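/- arXiv:0804.3855 — 4 statements merged into one kernel-verified Lean document; each statement's English description precedes it below -/
import Mathlib

section
/- Let k : 𝔻∖{0} → ℝ be a bounded, nonpositive, continuous function that extends to a locally Hölder continuous function on 𝔻, and let u : 𝔻∖{0} → ℝ be a C² solution of Δu(z) = k(z)·e^{2u(z)} on 𝔻∖{0} with ∬_𝔻 e^{2u(z)} dxdy < ∞, and write u(z) = γ·log|z| + r(z) with γ > −1 and r continuous on 𝔻. If γ ≥ 0, then the remainder r is of class C² on all of 𝔻. -/
open Metric MeasureTheory
open scoped ENNReal NNReal

/-- The Laplacian Δu = ∂²u/∂x² + ∂²u/∂y² of a function on ℂ ≅ ℝ². -/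
noncomputable def lapl (u : ℂ → ℝ) (z : ℂ) : ℝ :=
  fderiv ℝ (fun w => fderiv ℝ u w 1) z 1
    + fderiv ℝ (fun w => fderiv ℝ u w Complex.I) z Complex.I

section

open Complex Filter Topology ComplexConjugate

/-- The (unnormalized) Cauchy–Riemann operator `∂₁ + i ∂₂`. -/
noncomputable def dbar (G : ℂ → ℂ) (z : ℂ) : ℂ := fderiv ℝ G z 1 + I * fderiv ℝ G z I

/-- The (unnormalized) conjugate Cauchy–Riemann operator `∂₁ - i ∂₂`. -/
noncomputable def del (G : ℂ → ℂ) (z : ℂ) : ℂ := fderiv ℝ G z 1 - I * fderiv ℝ G z I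

lemma dbar_mul {F G : ℂ → ℂ} {z : ℂ} (hF : DifferentiableAt ℝ F z) (hG : DifferentiableAt ℝ G z) :
    dbar (fun w => F w * G w) z = F z * dbar G z + G z * dbar F z := by
  simp only [dbar, fderiv_fun_mul hF hG, add_apply,
    smul_apply, smul_eq_mul]
  ring

lemma del_mul {F G : ℂ → ℂ} {z : ℂ} (hF : DifferentiableAt ℝ F z) (hG : DifferentiableAt ℝ G z) :
    del (fun w => F w * G w) z = F z * del G z + G z * del F z := by
  simp only [del, fderiv_fun_mul hF hG, add_apply,
    smul_apply, smul_eq_mul]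
  ring

lemma dbar_sub {F G : ℂ → ℂ} {z : ℂ} (hF : DifferentiableAt ℝ F z) (hG : DifferentiableAt ℝ G z) :
    dbar (fun w => F w - G w) z = dbar F z - dbar G z := by
  simp only [dbar, fderiv_fun_sub hF hG, sub_apply]
  ring

lemma dbar_const (c z : ℂ) : dbar (fun _ => c) z = 0 := by
  simp [dbar]

lemma dbar_of_differentiableAt {F : ℂ → ℂ} {z : ℂ} (hF : DifferentiableAt ℂ F z) :
    dbar F z = 0 := by
  have h : fderiv ℂ F z I = I * fderiv ℂ F z 1 := by
    simp
  simp only [dbar, hF.fderiv_restrictScalars ℝ, ContinuousLinearMap.coe_restrictScalars', h]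
  rw [← mul_assoc, I_mul_I]
  ring

lemma Filter.EventuallyEq.dbar_eq {F G : ℂ → ℂ} {z : ℂ} (h : F =ᶠ[𝓝 z] G) :
    dbar F z = dbar G z := by
  simp only [dbar, h.fderiv_eq]

lemma dbar_eq_zero_of_notMem_tsupport {F : ℂ → ℂ} {z : ℂ} (h : z ∉ tsupport F) : dbar F z = 0 := by
  have : F =ᶠ[𝓝 z] fun _ => 0 := notMem_tsupport_iff_eventuallyEq.1 h
  rw [this.dbar_eq, dbar_const]

lemma del_eq_zero_of_notMem_tsupport {F : ℂ → ℂ} {z : ℂ} (h : z ∉ tsupport F) : del F z = 0 := by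
  have : F =ᶠ[𝓝 z] fun _ => 0 := notMem_tsupport_iff_eventuallyEq.1 h
  simp [del, this.fderiv_eq]

lemma ContDiff.continuous_dbar {F : ℂ → ℂ} (h : ContDiff ℝ 1 F) : Continuous (dbar F) := by
  have := h.continuous_fderiv (by norm_num)
  unfold dbar
  fun_prop

lemma ContDiff.contDiff_dbar {F : ℂ → ℂ} {n m : WithTop ℕ∞} (h : ContDiff ℝ n F) (hm : m + 1 ≤ n) :
    ContDiff ℝ m (dbar F) := by
  have := h.fderiv_right hm
  unfold dbar
  fun_prop

lemma HasCompactSupport.dbar {F : ℂ → ℂ} (h : HasCompactSupport F) : HasCompactSupport (dbar F) :=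
  h.mono' fun z hz => by
    by_contra hc
    exact hz (dbar_eq_zero_of_notMem_tsupport hc)

lemma integral_fderiv_apply_eq_zero {G : ℂ → ℂ} (hG : ContDiff ℝ 1 G) (hc : HasCompactSupport G)
    (v : ℂ) : ∫ z, fderiv ℝ G z v = 0 := by
  have hi : Integrable (fun z => fderiv ℝ G z v) :=
    ((hG.continuous_fderiv (by norm_num)).clm_apply continuous_const).integrable_of_hasCompactSupport
      (hc.fderiv_apply (𝕜 := ℝ) v)
  have := integral_mul_fderiv_eq_neg_fderiv_mul_of_integrable (μ := volume)
    (f := fun _ : ℂ => (1 : ℂ)) (g := G) (v := v) (by simp) (by simpa using hi)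
    (by simpa using hG.continuous.integrable_of_hasCompactSupport hc)
    (by simp) (fun x _ => (hG.differentiable (by norm_num)) x)
  simpa using this

lemma integrable_fderiv_apply {G : ℂ → ℂ} (hG : ContDiff ℝ 1 G) (hc : HasCompactSupport G)
    (v : ℂ) : Integrable (fun z => fderiv ℝ G z v) :=
  ((hG.continuous_fderiv (by norm_num)).clm_apply continuous_const).integrable_of_hasCompactSupport
      (hc.fderiv_apply (𝕜 := ℝ) v)

lemma integral_dbar_eq_zero_of_contDiff {G : ℂ → ℂ} (hG : ContDiff ℝ 1 G)
    (hc : HasCompactSupport G) : ∫ z, dbar G z = 0 := by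
  unfold dbar
  rw [integral_add (integrable_fderiv_apply hG hc 1) ((integrable_fderiv_apply hG hc I).const_mul I),
    integral_const_mul, integral_fderiv_apply_eq_zero hG hc, integral_fderiv_apply_eq_zero hG hc]
  simp

lemma integral_del_eq_zero_of_contDiff {G : ℂ → ℂ} (hG : ContDiff ℝ 1 G)
    (hc : HasCompactSupport G) : ∫ z, del G z = 0 := by
  unfold del
  rw [integral_sub (integrable_fderiv_apply hG hc 1) ((integrable_fderiv_apply hG hc I).const_mul I),
    integral_const_mul, integral_fderiv_apply_eq_zero hG hc, integral_fderiv_apply_eq_zero hG hc]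
  simp

lemma exists_cutoff {a b : ℝ} (ha : 0 < a) (hab : a < b) : ∃ χ : ℂ → ℂ, ContDiff ℝ 3 χ ∧
    HasCompactSupport χ ∧ tsupport χ ⊆ closedBall 0 b ∧ (∀ z, ‖z‖ ≤ a → χ z = 1) ∧
    (∀ z, ‖χ z‖ ≤ 1) ∧ (∀ z, 0 ≤ (χ z).re) := by
  let e : ContDiffBump (0 : ℂ) := ⟨a, b, ha, hab⟩
  have hs : tsupport (fun z => ((e z : ℝ) : ℂ)) ⊆ closedBall 0 b := by
    refine closure_minimal (fun z hz => ?_) isClosed_closedBall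
    have : z ∈ Function.support e := by simpa using hz
    rw [e.support_eq] at this
    exact ball_subset_closedBall this
  refine ⟨fun z => ((e z : ℝ) : ℂ), ?_, ?_, hs, ?_, ?_, ?_⟩
  · exact ofRealCLM.contDiff.comp e.contDiff
  · exact (isCompact_closedBall 0 b).of_isClosed_subset (isClosed_tsupport _) hs
  · intro z hz
    have := e.one_of_mem_closedBall (x := z) (by simpa using hz)
    simp [this]
  · intro z
    simp only [norm_real, Real.norm_eq_abs, abs_of_nonneg e.nonneg]
    exact e.le_one
  · intro z; simpa using e.nonneg

lemma aestronglyMeasurable_of_continuousOn_compl {G : ℂ → ℂ} {S : Finset ℂ}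
    (hG : ContinuousOn G (S : Set ℂ)ᶜ) : AEStronglyMeasurable G volume := by
  have h := hG.aestronglyMeasurable (μ := volume) S.measurableSet.compl
  rwa [Measure.restrict_eq_self_of_ae_mem] at h
  exact compl_mem_ae_iff.2 (S.finite_toSet.measure_zero volume)

lemma fderiv_comp_affine {F : ℂ → ℂ} {c : ℝ} {b z : ℂ} (hF : DifferentiableAt ℝ F (c * z + b))
    (v : ℂ) : fderiv ℝ (fun w => F (c * w + b)) z v = c * fderiv ℝ F (c * z + b) v := by
  have h1 : HasFDerivAt (fun w : ℂ => (c : ℂ) * w + b) (c • ContinuousLinearMap.id ℝ ℂ) z := by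
    have := ((hasFDerivAt_id (𝕜 := ℝ) z).const_smul c).add_const b
    simpa using this
  have h2 : HasFDerivAt (fun w => F (c * w + b)) _ z := hF.hasFDerivAt.comp z h1
  simp [h2.fderiv]

lemma integral_dbar_eq_zero (S : Finset ℂ) : ∀ G : ℂ → ℂ, ContDiffOn ℝ 1 G (S : Set ℂ)ᶜ →
    HasCompactSupport G → (∀ a ∈ S, Tendsto (fun ζ => (ζ - a) * G ζ) (𝓝[≠] a) (𝓝 0)) →
    Integrable (dbar G) → ∫ z, dbar G z = 0 := by
  induction S using Finset.induction_on with
  | empty =>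
    intro G hG hc _ _
    refine integral_dbar_eq_zero_of_contDiff ?_ hc
    simpa [contDiffOn_univ] using hG
  | insert a S haS ih =>
    intro G hG hc hS hi
    obtain ⟨e, he, hec, hes, he1, heb, -⟩ := exists_cutoff (a := 1) (b := 2) one_pos one_lt_two
    obtain ⟨C, hC⟩ : ∃ C, ∀ z, ‖dbar e z‖ ≤ C :=
      hec.dbar.exists_bound_of_continuous (he.of_le (by norm_num)).continuous_dbar
    have hC0 : 0 ≤ C := (norm_nonneg _).trans (hC 0)
    have hopen : IsOpen ((insert a S : Finset ℂ) : Set ℂ)ᶜ :=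
      (Finset.finite_toSet _).isClosed.isOpen_compl
    let N : ℕ → ℝ := fun n => n + 1
    have hN : ∀ n, 0 < N n := fun n => by positivity
    let η : ℕ → ℂ → ℂ := fun n ζ => e ((N n : ℂ) * (ζ - a))
    have hηs : ∀ n, ContDiff ℝ 1 (η n) := fun n =>
      (he.of_le (by norm_num)).comp (by fun_prop)
    have hη1 : ∀ n ζ, ‖ζ - a‖ ≤ (N n)⁻¹ → η n ζ = 1 := by
      intro n ζ h
      apply he1
      rw [norm_mul, norm_real, Real.norm_of_nonneg (hN n).le]
      calc N n * ‖ζ - a‖ ≤ N n * (N n)⁻¹ := by gcongr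
        _ = 1 := mul_inv_cancel₀ (hN n).ne'
    have hη0 : ∀ n ζ, 2 / N n < ‖ζ - a‖ → η n ζ = 0 := by
      intro n ζ h
      refine image_eq_zero_of_notMem_tsupport (f := e) fun hm => ?_
      have := hes hm
      rw [mem_closedBall, dist_zero_right, norm_mul, norm_real, Real.norm_of_nonneg (hN n).le] at this
      rw [div_lt_iff₀ (hN n)] at h
      linarith
    have hηa : ∀ n, η n =ᶠ[𝓝 a] fun _ => 1 := by
      intro n
      filter_upwards [closedBall_mem_nhds a (inv_pos.2 (hN n))] with ζ hζ
      exact hη1 n ζ (by simpa [dist_eq_norm] using hζ)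
    have hηd : ∀ n ζ, dbar (η n) ζ = N n * dbar e (N n * (ζ - a)) := by
      intro n ζ
      have h1 : η n = fun ζ => e ((N n : ℂ) * ζ + -(N n * a)) := by
        funext ζ
        simp only [η]
        ring_nf
      have h2 : (N n : ℂ) * (ζ - a) = N n * ζ + -(N n * a) := by ring
      have h3 := fun v => fderiv_comp_affine (b := -(N n * a)) (c := N n) (z := ζ)
        ((he.differentiable (by norm_num)) _) v
      simp only [dbar, h1, h2, h3]
      ring
    have hηd0 : ∀ n ζ, 2 / N n < ‖ζ - a‖ → dbar (η n) ζ = 0 := by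
      intro n ζ h
      have : η n =ᶠ[𝓝 ζ] fun _ => 0 := by
        have ho : IsOpen {w : ℂ | 2 / N n < ‖w - a‖} :=
          isOpen_lt continuous_const (by fun_prop)
        filter_upwards [ho.mem_nhds h] with w hw using hη0 n w hw
      rw [this.dbar_eq, dbar_const]
    have hGm : AEStronglyMeasurable G volume :=
      aestronglyMeasurable_of_continuousOn_compl hG.continuousOn
    -- pointwise control of the error term
    have hbound : ∀ ε > 0, ∀ᶠ n in atTop, ∀ ζ, ζ ≠ a → ‖G ζ * dbar (η n) ζ‖ ≤
        (closedBall a (2 / N n)).indicator (fun _ => ε * C * N n ^ 2) ζ := by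
      intro ε hε
      have h := hS a (Finset.mem_insert_self a S)
      rw [Metric.tendsto_nhdsWithin_nhds] at h
      obtain ⟨δ, hδ, h⟩ := h ε hε
      have hlim : Tendsto (fun n => 2 / N n) atTop (𝓝 0) :=
        (tendsto_const_nhds (x := (2:ℝ))).div_atTop
          (tendsto_atTop_add_const_right _ _ tendsto_natCast_atTop_atTop)
      filter_upwards [hlim.eventually_lt_const hδ] with n hn ζ hζ
      by_cases hm : ζ ∈ closedBall a (2 / N n)
      · rw [Set.indicator_of_mem hm]
        have h1 : ‖(ζ - a) * G ζ‖ ≤ ε := by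
          simpa using (h hζ (lt_of_le_of_lt hm hn)).le
        by_cases h2 : ‖ζ - a‖ < (N n)⁻¹
        · have : η n =ᶠ[𝓝 ζ] fun _ => 1 := by
            have ho : IsOpen {w : ℂ | ‖w - a‖ < (N n)⁻¹} :=
              isOpen_lt (by fun_prop) continuous_const
            filter_upwards [ho.mem_nhds h2] with w hw using hη1 n w (le_of_lt hw)
          rw [this.dbar_eq, dbar_const]
          simp only [mul_zero, norm_zero]
          positivity
        · push Not at h2
          have h3 : ‖G ζ‖ ≤ ε * N n := by
            rw [norm_mul] at h1
            calc ‖G ζ‖ = N n * ((N n)⁻¹ * ‖G ζ‖) := by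
                  rw [← mul_assoc, mul_inv_cancel₀ (hN n).ne', one_mul]
              _ ≤ N n * (‖ζ - a‖ * ‖G ζ‖) := by gcongr
              _ ≤ N n * ε := by gcongr
              _ = ε * N n := mul_comm _ _
          rw [norm_mul, hηd, norm_mul, norm_real, Real.norm_of_nonneg (hN n).le]
          calc ‖G ζ‖ * (N n * ‖dbar e (N n * (ζ - a))‖) ≤ (ε * N n) * (N n * C) := by
                have := hN n
                gcongr
                exact hC _
            _ = ε * C * N n ^ 2 := by ring
      · rw [Set.indicator_of_notMem hm, hηd0 n ζ (by simpa [dist_eq_norm] using hm)]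
        simp
    have hae : ∀ᵐ ζ : ℂ, ζ ≠ a := by
      exact compl_mem_ae_iff.2 (measure_singleton (μ := volume) a)
    have hind : ∀ (n : ℕ) (c : ℝ), Integrable ((closedBall a (2 / N n)).indicator (fun _ => c)) :=
      fun n c => (integrable_indicator_iff measurableSet_closedBall).2
        (integrableOn_const (measure_closedBall_lt_top).ne)
    have herr_int : ∀ᶠ n in atTop, Integrable (fun ζ => G ζ * dbar (η n) ζ) := by
      filter_upwards [hbound 1 one_pos] with n hn
      refine (hind n (1 * C * N n ^ 2)).mono' (hGm.mul (hηs n).continuous_dbar.aestronglyMeasurable) ?_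
      filter_upwards [hae] with ζ hζ using hn ζ hζ
    have herr : Tendsto (fun n => ∫ ζ, G ζ * dbar (η n) ζ) atTop (𝓝 0) := by
      rw [Metric.tendsto_nhds]
      intro ε hε
      filter_upwards [hbound (ε / (4 * Real.pi * C + 1)) (by positivity)] with n hn
      rw [dist_zero_right]
      set ε' := ε / (4 * Real.pi * C + 1) with hε'
      calc ‖∫ ζ, G ζ * dbar (η n) ζ‖ ≤ ∫ ζ,
            (closedBall a (2 / N n)).indicator (fun _ => ε' * C * N n ^ 2) ζ := by
            refine norm_integral_le_of_norm_le (hind n _) ?_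
            filter_upwards [hae] with ζ hζ using hn ζ hζ
        _ = 4 * Real.pi * C * ε' := by
            rw [integral_indicator measurableSet_closedBall, setIntegral_const]
            have : volume.real (closedBall a (2 / N n)) = Real.pi * (2 / N n) ^ 2 := by
              rw [Measure.real, Complex.volume_closedBall]
              rw [ENNReal.toReal_mul, ENNReal.toReal_pow, ENNReal.toReal_ofReal
                (div_nonneg zero_le_two (hN n).le)]
              simp [mul_comm]
            rw [this, smul_eq_mul]
            have := (hN n).ne'
            field_simp
            ring
        _ < ε := by
            rw [hε', mul_div_assoc', div_lt_iff₀ (by positivity)]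
            nlinarith
    let F : ℕ → ℂ → ℂ := fun n ζ => (1 - η n ζ) * G ζ
    have hFd : ∀ n ζ, ζ ∉ insert a S → dbar (F n) ζ = (1 - η n ζ) * dbar G ζ - G ζ * dbar (η n) ζ := by
      intro n ζ hζ
      have h1 : DifferentiableAt ℝ G ζ :=
        (hG.contDiffAt (hopen.mem_nhds (by simpa using hζ))).differentiableAt (by norm_num)
      have h2 : DifferentiableAt ℝ (η n) ζ := (hηs n).differentiable (by norm_num) ζ
      show dbar (fun w => (1 - η n w) * G w) ζ = _
      rw [dbar_mul (by fun_prop) h1, dbar_sub (by fun_prop) h2, dbar_const]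
      ring
    have hFae : ∀ n, dbar (F n) =ᵐ[volume] fun ζ => (1 - η n ζ) * dbar G ζ - G ζ * dbar (η n) ζ := by
      intro n
      have : ∀ᵐ ζ : ℂ, ζ ∈ ((insert a S : Finset ℂ) : Set ℂ)ᶜ :=
        compl_mem_ae_iff.2 ((Finset.finite_toSet _).measure_zero volume)
      filter_upwards [this] with ζ hζ using hFd n ζ (by simpa using hζ)
    have hηb : ∀ n ζ, ‖1 - η n ζ‖ ≤ 2 := fun n ζ =>
      (norm_sub_le _ _).trans (by
        have := heb ((N n : ℂ) * (ζ - a))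
        simp only [norm_one, η]
        linarith)
    have hmain_int : ∀ n, Integrable (fun ζ => (1 - η n ζ) * dbar G ζ) := fun n =>
      hi.bdd_mul (continuous_const.sub (hηs n).continuous).aestronglyMeasurable
        (Eventually.of_forall (hηb n))
    have hzero : ∀ᶠ n in atTop, ∫ ζ, (1 - η n ζ) * dbar G ζ = ∫ ζ, G ζ * dbar (η n) ζ := by
      filter_upwards [herr_int] with n hn
      have hz : ∫ ζ, dbar (F n) ζ = 0 := by
        refine ih (F n) ?_ hc.mul_left ?_ (((hmain_int n).sub hn).congr (hFae n).symm)
        · intro ζ hζ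
          refine ContDiffAt.contDiffWithinAt ?_
          by_cases hζa : ζ = a
          · subst hζa
            refine contDiffAt_const (c := (0 : ℂ)) |>.congr_of_eventuallyEq ?_
            filter_upwards [hηa n] with w hw
            simp [F, hw]
          · refine (contDiffAt_const.sub (hηs n).contDiffAt).mul (hG.contDiffAt (hopen.mem_nhds ?_))
            simpa [hζa] using hζ
        · intro b hb
          have h1 := hS b (Finset.mem_insert_of_mem hb)
          rw [tendsto_zero_iff_norm_tendsto_zero] at h1 ⊢
          refine squeeze_zero (fun _ => norm_nonneg _) (fun ζ => ?_) (by simpa using h1.const_mul 2)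
          calc ‖(ζ - b) * F n ζ‖ = ‖1 - η n ζ‖ * ‖(ζ - b) * G ζ‖ := by
                rw [← norm_mul]; simp only [F]; ring_nf
            _ ≤ 2 * (‖ζ - b‖ * ‖G ζ‖) := by
                rw [norm_mul (ζ - b)]; gcongr; exact hηb n ζ
      rw [integral_congr_ae (hFae n), integral_sub (hmain_int n) hn] at hz
      exact sub_eq_zero.1 hz
    have hlim : Tendsto (fun n => ∫ ζ, (1 - η n ζ) * dbar G ζ) atTop (𝓝 (∫ ζ, dbar G ζ)) := by
      refine tendsto_integral_of_dominated_convergence (fun ζ => 2 * ‖dbar G ζ‖)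
        (fun n => (hmain_int n).aestronglyMeasurable) (hi.norm.const_mul 2)
        (fun n => Eventually.of_forall fun ζ => ?_) ?_
      · rw [norm_mul]; gcongr; exact hηb n ζ
      · filter_upwards [hae] with ζ hζ
        refine tendsto_const_nhds.congr' ?_
        have hlim : Tendsto (fun n => 2 / N n) atTop (𝓝 0) :=
          (tendsto_const_nhds (x := (2:ℝ))).div_atTop
            (tendsto_atTop_add_const_right _ _ tendsto_natCast_atTop_atTop)
        filter_upwards [hlim.eventually_lt_const (norm_pos_iff.2 (sub_ne_zero.2 hζ))] with n hn
        rw [hη0 n ζ hn]; simp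
    exact tendsto_nhds_unique (hlim.congr' hzero) herr

lemma contDiffAt_inv_pow {z ζ : ℂ} (h : ζ ≠ z) (m : ℕ) {n : WithTop ℕ∞} :
    ContDiffAt ℝ n (fun w => ((w - z) ^ m)⁻¹) ζ := by
  refine ContDiffAt.inv (by fun_prop) ?_
  exact pow_ne_zero _ (sub_ne_zero.2 h)

lemma dbar_inv_pow {z ζ : ℂ} (h : ζ ≠ z) (m : ℕ) : dbar (fun w => ((w - z) ^ m)⁻¹) ζ = 0 := by
  apply dbar_of_differentiableAt
  have : (ζ - z) ^ m ≠ 0 := pow_ne_zero _ (sub_ne_zero.2 h)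
  fun_prop (disch := assumption)

/-- A function vanishing near `z` may be divided by powers of `ζ - z`. -/
lemma continuous_mul_inv_pow {φ : ℂ → ℂ} (hφ : Continuous φ) {z : ℂ} (hz : φ =ᶠ[𝓝 z] fun _ => 0)
    (m : ℕ) : Continuous fun ζ => φ ζ * ((ζ - z) ^ m)⁻¹ := by
  rw [continuous_iff_continuousAt]
  intro ζ
  by_cases h : ζ = z
  · subst h
    refine (continuousAt_const (y := (0 : ℂ))).congr ?_
    filter_upwards [hz] with w hw
    simp [hw]
  · exact hφ.continuousAt.mul (contDiffAt_inv_pow h m (n := 1)).continuousAt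

lemma integrable_mul_inv_pow {φ : ℂ → ℂ} (hφ : Continuous φ) (hc : HasCompactSupport φ) {z : ℂ}
    (hz : φ =ᶠ[𝓝 z] fun _ => 0) (m : ℕ) : Integrable fun ζ => φ ζ * ((ζ - z) ^ m)⁻¹ :=
  (continuous_mul_inv_pow hφ hz m).integrable_of_hasCompactSupport hc.mul_right

lemma continuous_dbar_mul {χ q : ℂ → ℂ} {U : Set ℂ} {s : ℂ} (hU : IsOpen U) (hχ : ContDiff ℝ 2 χ)
    (hχU : tsupport χ ⊆ U) (hχs : dbar χ =ᶠ[𝓝 s] fun _ => 0) (hq : ContinuousOn q (U \ {s})) :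
    Continuous fun ζ => dbar χ ζ * q ζ := by
  rw [continuous_iff_continuousAt]
  intro ζ
  by_cases h : ζ = s
  · subst h
    refine (continuousAt_const (y := (0 : ℂ))).congr ?_
    filter_upwards [hχs] with w hw
    simp [hw]
  · by_cases h2 : ζ ∈ tsupport χ
    · exact (hχ.of_le (by norm_num)).continuous_dbar.continuousAt.mul
        (hq.continuousAt ((hU.sdiff isClosed_singleton).mem_nhds ⟨hχU h2, h⟩))
    · refine (continuousAt_const (y := (0 : ℂ))).congr ?_
      filter_upwards [(isClosed_tsupport χ).isOpen_compl.mem_nhds h2] with w hw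
      rw [dbar_eq_zero_of_notMem_tsupport hw, zero_mul]

lemma Filter.EventuallyEq.dbar_eventuallyEq_zero {χ : ℂ → ℂ} {z c : ℂ}
    (h : χ =ᶠ[𝓝 z] fun _ => c) : dbar χ =ᶠ[𝓝 z] fun _ => 0 := by
  filter_upwards [h.eventuallyEq_nhds] with w hw
  rw [hw.dbar_eq, dbar_const]

/-- Cauchy–Pompeiu type identity with kernel `(ζ - z)⁻ᵐ` for a function `q` vanishing to order `> m - 1`
at `z`, with a possible weak singularity at `s`. -/
lemma integral_cauchy_pompeiu {χ q g : ℂ → ℂ} {U : Set ℂ} {s z : ℂ} {m : ℕ} (hU : IsOpen U)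
    (hχ : ContDiff ℝ 2 χ) (hχc : HasCompactSupport χ) (hχU : tsupport χ ⊆ U)
    (hχz : dbar χ =ᶠ[𝓝 z] fun _ => 0) (hχs : dbar χ =ᶠ[𝓝 s] fun _ => 0) (hzs : z ≠ s)
    (hq : ContDiffOn ℝ 1 q (U \ {s})) (hqg : ∀ ζ ∈ U \ {s}, dbar q ζ = g ζ)
    (hqz : Tendsto (fun ζ => q ζ * ((ζ - z) ^ m)⁻¹ * (ζ - z)) (𝓝[≠] z) (𝓝 0))
    (hqs : Tendsto (fun ζ => χ ζ * q ζ * (ζ - s)) (𝓝[≠] s) (𝓝 0))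
    (hg : Integrable fun ζ => χ ζ * g ζ * ((ζ - z) ^ m)⁻¹) :
    (∫ ζ, χ ζ * g ζ * ((ζ - z) ^ m)⁻¹) + ∫ ζ, dbar χ ζ * q ζ * ((ζ - z) ^ m)⁻¹ = 0 := by
  have hUs : IsOpen (U \ {s}) := hU.sdiff isClosed_singleton
  have hI : Integrable fun ζ => dbar χ ζ * q ζ * ((ζ - z) ^ m)⁻¹ := by
    refine integrable_mul_inv_pow (continuous_dbar_mul hU hχ hχU hχs hq.continuousOn)
      hχc.dbar.mul_right ?_ m
    filter_upwards [hχz] with w hw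
    simp [hw]
  let G : ℂ → ℂ := fun ζ => χ ζ * (q ζ * ((ζ - z) ^ m)⁻¹)
  have hGd : ∀ ζ, ζ ≠ z → ζ ≠ s → dbar G ζ =
      χ ζ * g ζ * ((ζ - z) ^ m)⁻¹ + dbar χ ζ * q ζ * ((ζ - z) ^ m)⁻¹ := by
    intro ζ h1 h2
    by_cases h : ζ ∈ tsupport χ
    · have hm : ζ ∈ U \ {s} := ⟨hχU h, h2⟩
      have d1 : DifferentiableAt ℝ χ ζ := hχ.differentiable (by norm_num) ζ
      have d2 : DifferentiableAt ℝ q ζ :=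
        (hq.contDiffAt (hUs.mem_nhds hm)).differentiableAt (by norm_num)
      have d3 := (contDiffAt_inv_pow h1 m (n := 1)).differentiableAt (by norm_num)
      simp only [G]
      rw [dbar_mul d1 (d2.fun_mul d3), dbar_mul d2 d3, dbar_inv_pow h1, hqg ζ hm]
      ring
    · have : ζ ∉ tsupport G := fun hc => h (tsupport_mul_subset_left hc)
      rw [dbar_eq_zero_of_notMem_tsupport this, dbar_eq_zero_of_notMem_tsupport h,
        image_eq_zero_of_notMem_tsupport h]
      simp
  have hae : dbar G =ᵐ[volume] fun ζ =>
      χ ζ * g ζ * ((ζ - z) ^ m)⁻¹ + dbar χ ζ * q ζ * ((ζ - z) ^ m)⁻¹ := by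
    have : ∀ᵐ ζ : ℂ, ζ ∈ (({z, s} : Finset ℂ) : Set ℂ)ᶜ :=
      compl_mem_ae_iff.2 ((Finset.finite_toSet _).measure_zero volume)
    filter_upwards [this] with ζ hζ
    simp only [Finset.coe_insert, Finset.coe_singleton, Set.mem_compl_iff, Set.mem_insert_iff,
      Set.mem_singleton_iff, not_or] at hζ
    exact hGd ζ hζ.1 hζ.2
  have h0 := integral_dbar_eq_zero {z, s} G ?_ hχc.mul_right ?_ ((hg.add hI).congr hae.symm)
  · rw [integral_congr_ae hae, integral_add hg hI] at h0
    exact h0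
  · intro ζ hζ
    simp only [Finset.coe_insert, Finset.coe_singleton, Set.mem_compl_iff, Set.mem_insert_iff,
      Set.mem_singleton_iff, not_or] at hζ
    refine ContDiffAt.contDiffWithinAt ?_
    by_cases h : ζ ∈ tsupport χ
    · exact (hχ.of_le (by norm_num)).contDiffAt.mul ((hq.contDiffAt
        (hUs.mem_nhds ⟨hχU h, hζ.2⟩)).mul (contDiffAt_inv_pow hζ.1 m))
    · refine (contDiffAt_const (c := (0 : ℂ))).congr_of_eventuallyEq ?_
      filter_upwards [(isClosed_tsupport χ).isOpen_compl.mem_nhds h] with w hw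
      simp [G, image_eq_zero_of_notMem_tsupport hw]
  · intro a ha
    have hχb := hχ.continuous
    rw [Finset.mem_insert, Finset.mem_singleton] at ha
    rcases ha with rfl | rfl
    · have := (hχb.continuousAt.mono_left nhdsWithin_le_nhds : Tendsto χ (𝓝[≠] a) (𝓝 (χ a))).mul hqz
      rw [mul_zero] at this
      refine this.congr fun ζ => ?_
      simp only [G]; ring
    · have h1 : Tendsto (fun ζ => ((ζ - z) ^ m)⁻¹) (𝓝[≠] a) (𝓝 (((a - z) ^ m)⁻¹)) :=
        (contDiffAt_inv_pow hzs.symm m (n := 1)).continuousAt.mono_left nhdsWithin_le_nhds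
      have := hqs.mul h1
      rw [zero_mul] at this
      refine this.congr fun ζ => ?_
      simp only [G]; ring

lemma integrable_indicator_norm_rpow {t : ℝ} (ht : -2 < t) (R : ℝ) :
    Integrable ((closedBall (0 : ℂ) R).indicator fun w => ‖w‖ ^ t) := by
  have h := (integrable_fun_norm_addHaar (volume : Measure ℂ)
    (f := (Set.Iic R).indicator fun y : ℝ => y ^ t)).2 ?_
  · refine h.congr (Eventually.of_forall fun w => ?_)
    simp [Set.indicator]
  · rcases le_or_gt R 0 with hR | hR
    · refine (integrableOn_zero).congr_fun (fun y hy => ?_) measurableSet_Ioi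
      have : y ∉ Set.Iic R := by
        simp only [Set.mem_Iic, not_le]; exact hR.trans_lt hy
      simp [Set.indicator_of_notMem this]
    · have h1 : IntegrableOn (fun y : ℝ => y ^ (t + 1)) (Set.Ioc 0 R) :=
        (intervalIntegrable_iff_integrableOn_Ioc_of_le hR.le).1
          (intervalIntegral.intervalIntegrable_rpow' (by linarith))
      have h2 := (integrable_indicator_iff measurableSet_Ioc).2 h1
      refine (h2.integrableOn (s := Set.Ioi 0)).congr_fun (fun y hy => ?_) measurableSet_Ioi
      have hy : 0 < y := hy
      by_cases hyR : y ≤ R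
      · simp [Set.indicator, hy, hyR, Real.rpow_add hy, mul_comm]
      · simp [Set.indicator, hyR]

lemma continuousAt_integral_mul_inv_pow {φ : ℂ → ℂ} (hφ : Continuous φ) (hc : HasCompactSupport φ)
    {δ : ℝ} (hδ : 0 < δ) (h0 : ∀ ζ, ‖ζ‖ < δ → φ ζ = 0) (m : ℕ) :
    ContinuousAt (fun z => ∫ ζ, φ ζ * ((ζ - z) ^ m)⁻¹) 0 := by
  have hz0 : ∀ z, ‖z‖ < δ → φ =ᶠ[𝓝 z] fun _ => 0 := fun z hz => by
    filter_upwards [(isOpen_lt continuous_norm continuous_const).mem_nhds hz] with w hw using h0 w hw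
  refine continuousAt_of_dominated (bound := fun ζ => ‖φ ζ‖ * ((δ / 2) ^ m)⁻¹) ?_ ?_
    ((hφ.integrable_of_hasCompactSupport hc).norm.mul_const _) ?_
  · filter_upwards [ball_mem_nhds (0 : ℂ) hδ] with z hz
    exact (continuous_mul_inv_pow hφ (hz0 z (by simpa using hz)) m).aestronglyMeasurable
  · filter_upwards [ball_mem_nhds (0 : ℂ) (half_pos hδ)] with z hz
    refine Eventually.of_forall fun ζ => ?_
    by_cases h : ‖ζ‖ < δ
    · simp [h0 ζ h]
    · rw [norm_mul, norm_inv, norm_pow]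
      gcongr
      have h1 : ‖z‖ < δ / 2 := by simpa using hz
      have := norm_sub_norm_le ζ z
      linarith
  · refine Eventually.of_forall fun ζ => ?_
    by_cases h : ζ = 0
    · subst h
      simpa [h0 0 (by simpa using hδ)] using continuousAt_const
    · refine continuousAt_const.mul (ContinuousAt.inv₀ (by fun_prop) ?_)
      simpa using fun h' => absurd h' h

lemma dbar_conj (z : ℂ) : dbar (fun w => (starRingEnd ℂ) w) z = 2 := by
  have : fderiv ℝ (fun w => (starRingEnd ℂ) w) z = conjCLE.toContinuousLinearMap :=
    conjCLE.toContinuousLinearMap.hasFDerivAt.fderiv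
  simp only [dbar, this]
  simp [one_add_one_eq_two]

lemma dbar_add_const (F : ℂ → ℂ) (c z : ℂ) : dbar (fun w => F w + c) z = dbar F z := by
  simp [dbar, fderiv_add_const]

lemma re_integral_dbar_mul_conj_le {χ : ℂ → ℂ} (hχ : ContDiff ℝ 2 χ) (hχc : HasCompactSupport χ)
    {δ t : ℝ} (hχ1 : ∀ z, ‖z‖ ≤ δ → χ z = 1) (hre : ∀ z, 0 ≤ (χ z).re)
    (ht : 0 < t) (htδ : t ≤ δ) :
    (∫ ζ, dbar χ ζ * ((starRingEnd ℂ) ζ * ((‖ζ‖ ^ 2 + t ^ 2 : ℝ) : ℂ)⁻¹)).re ≤ - (Real.pi / 2) := by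
  let D : ℂ → ℝ := fun ζ => ‖ζ‖ ^ 2 + t ^ 2
  have hD : ∀ ζ, 0 < D ζ := fun ζ => by positivity
  have hDC : ∀ ζ, (D ζ : ℂ) ≠ 0 := fun ζ => by exact_mod_cast (hD ζ).ne'
  have hDs : ContDiff ℝ 1 (fun ζ => (D ζ : ℂ)) :=
    ofRealCLM.contDiff.comp ((contDiff_norm_sq ℝ).add contDiff_const)
  have hconj : ContDiff ℝ 1 (fun ζ : ℂ => (starRingEnd ℂ) ζ) :=
    conjCLE.toContinuousLinearMap.contDiff
  let k : ℂ → ℂ := fun ζ => (starRingEnd ℂ) ζ * (D ζ : ℂ)⁻¹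
  have hk : ContDiff ℝ 1 k := hconj.mul (hDs.inv hDC)
  have hDeq : (fun ζ => (D ζ : ℂ)) = fun ζ => ζ * (starRingEnd ℂ) ζ + (t : ℂ) ^ 2 := by
    funext ζ
    simp only [D, mul_conj, normSq_eq_norm_sq]
    push_cast
    rfl
  have hDd : ∀ ζ, dbar (fun ζ => (D ζ : ℂ)) ζ = 2 * ζ := by
    intro ζ
    have h1 : DifferentiableAt ℝ (fun ζ : ℂ => ζ) ζ := differentiableAt_id
    have h2 : dbar (fun w : ℂ => w) ζ = 0 := dbar_of_differentiableAt differentiableAt_id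
    rw [hDeq, dbar_add_const, dbar_mul h1 (hconj.differentiable (by norm_num) ζ), dbar_conj, h2]
    ring
  have hkd : ∀ ζ, dbar k ζ = ((2 * t ^ 2 / D ζ ^ 2 : ℝ) : ℂ) := by
    intro ζ
    have h1 := dbar_mul (hk.differentiable (by norm_num) ζ) (hDs.differentiable (by norm_num) ζ)
    have h2 : (fun w => k w * (D w : ℂ)) = fun w => (starRingEnd ℂ) w := by
      funext w
      simp [k, hDC w]
    rw [h2, dbar_conj, hDd] at h1
    have h3 : ζ * (starRingEnd ℂ) ζ = (D ζ : ℂ) - t ^ 2 := by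
      rw [congrFun hDeq ζ]; ring
    have h4 : (D ζ : ℂ) * dbar k ζ = 2 * t ^ 2 * (D ζ : ℂ)⁻¹ := by
      have : k ζ * (2 * ζ) = 2 * (ζ * (starRingEnd ℂ) ζ) * (D ζ : ℂ)⁻¹ := by
        simp only [k]; ring
      rw [this, h3] at h1
      have h5 : (D ζ : ℂ) * (D ζ : ℂ)⁻¹ = 1 := mul_inv_cancel₀ (hDC ζ)
      linear_combination -h1 - 2 * h5
    push_cast
    rw [eq_div_iff (pow_ne_zero 2 (hDC ζ))]
    have h5 : (D ζ : ℂ) * (D ζ : ℂ)⁻¹ = 1 := mul_inv_cancel₀ (hDC ζ)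
    linear_combination (D ζ : ℂ) * h4 + 2 * (t : ℂ) ^ 2 * h5
  have hχ1' := hχ.of_le (m := 1) (by norm_num)
  have h0 := integral_dbar_eq_zero_of_contDiff (hχ1'.mul hk) hχc.mul_right
  have heq : ∀ ζ, dbar (fun w => χ w * k w) ζ =
      χ ζ * ((2 * t ^ 2 / D ζ ^ 2 : ℝ) : ℂ) + dbar χ ζ * k ζ := by
    intro ζ
    rw [dbar_mul (hχ1'.differentiable (by norm_num) ζ) (hk.differentiable (by norm_num) ζ), hkd]
    ring
  have hcD : Continuous D := by fun_prop
  have hi1 : Integrable fun ζ => χ ζ * ((2 * t ^ 2 / D ζ ^ 2 : ℝ) : ℂ) := by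
    refine Continuous.integrable_of_hasCompactSupport ?_ hχc.mul_right
    refine hχ.continuous.mul (continuous_ofReal.comp (continuous_const.div (hcD.pow 2) ?_))
    exact fun ζ => (pow_pos (hD ζ) 2).ne'
  have hi2 : Integrable fun ζ => dbar χ ζ * k ζ :=
    (hχ1'.continuous_dbar.mul hk.continuous).integrable_of_hasCompactSupport hχc.dbar.mul_right
  change ∫ ζ, dbar (fun w => χ w * k w) ζ = 0 at h0
  simp only [heq] at h0
  rw [integral_add hi1 hi2] at h0
  have h1 : Real.pi / 2 ≤ (∫ ζ, χ ζ * ((2 * t ^ 2 / D ζ ^ 2 : ℝ) : ℂ)).re := by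
    have hint : Integrable ((ball (0 : ℂ) t).indicator fun _ => (1 / (2 * t ^ 2) : ℝ)) :=
      (integrable_indicator_iff measurableSet_ball).2 (integrableOn_const measure_ball_lt_top.ne)
    have : (∫ ζ, (ball (0 : ℂ) t).indicator (fun _ => (1 / (2 * t ^ 2) : ℝ)) ζ) = Real.pi / 2 := by
      rw [integral_indicator measurableSet_ball, setIntegral_const, Measure.real,
        Complex.volume_ball, ENNReal.toReal_mul, ENNReal.toReal_pow, ENNReal.toReal_ofReal ht.le]
      simp only [ENNReal.coe_toReal, NNReal.coe_real_pi, smul_eq_mul]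
      field_simp
    rw [← this]
    have hre_eq : (∫ ζ, χ ζ * ((2 * t ^ 2 / D ζ ^ 2 : ℝ) : ℂ)).re
        = ∫ ζ, (χ ζ * ((2 * t ^ 2 / D ζ ^ 2 : ℝ) : ℂ)).re := (integral_re hi1).symm
    rw [hre_eq]
    refine integral_mono hint hi1.re fun ζ => ?_
    have hpos : 0 ≤ 2 * t ^ 2 / D ζ ^ 2 := by positivity
    show _ ≤ (χ ζ * ((2 * t ^ 2 / D ζ ^ 2 : ℝ) : ℂ)).re
    rw [re_mul_ofReal]
    by_cases h : ζ ∈ ball (0 : ℂ) t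
    · have hn : ‖ζ‖ < t := by simpa using h
      rw [Set.indicator_of_mem h, hχ1 ζ (hn.le.trans htδ), one_re, one_mul,
        div_le_div_iff₀ (by positivity) (pow_pos (hD ζ) 2)]
      have hD2 : D ζ ≤ 2 * t ^ 2 := by
        have := pow_le_pow_left₀ (norm_nonneg ζ) hn.le 2
        simp only [D]; linarith
      have := pow_le_pow_left₀ (hD ζ).le hD2 2
      linarith
    · rw [Set.indicator_of_notMem h]
      exact mul_nonneg (hre ζ) hpos
  have h2 := congrArg Complex.re h0
  rw [add_re, zero_re] at h2
  change (∫ ζ, dbar χ ζ * k ζ).re ≤ _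
  linarith

lemma integral_dbar_mul_inv_ne_zero {χ : ℂ → ℂ} (hχ : ContDiff ℝ 2 χ) (hχc : HasCompactSupport χ)
    {δ : ℝ} (hδ : 0 < δ) (hχ1 : ∀ z, ‖z‖ ≤ δ → χ z = 1) (hre : ∀ z, 0 ≤ (χ z).re) :
    ∫ ζ, dbar χ ζ * ((ζ - 0) ^ 1)⁻¹ ≠ 0 := by
  have hcd : Continuous (dbar χ) := (hχ.of_le (by norm_num)).continuous_dbar
  have hd0 : ∀ ζ, ‖ζ‖ < δ → dbar χ ζ = 0 := by
    intro ζ h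
    have : χ =ᶠ[𝓝 ζ] fun _ => 1 := by
      filter_upwards [(isOpen_lt continuous_norm continuous_const).mem_nhds h] with w hw
      exact hχ1 w (le_of_lt hw)
    rw [this.dbar_eq, dbar_const]
  have hcont : Tendsto (fun t : ℝ => ∫ ζ, dbar χ ζ * ((starRingEnd ℂ) ζ *
      ((‖ζ‖ ^ 2 + t ^ 2 : ℝ) : ℂ)⁻¹)) (𝓝[>] 0) (𝓝 (∫ ζ, dbar χ ζ * ((ζ - 0) ^ 1)⁻¹)) := by
    refine tendsto_integral_filter_of_dominated_convergence (fun ζ => ‖dbar χ ζ‖ * δ⁻¹) ?_ ?_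
      ((hcd.integrable_of_hasCompactSupport hχc.dbar).norm.mul_const _) ?_
    · filter_upwards [self_mem_nhdsWithin] with t (ht : 0 < t)
      refine (hcd.mul (continuous_conj.mul (Continuous.inv₀ (by fun_prop) ?_))).aestronglyMeasurable
      intro ζ
      have : 0 < ‖ζ‖ ^ 2 + t ^ 2 := by positivity
      exact_mod_cast this.ne'
    · refine Eventually.of_forall fun t => Eventually.of_forall fun ζ => ?_
      by_cases h : ‖ζ‖ < δ
      · simp [hd0 ζ h]
      · rw [norm_mul, norm_mul, RCLike.norm_conj, norm_inv, norm_real,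
          Real.norm_of_nonneg (by positivity)]
        push Not at h
        have h0 : 0 < ‖ζ‖ := hδ.trans_le h
        gcongr
        calc ‖ζ‖ * (‖ζ‖ ^ 2 + t ^ 2)⁻¹ ≤ ‖ζ‖ * (‖ζ‖ ^ 2)⁻¹ := by
              gcongr
              nlinarith [sq_nonneg t]
          _ = ‖ζ‖⁻¹ := by field_simp
          _ ≤ δ⁻¹ := by gcongr
    · refine Eventually.of_forall fun ζ => ?_
      by_cases h : ‖ζ‖ < δ
      · simp [hd0 ζ h]
      · push Not at h
        have h0 : 0 < ‖ζ‖ := hδ.trans_le h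
        have h1 : ζ ≠ 0 := norm_pos_iff.1 h0
        have : ((ζ - 0) ^ 1)⁻¹ = (starRingEnd ℂ) ζ * ((‖ζ‖ ^ 2 + 0 ^ 2 : ℝ) : ℂ)⁻¹ := by
          have h2 : ζ * (starRingEnd ℂ) ζ = ((‖ζ‖ ^ 2 : ℝ) : ℂ) := by
            rw [mul_conj, normSq_eq_norm_sq]
          have h3 : (starRingEnd ℂ) ζ ≠ 0 := by simpa using h1
          rw [show ‖ζ‖ ^ 2 + (0 : ℝ) ^ 2 = ‖ζ‖ ^ 2 by ring, ← h2]
          field_simp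
          simp
        rw [this]
        refine Tendsto.mono_left ?_ nhdsWithin_le_nhds
        refine tendsto_const_nhds.mul (tendsto_const_nhds.mul (Tendsto.inv₀ ?_ ?_))
        · have hc : Continuous fun t : ℝ => ((‖ζ‖ ^ 2 + t ^ 2 : ℝ) : ℂ) := by fun_prop
          exact hc.tendsto 0
        · have : 0 < ‖ζ‖ ^ 2 + (0 : ℝ) ^ 2 := by positivity
          exact_mod_cast this.ne'
  intro h0
  rw [h0] at hcont
  have h1 := (continuous_re.tendsto 0).comp hcont
  have h2 : (0 : ℂ).re ≤ -(Real.pi / 2) := by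
    refine le_of_tendsto h1 ?_
    filter_upwards [Ioc_mem_nhdsGT hδ] with t ht
    exact re_integral_dbar_mul_conj_le hχ hχc hχ1 hre ht.1 ht.2
  have := Real.pi_pos
  rw [zero_re] at h2
  linarith

lemma continuous_mul_of_tsupport_subset {χ f : ℂ → ℂ} {U : Set ℂ} (hU : IsOpen U)
    (hχ : Continuous χ) (hχU : tsupport χ ⊆ U) (hf : ContinuousOn f U) :
    Continuous fun ζ => χ ζ * f ζ := by
  rw [continuous_iff_continuousAt]
  intro ζ
  by_cases h : ζ ∈ tsupport χ
  · exact hχ.continuousAt.mul (hf.continuousAt (hU.mem_nhds (hχU h)))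
  · refine (continuousAt_const (y := (0 : ℂ))).congr ?_
    filter_upwards [(isClosed_tsupport χ).isOpen_compl.mem_nhds h] with w hw
    simp [image_eq_zero_of_notMem_tsupport hw]

lemma integrable_mul_inv_pow_one {Φ : ℂ → ℂ} (hΦ : Continuous Φ) (hc : HasCompactSupport Φ) (z : ℂ) :
    Integrable fun ζ => Φ ζ * ((ζ - z) ^ 1)⁻¹ := by
  obtain ⟨B, hB⟩ := hc.exists_bound_of_continuous hΦ
  obtain ⟨R, hR⟩ := hc.isBounded.subset_closedBall (z : ℂ)
  have h := (integrable_indicator_norm_rpow (t := -1) (by norm_num) R).const_mul B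
  refine (h.comp_sub_right z).mono' ?_ (Eventually.of_forall fun ζ => ?_)
  · exact hΦ.aestronglyMeasurable.mul (Measurable.aestronglyMeasurable (by fun_prop))
  · by_cases hζ : ζ ∈ closedBall z R
    · rw [Set.indicator_of_mem (by simpa [dist_eq_norm] using hζ), norm_mul, pow_one, norm_inv,
        Real.rpow_neg_one]
      gcongr
      exact hB ζ
    · have : Φ ζ = 0 := image_eq_zero_of_notMem_tsupport fun h => hζ (hR h)
      rw [this, zero_mul, norm_zero, Set.indicator_of_notMem (by simpa [dist_eq_norm] using hζ)]
      simp

lemma continuousAt_integral_mul_inv {Φ : ℂ → ℂ} (hΦ : Continuous Φ) (hc : HasCompactSupport Φ) :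
    ContinuousAt (fun z => ∫ ζ, Φ ζ * ((ζ - z) ^ 1)⁻¹) 0 := by
  obtain ⟨B, hB⟩ := hc.exists_bound_of_continuous hΦ
  obtain ⟨R, hR⟩ := hc.isBounded.subset_closedBall (0 : ℂ)
  have heq : (fun z => ∫ ζ, Φ ζ * ((ζ - z) ^ 1)⁻¹) = fun z => ∫ w, Φ (w + z) * (w ^ 1)⁻¹ := by
    funext z
    rw [← integral_add_right_eq_self _ z]
    simp
  rw [heq]
  refine continuousAt_of_dominated (bound := fun w => B *
    (closedBall (0 : ℂ) (R + 1)).indicator (fun w => ‖w‖ ^ (-1 : ℝ)) w) ?_ ?_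
    ((integrable_indicator_norm_rpow (by norm_num) _).const_mul B) ?_
  · refine Eventually.of_forall fun z => ?_
    have : Continuous fun w => Φ (w + z) := by fun_prop
    exact this.aestronglyMeasurable.mul (Measurable.aestronglyMeasurable (by fun_prop))
  · filter_upwards [ball_mem_nhds (0 : ℂ) one_pos] with z hz
    refine Eventually.of_forall fun w => ?_
    by_cases hw : w ∈ closedBall (0 : ℂ) (R + 1)
    · rw [Set.indicator_of_mem hw, norm_mul, pow_one, norm_inv, Real.rpow_neg_one]
      gcongr
      exact hB _
    · have : Φ (w + z) = 0 := image_eq_zero_of_notMem_tsupport fun h => hw (by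
        have h1 := hR h
        simp only [mem_closedBall, dist_zero_right, mem_ball] at h1 hz ⊢
        have := norm_sub_le (w + z) z
        rw [add_sub_cancel_right] at this
        linarith)
      rw [this, zero_mul, norm_zero, Set.indicator_of_notMem hw]
      simp
  · exact Eventually.of_forall fun w => by fun_prop

/-- Interior gradient estimate at the centre of the unit disc. -/
lemma exists_norm_del_le : ∃ C : ℝ, ∀ (r : ℂ → ℂ) (M B : ℝ), ContDiffOn ℝ 2 r (ball 0 1) →
    (∀ ζ ∈ ball (0 : ℂ) 1, ‖r ζ‖ ≤ M) → (∀ ζ ∈ ball (0 : ℂ) 1, ‖dbar (del r) ζ‖ ≤ B) →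
    ‖del r 0‖ ≤ C * (M + B) := by
  obtain ⟨χ, hχ3, hχc, hχs, hχ1, hχb, hχre⟩ :=
    exists_cutoff (a := 1 / 4) (b := 1 / 2) (by norm_num) (by norm_num)
  have hχ : ContDiff ℝ 2 χ := hχ3.of_le (by norm_num)
  have hχU : tsupport χ ⊆ ball 0 1 := hχs.trans (closedBall_subset_ball (by norm_num))
  set A := ∫ ζ, dbar χ ζ * ((ζ - 0) ^ 1)⁻¹ with hA
  have hA0 : A ≠ 0 := integral_dbar_mul_inv_ne_zero hχ hχc (by norm_num) hχ1 hχre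
  have hχ0 : χ =ᶠ[𝓝 0] fun _ => 1 := by
    filter_upwards [closedBall_mem_nhds (0 : ℂ) (show (0 : ℝ) < 1 / 4 by norm_num)] with w hw
    exact hχ1 w (by simpa using hw)
  have hd0 : dbar χ =ᶠ[𝓝 0] fun _ => 0 := hχ0.dbar_eventuallyEq_zero
  have hχ2 : χ =ᶠ[𝓝 2] fun _ => 0 := notMem_tsupport_iff_eventuallyEq.1 fun h => by
    have := hχU h
    norm_num at this
  have hd2 : dbar χ =ᶠ[𝓝 2] fun _ => 0 := hχ2.dbar_eventuallyEq_zero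
  let ψ : ℂ → ℂ := fun ζ => dbar χ ζ * ((ζ - 0) ^ 1)⁻¹
  have hψc : HasCompactSupport ψ := hχc.dbar.mul_right
  have hψU : tsupport ψ ⊆ ball 0 1 :=
    ((tsupport_mul_subset_left).trans (closure_minimal (fun ζ hζ => by
      by_contra hc
      exact hζ (dbar_eq_zero_of_notMem_tsupport hc)) (isClosed_tsupport χ))).trans hχU
  have hψ : ContDiff ℝ 1 ψ := by
    rw [contDiff_iff_contDiffAt]
    intro ζ
    by_cases h : ζ = 0
    · subst h
      refine (contDiffAt_const (c := (0 : ℂ))).congr_of_eventuallyEq ?_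
      filter_upwards [hd0] with w hw
      simp [ψ, hw]
    · exact (hχ.contDiff_dbar (by norm_num)).contDiffAt.mul (contDiffAt_inv_pow h 1)
  have hI1 := integrable_indicator_norm_rpow (t := -1) (by norm_num) (1 / 2)
  refine ⟨((∫ w, (closedBall (0 : ℂ) (1 / 2)).indicator (fun w => ‖w‖ ^ (-1 : ℝ)) w)
    + ∫ ζ, ‖del ψ ζ‖) / ‖A‖, fun r M B hr hM hB => ?_⟩
  set c1 := ∫ w, (closedBall (0 : ℂ) (1 / 2)).indicator (fun w => ‖w‖ ^ (-1 : ℝ)) w with hc1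
  have hc1' : 0 ≤ c1 := integral_nonneg fun w =>
    Set.indicator_nonneg (fun w _ => by positivity) w
  have hc2' : 0 ≤ ∫ ζ, ‖del ψ ζ‖ := integral_nonneg fun w => norm_nonneg _
  have hM0 : 0 ≤ M := (norm_nonneg _).trans (hM 0 (by simp))
  have hB0 : 0 ≤ B := (norm_nonneg _).trans (hB 0 (by simp))
  have hp : ContDiffOn ℝ 1 (del r) (ball 0 1) := by
    have := hr.fderiv_of_isOpen (m := 1) isOpen_ball (by norm_num)
    unfold del
    fun_prop
  have hpd : ∀ ζ ∈ ball (0 : ℂ) 1, DifferentiableAt ℝ (del r) ζ := fun ζ hζ =>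
    (hp.contDiffAt (isOpen_ball.mem_nhds hζ)).differentiableAt (by norm_num)
  have hf : ContinuousOn (dbar (del r)) (ball 0 1) := by
    have := hp.continuousOn_fderiv_of_isOpen isOpen_ball (by norm_num)
    unfold dbar
    fun_prop
  have hΦ := continuous_mul_of_tsupport_subset isOpen_ball hχ.continuous hχU hf
  have hbase := integral_cauchy_pompeiu (χ := χ) (q := fun ζ => del r ζ - del r 0)
    (g := dbar (del r)) (U := ball 0 1) (s := 2) (z := 0) (m := 1) isOpen_ball hχ hχc hχU hd0 hd2
    (by norm_num) ((hp.sub contDiffOn_const).mono Set.sdiff_subset)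
    (fun ζ hζ => by rw [dbar_sub (hpd ζ hζ.1) (by fun_prop), dbar_const, sub_zero]) ?_ ?_
    (integrable_mul_inv_pow_one hΦ hχc.mul_right 0)
  · have hψp : Integrable fun ζ => dbar χ ζ * del r ζ * ((ζ - 0) ^ 1)⁻¹ :=
      integrable_mul_inv_pow (continuous_dbar_mul isOpen_ball hχ hχU hd2
        (hp.continuousOn.mono Set.sdiff_subset)) hχc.dbar.mul_right
        (by filter_upwards [hd0] with w hw; simp [hw]) 1
    have hψi : Integrable ψ := hψ.continuous.integrable_of_hasCompactSupport hψc
    have h1 : ∫ ζ, dbar χ ζ * (del r ζ - del r 0) * ((ζ - 0) ^ 1)⁻¹ =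
        (∫ ζ, dbar χ ζ * del r ζ * ((ζ - 0) ^ 1)⁻¹) - del r 0 * A := by
      rw [hA, ← integral_const_mul, ← integral_sub hψp (hψi.const_mul _)]
      congr 1
      funext ζ
      ring
    rw [h1] at hbase
    have hrψ : ContDiff ℝ 1 fun ζ => ψ ζ * r ζ := by
      rw [contDiff_iff_contDiffAt]
      intro ζ
      by_cases h : ζ ∈ tsupport ψ
      · exact hψ.contDiffAt.mul
          ((hr.contDiffAt (isOpen_ball.mem_nhds (hψU h))).of_le (by norm_num))
      · refine (contDiffAt_const (c := (0 : ℂ))).congr_of_eventuallyEq ?_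
        filter_upwards [(isClosed_tsupport ψ).isOpen_compl.mem_nhds h] with w hw
        simp [image_eq_zero_of_notMem_tsupport hw]
    have h2 := integral_del_eq_zero_of_contDiff hrψ hψc.mul_right
    have h3 : ∀ ζ, del (fun ζ => ψ ζ * r ζ) ζ
        = dbar χ ζ * del r ζ * ((ζ - 0) ^ 1)⁻¹ + del ψ ζ * r ζ := by
      intro ζ
      by_cases h : ζ ∈ tsupport ψ
      · rw [del_mul (hψ.differentiable (by norm_num) ζ)
          ((hr.contDiffAt (isOpen_ball.mem_nhds (hψU h))).differentiableAt (by norm_num))]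
        simp only [ψ]
        ring
      · have hz := image_eq_zero_of_notMem_tsupport h
        simp only [ψ] at hz
        have : dbar χ ζ * del r ζ * ((ζ - 0) ^ 1)⁻¹ = 0 := by
          linear_combination (del r ζ) * hz
        rw [this, del_eq_zero_of_notMem_tsupport h,
          del_eq_zero_of_notMem_tsupport fun hc => h (tsupport_mul_subset_left hc)]
        simp
    simp only [h3] at h2
    have hdψ : Integrable (del ψ) := by
      unfold del
      exact (integrable_fderiv_apply hψ hψc 1).sub ((integrable_fderiv_apply hψ hψc I).const_mul I)
    have hdψs : ∀ ζ, ‖del ψ ζ * r ζ‖ ≤ ‖del ψ ζ‖ * M := by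
      intro ζ
      by_cases h : ζ ∈ tsupport ψ
      · rw [norm_mul]
        gcongr
        exact hM ζ (hψU h)
      · simp [del_eq_zero_of_notMem_tsupport h]
    have hdi : Integrable fun ζ => del ψ ζ * r ζ := by
      have h4 : Integrable fun ζ => del (fun ζ => ψ ζ * r ζ) ζ := by
        unfold del
        exact (integrable_fderiv_apply hrψ hψc.mul_right 1).sub
          ((integrable_fderiv_apply hrψ hψc.mul_right I).const_mul I)
      refine (h4.sub hψp).congr (Eventually.of_forall fun ζ => ?_)
      simp only [Pi.sub_apply, h3]
      ring
    rw [integral_add hψp hdi] at h2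
    have hkey : del r 0 * A = (∫ ζ, χ ζ * dbar (del r) ζ * ((ζ - 0) ^ 1)⁻¹)
        - ∫ ζ, del ψ ζ * r ζ := by
      linear_combination h2 - hbase
    have hb1 : ‖∫ ζ, χ ζ * dbar (del r) ζ * ((ζ - 0) ^ 1)⁻¹‖ ≤ B * c1 := by
      rw [hc1, ← integral_const_mul]
      refine norm_integral_le_of_norm_le (hI1.const_mul B) (Eventually.of_forall fun ζ => ?_)
      by_cases h : ζ ∈ closedBall (0 : ℂ) (1 / 2)
      · rw [Set.indicator_of_mem h, norm_mul, norm_mul, pow_one, sub_zero, norm_inv,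
          Real.rpow_neg_one]
        have := hB ζ (closedBall_subset_ball (by norm_num) h)
        gcongr
        calc ‖χ ζ‖ * ‖dbar (del r) ζ‖ ≤ 1 * B := by
              gcongr
              exact hχb ζ
          _ = B := one_mul B
      · rw [Set.indicator_of_notMem h, image_eq_zero_of_notMem_tsupport fun h' => h (hχs h')]
        simp
    have hb2 : ‖∫ ζ, del ψ ζ * r ζ‖ ≤ (∫ ζ, ‖del ψ ζ‖) * M := by
      rw [← integral_mul_const]
      exact norm_integral_le_of_norm_le (hdψ.norm.mul_const M) (Eventually.of_forall hdψs)
    have hAp : 0 < ‖A‖ := norm_pos_iff.2 hA0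
    rw [div_mul_eq_mul_div, le_div_iff₀ hAp, ← norm_mul, hkey]
    refine (norm_sub_le _ _).trans ((add_le_add hb1 hb2).trans ?_)
    nlinarith [mul_nonneg hc1' hM0, mul_nonneg hc2' hB0]
  · have h1 : Tendsto (fun ζ => del r ζ - del r 0) (𝓝[≠] 0) (𝓝 (del r 0 - del r 0)) :=
      ((hp.continuousOn.continuousAt (ball_mem_nhds 0 one_pos)).sub continuousAt_const).mono_left
        nhdsWithin_le_nhds
    rw [sub_self] at h1
    refine h1.congr' ?_
    filter_upwards [self_mem_nhdsWithin] with ζ hζ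
    have hζ : ζ ≠ 0 := hζ
    rw [mul_assoc, pow_one, sub_zero, inv_mul_cancel₀ hζ, mul_one]
  · refine tendsto_const_nhds.congr' ?_
    filter_upwards [nhdsWithin_le_nhds hχ2] with ζ hζ
    simp [hζ]

lemma del_comp_affine {F : ℂ → ℂ} {c : ℝ} {b z : ℂ} (hF : DifferentiableAt ℝ F (c * z + b)) :
    del (fun w => F (c * w + b)) z = c * del F (c * z + b) := by
  unfold del
  rw [fderiv_comp_affine hF, fderiv_comp_affine hF]
  ring

lemma dbar_comp_affine {F : ℂ → ℂ} {c : ℝ} {b z : ℂ} (hF : DifferentiableAt ℝ F (c * z + b)) :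
    dbar (fun w => F (c * w + b)) z = c * dbar F (c * z + b) := by
  unfold dbar
  rw [fderiv_comp_affine hF, fderiv_comp_affine hF]
  ring

lemma dbar_const_mul (c : ℂ) {F : ℂ → ℂ} {z : ℂ} (hF : DifferentiableAt ℝ F z) :
    dbar (fun w => c * F w) z = c * dbar F z := by
  rw [dbar_mul (by fun_prop) hF, dbar_const]
  ring

lemma ContDiffOn.del_of_isOpen {r : ℂ → ℂ} {U : Set ℂ} (hU : IsOpen U) (hr : ContDiffOn ℝ 2 r U) :
    ContDiffOn ℝ 1 (del r) U := by
  have := hr.fderiv_of_isOpen (m := 1) hU (by norm_num)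
  unfold del
  fun_prop

/-- The gradient of a function with bounded Laplacian, continuous at an isolated singularity `0`,
is `o(1 / |z|)`. -/
lemma tendsto_mul_del {r : ℂ → ℂ} {R B : ℝ} (hR : 0 < R)
    (hr : ContDiffOn ℝ 2 r (ball 0 R \ {0})) (hc : ContinuousAt r 0)
    (hB : ∀ ζ ∈ ball (0 : ℂ) R \ {0}, ‖dbar (del r) ζ‖ ≤ B) :
    Tendsto (fun ζ => del r ζ * ζ) (𝓝[≠] 0) (𝓝 0) := by
  obtain ⟨C, hC⟩ := exists_norm_del_le
  have hUo : IsOpen (ball (0 : ℂ) R \ {0}) := isOpen_ball.sdiff isClosed_singleton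
  have hp : ContDiffOn ℝ 1 (del r) (ball 0 R \ {0}) := hr.del_of_isOpen hUo
  have key : ∀ η > 0, ∀ᶠ z in 𝓝[≠] (0 : ℂ), ‖del r z * z‖ ≤ 2 * C * (η + (‖z‖ / 2) ^ 2 * B) := by
    intro η hη
    obtain ⟨δ, hδ, hδr⟩ := Metric.continuousAt_iff.1 hc η hη
    have hmem : ball (0 : ℂ) (min R δ / 2) ∈ 𝓝[≠] (0 : ℂ) :=
      nhdsWithin_le_nhds (ball_mem_nhds _ (by positivity))
    filter_upwards [hmem, self_mem_nhdsWithin] with z hz hz0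
    have hz0 : z ≠ 0 := hz0
    set ρ : ℝ := ‖z‖ / 2 with hρ
    have hρ0 : 0 < ρ := by positivity
    have hzn : ‖z‖ < min R δ / 2 := by simpa using hz
    have hzR : ‖z‖ < R / 2 := hzn.trans_le (by gcongr; exact min_le_left _ _)
    have hzδ : ‖z‖ < δ / 2 := hzn.trans_le (by gcongr; exact min_le_right _ _)
    have hin : ∀ w ∈ ball (0 : ℂ) 1, (ρ * w + z : ℂ) ∈ ball (0 : ℂ) R \ {0} ∧
        (ρ * w + z : ℂ) ∈ ball (0 : ℂ) δ := by
      intro w hw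
      have hw1 : ‖w‖ < 1 := by simpa using hw
      have h1 : ‖(ρ * w : ℂ)‖ < ρ := by
        rw [norm_mul, Complex.norm_real, Real.norm_of_nonneg hρ0.le]
        nlinarith
      have h2 := norm_add_le (ρ * w : ℂ) z
      have h3 : ‖z‖ ≤ ‖(ρ * w + z : ℂ)‖ + ‖(ρ * w : ℂ)‖ := by
        have := norm_sub_le (ρ * w + z : ℂ) (ρ * w)
        rwa [add_sub_cancel_left] at this
      refine ⟨⟨by simp only [mem_ball, dist_zero_right]; linarith, fun h0 => ?_⟩,
        by simp only [mem_ball, dist_zero_right]; linarith⟩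
      rw [Set.mem_singleton_iff] at h0
      rw [h0, norm_zero] at h3
      linarith
    have hd : ∀ w ∈ ball (0 : ℂ) 1, DifferentiableAt ℝ (fun w => r w - r 0) (ρ * w + z) :=
      fun w hw => ((hr.contDiffAt (hUo.mem_nhds (hin w hw).1)).differentiableAt
        (by norm_num)).sub_const _
    have hdel : ∀ w ∈ ball (0 : ℂ) 1,
        del (fun w => r (ρ * w + z) - r 0) w = ρ * del r (ρ * w + z) := by
      intro w hw
      rw [del_comp_affine (F := fun w => r w - r 0) (hd w hw)]
      simp [del, fderiv_sub_const]
    have h := hC (fun w => r (ρ * w + z) - r 0) η (ρ ^ 2 * B) ?_ ?_ ?_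
    · rw [hdel 0 (by simp), mul_zero, zero_add, norm_mul, Complex.norm_real,
        Real.norm_of_nonneg hρ0.le] at h
      rw [norm_mul]
      have : ‖z‖ = 2 * ρ := by rw [hρ]; ring
      rw [this]
      linarith
    · refine ContDiffOn.sub (hr.comp (f := fun w : ℂ => (ρ * w + z : ℂ))
        (by fun_prop) fun w hw => (hin w hw).1) contDiffOn_const
    · intro w hw
      have := hδr (hin w hw).2
      rw [dist_eq_norm] at this
      exact this.le
    · intro w hw
      have he : del (fun w => r (ρ * w + z) - r 0) =ᶠ[𝓝 w] fun w => ρ * del r (ρ * w + z) := by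
        filter_upwards [isOpen_ball.mem_nhds hw] with v hv using hdel v hv
      have hpd : DifferentiableAt ℝ (del r) (ρ * w + z) :=
        (hp.contDiffAt (hUo.mem_nhds (hin w hw).1)).differentiableAt (by norm_num)
      rw [he.dbar_eq, dbar_const_mul, dbar_comp_affine hpd]
      · rw [norm_mul, norm_mul, Complex.norm_real, Real.norm_of_nonneg hρ0.le, sq, mul_assoc]
        gcongr
        exact hB _ (hin w hw).1
      · exact DifferentiableAt.comp (g := del r) (f := fun w : ℂ => (ρ * w + z : ℂ)) w hpd (by fun_prop)
  rw [tendsto_zero_iff_norm_tendsto_zero]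
  rw [Metric.tendsto_nhds]
  intro ε hε
  have hη : 0 < ε / (4 * (|C| + 1)) := by positivity
  have hlim : Tendsto (fun z : ℂ => 2 * C * (ε / (4 * (|C| + 1)) + (‖z‖ / 2) ^ 2 * B)) (𝓝[≠] 0)
      (𝓝 (2 * C * (ε / (4 * (|C| + 1)) + (‖(0 : ℂ)‖ / 2) ^ 2 * B))) :=
    (Continuous.tendsto (by fun_prop) 0).mono_left nhdsWithin_le_nhds
  have hlt : 2 * C * (ε / (4 * (|C| + 1)) + (‖(0 : ℂ)‖ / 2) ^ 2 * B) < ε := by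
    have h1 : 2 * C * (ε / (4 * (|C| + 1)) + (‖(0 : ℂ)‖ / 2) ^ 2 * B)
        = (C / (|C| + 1)) * (ε / 2) := by
      rw [norm_zero]; field_simp; ring
    have h2 : C / (|C| + 1) ≤ 1 := by
      rw [div_le_one (by positivity)]
      linarith [le_abs_self C]
    rw [h1]
    nlinarith
  filter_upwards [key _ hη, hlim.eventually (gt_mem_nhds hlt)] with z h1 h2
  rw [Real.dist_eq, sub_zero, abs_of_nonneg (norm_nonneg _)]
  exact h1.trans_lt h2

lemma fderiv_apply_eq_del_dbar (p : ℂ → ℂ) (z w : ℂ) :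
    fderiv ℝ p z w = del p z / 2 * w + dbar p z / 2 * conj w := by
  have hw : w = w.re • (1 : ℂ) + w.im • I := by
    simp [Complex.re_add_im]
  have h1 : fderiv ℝ p z w = w.re * fderiv ℝ p z 1 + w.im * fderiv ℝ p z I := by
    conv_lhs => rw [hw]
    rw [map_add, map_smul, map_smul]
    simp
  have h2 : w = w.re + w.im * I := (Complex.re_add_im w).symm
  have h3 : conj w = w.re - w.im * I := by
    apply Complex.ext <;> simp
  rw [h1, h3]
  conv_rhs => enter [1, 2]; rw [h2]
  unfold del dbar
  linear_combination ((w.im : ℂ) * fderiv ℝ p z I) * I_sq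

lemma norm_mul_sub_mul_inv_sq_le {χ f : ℂ → ℂ} {R a b α C : ℝ} (hC0 : 0 ≤ C) (hbR : b < R) (haR : a < R)
    (hχs : tsupport χ ⊆ closedBall 0 b) (hχb : ∀ z, ‖χ z‖ ≤ 1)
    (hC : ∀ x ∈ ball (0 : ℂ) R, ∀ y ∈ ball (0 : ℂ) R, ‖f x - f y‖ ≤ C * ‖x - y‖ ^ α)
    {z : ℂ} (hz : ‖z‖ < a) (w : ℂ) :
    ‖χ (w + z) * (f (w + z) - f z) * (w ^ 2)⁻¹‖ ≤
      C * (closedBall (0 : ℂ) (a + b)).indicator (fun w => ‖w‖ ^ (α - 2)) w := by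
  by_cases hw0 : w = 0
  · subst hw0
    have : 0 ≤ (closedBall (0 : ℂ) (a + b)).indicator (fun w => ‖w‖ ^ (α - 2)) 0 :=
      Set.indicator_nonneg (fun w _ => by positivity) _
    simpa using mul_nonneg hC0 this
  by_cases hχ : w + z ∈ tsupport χ
  · have h1 := hχs hχ
    simp only [mem_closedBall, dist_zero_right] at h1
    have hw : ‖w‖ ≤ a + b := by
      have := norm_sub_le (w + z) z
      rw [add_sub_cancel_right] at this
      linarith
    rw [Set.indicator_of_mem (by simpa using hw), norm_mul, norm_mul, norm_inv, norm_pow]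
    have hwp : 0 < ‖w‖ := norm_pos_iff.2 hw0
    have h2 := hC (w + z) (by simp; linarith) z (by simp; linarith)
    rw [add_sub_cancel_right] at h2
    have h3 : ‖w‖ ^ (α - 2) = ‖w‖ ^ α * (‖w‖ ^ 2)⁻¹ := by
      rw [Real.rpow_sub hwp, div_eq_mul_inv]
      norm_cast
    rw [h3, ← mul_assoc]
    refine mul_le_mul_of_nonneg_right ?_ (by positivity)
    calc ‖χ (w + z)‖ * ‖f (w + z) - f z‖ ≤ 1 * ‖f (w + z) - f z‖ := by gcongr; exact hχb _
      _ ≤ _ := by rw [one_mul]; exact h2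
  · rw [image_eq_zero_of_notMem_tsupport hχ]
    simpa using mul_nonneg hC0 (Set.indicator_nonneg (fun w _ => by positivity) _)

lemma integral_mul_sub_mul_inv_sq_eq (χ f : ℂ → ℂ) (z : ℂ) :
    ∫ ζ, χ ζ * (f ζ - f z) * ((ζ - z) ^ 2)⁻¹ =
      ∫ w, χ (w + z) * (f (w + z) - f z) * (w ^ 2)⁻¹ := by
  rw [← integral_add_right_eq_self _ z]
  simp

lemma integrable_mul_sub_mul_inv_sq {χ f : ℂ → ℂ} {R a b α C : ℝ} (hC0 : 0 ≤ C) (hbR : b < R) (haR : a < R)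
    (hα : 0 < α) (hχ : Continuous χ)
    (hχs : tsupport χ ⊆ closedBall 0 b) (hχb : ∀ z, ‖χ z‖ ≤ 1) (hf : ContinuousOn f (ball 0 R))
    (hC : ∀ x ∈ ball (0 : ℂ) R, ∀ y ∈ ball (0 : ℂ) R, ‖f x - f y‖ ≤ C * ‖x - y‖ ^ α)
    {z : ℂ} (hz : ‖z‖ < a) : Integrable fun ζ => χ ζ * (f ζ - f z) * ((ζ - z) ^ 2)⁻¹ := by
  have h : Integrable fun w => χ (w + z) * (f (w + z) - f z) * (w ^ 2)⁻¹ := by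
    refine ((integrable_indicator_norm_rpow (by linarith) _).const_mul C).mono' ?_
      (Eventually.of_forall (norm_mul_sub_mul_inv_sq_le hC0 hbR haR hχs hχb hC hz))
    have hΦ := continuous_mul_of_tsupport_subset isOpen_ball hχ
      (hχs.trans (closedBall_subset_ball hbR)) (hf.sub (continuousOn_const (c := f z)))
    have : Continuous fun w => χ (w + z) * (f (w + z) - f z) :=
      hΦ.comp (continuous_add_const z)
    exact this.aestronglyMeasurable.mul (Measurable.aestronglyMeasurable (by fun_prop))
  simpa using h.comp_sub_right z

lemma continuousAt_integral_mul_sub_mul_inv_sq {χ f : ℂ → ℂ} {R a b α C : ℝ} (hC0 : 0 ≤ C) (hbR : b < R)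
    (haR : a < R) (ha : 0 < a) (hα : 0 < α) (hχ : Continuous χ)
    (hχs : tsupport χ ⊆ closedBall 0 b) (hχb : ∀ z, ‖χ z‖ ≤ 1) (hf : ContinuousOn f (ball 0 R))
    (hC : ∀ x ∈ ball (0 : ℂ) R, ∀ y ∈ ball (0 : ℂ) R, ‖f x - f y‖ ≤ C * ‖x - y‖ ^ α) :
    ContinuousAt (fun z => ∫ ζ, χ ζ * (f ζ - f z) * ((ζ - z) ^ 2)⁻¹) 0 := by
  simp only [integral_mul_sub_mul_inv_sq_eq]
  have hΦ := continuous_mul_of_tsupport_subset isOpen_ball hχ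
      (hχs.trans (closedBall_subset_ball hbR)) hf
  refine continuousAt_of_dominated (bound := fun w => C *
    (closedBall (0 : ℂ) (a + b)).indicator (fun w => ‖w‖ ^ (α - 2)) w) ?_ ?_
    ((integrable_indicator_norm_rpow (by linarith) _).const_mul C) ?_
  · refine Eventually.of_forall fun z => ?_
    have h1 : Continuous fun w => χ (w + z) * (f (w + z) - f z) := by
      have : Continuous fun w => χ (w + z) * f (w + z) - χ (w + z) * f z :=
        (hΦ.comp (continuous_add_const z)).sub (by fun_prop)
      exact this.congr fun w => by ring
    exact h1.aestronglyMeasurable.mul (Measurable.aestronglyMeasurable (by fun_prop))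
  · filter_upwards [ball_mem_nhds (0 : ℂ) ha] with z hz
    exact Eventually.of_forall (norm_mul_sub_mul_inv_sq_le hC0 hbR haR hχs hχb hC (by simpa using hz))
  · refine Eventually.of_forall fun w => ?_
    have hf0 : ContinuousAt f 0 := hf.continuousAt (ball_mem_nhds _ (ha.trans haR))
    have h1 : Continuous fun z => χ (w + z) * f (w + z) := hΦ.comp (continuous_const_add w)
    have h2 : ContinuousAt (fun z => χ (w + z) * f (w + z) - χ (w + z) * f z) 0 :=
      h1.continuousAt.sub (ContinuousAt.mul (by fun_prop) hf0)
    refine (h2.mul (continuousAt_const (y := (w ^ 2)⁻¹))).congr (Eventually.of_forall fun z => ?_)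
    simp only [mul_sub]
    rfl

lemma eventuallyEq_zero_of_norm_lt {φ : ℂ → ℂ} {a : ℝ} (h : ∀ ζ, ‖ζ‖ < a → φ ζ = 0) {z : ℂ}
    (hz : ‖z‖ < a) : φ =ᶠ[𝓝 z] fun _ => 0 := by
  filter_upwards [(isOpen_lt continuous_norm continuous_const).mem_nhds hz] with w hw using h w hw

lemma tendsto_mul_sub_mul {χ p l : ℂ → ℂ} (hχ : Continuous χ)
    (h0 : Tendsto (fun ζ => p ζ * ζ) (𝓝[≠] 0) (𝓝 0)) (hl : Continuous l) :
    Tendsto (fun ζ => χ ζ * (p ζ - l ζ) * (ζ - 0)) (𝓝[≠] 0) (𝓝 0) := by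
  have h1 : Tendsto χ (𝓝[≠] 0) (𝓝 (χ 0)) := hχ.continuousAt.mono_left nhdsWithin_le_nhds
  have h2 : Tendsto (fun ζ => l ζ * ζ) (𝓝[≠] 0) (𝓝 (l 0 * 0)) :=
    (Continuous.tendsto (by fun_prop) _).mono_left nhdsWithin_le_nhds
  have := h1.mul (h0.sub h2)
  simp only [mul_zero, sub_zero] at this
  refine this.congr fun ζ => ?_
  ring

/-- A solution of `∂̄p = f` in a punctured disc with `p = o(1 / |z|)` extends continuously. -/
lemma exists_tendsto_of_dbar_eq {p f : ℂ → ℂ} {R : ℝ} (hR : 0 < R)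
    (hp : ContDiffOn ℝ 1 p (ball 0 R \ {0})) (hf : ContinuousOn f (ball 0 R))
    (hpf : ∀ ζ ∈ ball (0 : ℂ) R \ {0}, dbar p ζ = f ζ)
    (h0 : Tendsto (fun ζ => p ζ * ζ) (𝓝[≠] 0) (𝓝 0)) : ∃ p0, Tendsto p (𝓝[≠] 0) (𝓝 p0) := by
  have ha : 0 < R / 3 := by positivity
  have hbR : R / 2 < R := by linarith
  obtain ⟨χ, hχ3, hχc, hχs, hχ1, hχb, hχre⟩ :=
    exists_cutoff (a := R / 3) (b := R / 2) (by positivity) (by linarith)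
  have hχ : ContDiff ℝ 2 χ := hχ3.of_le (by norm_num)
  have hχU : tsupport χ ⊆ ball 0 R := hχs.trans (closedBall_subset_ball hbR)
  have hd : ∀ z, ‖z‖ < R / 3 → dbar χ z = 0 := fun z hz => by
    have : χ =ᶠ[𝓝 z] fun _ => 1 := by
      filter_upwards [(isOpen_lt continuous_norm continuous_const).mem_nhds hz] with w hw
      exact hχ1 w (le_of_lt hw)
    rw [this.dbar_eq, dbar_const]
  have hd' : ∀ z, ‖z‖ < R / 3 → dbar χ =ᶠ[𝓝 z] fun _ => 0 := fun z hz =>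
    eventuallyEq_zero_of_norm_lt hd hz
  have hdc : Continuous (dbar χ) := (hχ.of_le (by norm_num)).continuous_dbar
  have hd0 := hd' 0 (by simpa using ha)
  have hpc := continuous_dbar_mul isOpen_ball hχ hχU hd0 hp.continuousOn
  have hpcc : HasCompactSupport fun ζ => dbar χ ζ * p ζ := hχc.dbar.mul_right
  have hΦ := continuous_mul_of_tsupport_subset isOpen_ball hχ.continuous hχU hf
  have hUo : IsOpen (ball (0 : ℂ) R \ {0}) := isOpen_ball.sdiff isClosed_singleton
  have hA0 := integral_dbar_mul_inv_ne_zero hχ hχc ha hχ1 hχre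
  have key : ∀ z, ‖z‖ < R / 3 → z ≠ 0 → p z * (∫ ζ, dbar χ ζ * ((ζ - z) ^ 1)⁻¹) =
      (∫ ζ, χ ζ * f ζ * ((ζ - z) ^ 1)⁻¹) + ∫ ζ, dbar χ ζ * p ζ * ((ζ - z) ^ 1)⁻¹ := by
    intro z hz hz0
    have hzU : z ∈ ball (0 : ℂ) R \ {0} := ⟨by simp; linarith, hz0⟩
    have h := integral_cauchy_pompeiu (χ := χ) (q := fun ζ => p ζ - p z) (g := f) (s := 0) (z := z)
      (m := 1) isOpen_ball hχ hχc hχU (hd' z hz) hd0 hz0 (hp.sub contDiffOn_const)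
      (fun ζ hζ => by
        rw [dbar_sub ((hp.contDiffAt (hUo.mem_nhds hζ)).differentiableAt (by norm_num))
          (by fun_prop), dbar_const, sub_zero, hpf ζ hζ]) ?_
      (tendsto_mul_sub_mul hχ.continuous h0 continuous_const)
      (integrable_mul_inv_pow_one hΦ hχc.mul_right z)
    · have h1 : Integrable fun ζ => dbar χ ζ * p ζ * ((ζ - z) ^ 1)⁻¹ :=
        integrable_mul_inv_pow hpc hpcc
          (eventuallyEq_zero_of_norm_lt (fun ζ hζ => by rw [hd ζ hζ, zero_mul]) hz) 1
      have h2 : Integrable fun ζ => dbar χ ζ * ((ζ - z) ^ 1)⁻¹ :=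
        integrable_mul_inv_pow hdc hχc.dbar (hd' z hz) 1
      have h3 : ∫ ζ, dbar χ ζ * (p ζ - p z) * ((ζ - z) ^ 1)⁻¹ =
          (∫ ζ, dbar χ ζ * p ζ * ((ζ - z) ^ 1)⁻¹) - p z * ∫ ζ, dbar χ ζ * ((ζ - z) ^ 1)⁻¹ := by
        rw [← integral_const_mul, ← integral_sub h1 (h2.const_mul _)]
        congr 1
        funext ζ
        ring
      rw [h3] at h
      linear_combination -h
    · have hpz : ContinuousAt p z := hp.continuousOn.continuousAt (hUo.mem_nhds hzU)
      have : Tendsto (fun ζ => p ζ - p z) (𝓝[≠] z) (𝓝 (p z - p z)) :=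
        (hpz.sub continuousAt_const).mono_left nhdsWithin_le_nhds
      rw [sub_self] at this
      refine this.congr' ?_
      filter_upwards [self_mem_nhdsWithin] with ζ hζ
      rw [pow_one, mul_assoc, inv_mul_cancel₀ (sub_ne_zero.2 hζ), mul_one]
  have hA := continuousAt_integral_mul_inv_pow hdc hχc.dbar ha hd 1
  have hN := (continuousAt_integral_mul_inv hΦ hχc.mul_right).add
    (continuousAt_integral_mul_inv_pow hpc hpcc ha (fun ζ hζ => by rw [hd ζ hζ, zero_mul]) 1)
  have hq := hN.div hA hA0
  refine ⟨_, (hq.mono_left nhdsWithin_le_nhds).congr' ?_⟩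
  filter_upwards [nhdsWithin_le_nhds (ball_mem_nhds (0 : ℂ) ha), self_mem_nhdsWithin,
    nhdsWithin_le_nhds (hA.eventually_ne hA0)] with z hz hz0 hAz
  have := key z (by simpa using hz) hz0
  simp only [Pi.div_apply, Pi.add_apply]
  rw [← this, mul_div_cancel_right₀ _ hAz]

/-- A continuous solution of `∂̄p = f` in a punctured disc, with `f` Hölder continuous across the
puncture, has a derivative with a limit at the puncture. -/
lemma exists_tendsto_fderiv_of_dbar_eq {p f : ℂ → ℂ} {R α C : ℝ} {p0 : ℂ} (hR : 0 < R)
    (hα : 0 < α) (hC0 : 0 ≤ C)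
    (hp : ContDiffOn ℝ 1 p (ball 0 R \ {0})) (hf : ContinuousOn f (ball 0 R))
    (hC : ∀ x ∈ ball (0 : ℂ) R, ∀ y ∈ ball (0 : ℂ) R, ‖f x - f y‖ ≤ C * ‖x - y‖ ^ α)
    (hpf : ∀ ζ ∈ ball (0 : ℂ) R \ {0}, dbar p ζ = f ζ)
    (hp0 : Tendsto p (𝓝[≠] 0) (𝓝 p0)) : ∃ L, Tendsto (fderiv ℝ p) (𝓝[≠] 0) (𝓝 L) := by
  have h0 : Tendsto (fun ζ => p ζ * ζ) (𝓝[≠] 0) (𝓝 0) := by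
    have := hp0.mul (tendsto_id.mono_left (nhdsWithin_le_nhds (a := (0 : ℂ)) (s := {0}ᶜ)))
    simpa using this
  have ha : 0 < R / 3 := by positivity
  have hbR : R / 2 < R := by linarith
  have haR : R / 3 < R := by linarith
  obtain ⟨χ, hχ3, hχc, hχs, hχ1, hχb, hχre⟩ :=
    exists_cutoff (a := R / 3) (b := R / 2) (by positivity) (by linarith)
  have hχ : ContDiff ℝ 2 χ := hχ3.of_le (by norm_num)
  have hχU : tsupport χ ⊆ ball 0 R := hχs.trans (closedBall_subset_ball hbR)
  have hd : ∀ z, ‖z‖ < R / 3 → dbar χ z = 0 := fun z hz => by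
    have : χ =ᶠ[𝓝 z] fun _ => 1 := by
      filter_upwards [(isOpen_lt continuous_norm continuous_const).mem_nhds hz] with w hw
      exact hχ1 w (le_of_lt hw)
    rw [this.dbar_eq, dbar_const]
  have hd' : ∀ z, ‖z‖ < R / 3 → dbar χ =ᶠ[𝓝 z] fun _ => 0 := fun z hz =>
    eventuallyEq_zero_of_norm_lt hd hz
  have hdc : Continuous (dbar χ) := (hχ.of_le (by norm_num)).continuous_dbar
  have hd0 := hd' 0 (by simpa using ha)
  have hpc := continuous_dbar_mul isOpen_ball hχ hχU hd0 hp.continuousOn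
  have hpcc : HasCompactSupport fun ζ => dbar χ ζ * p ζ := hχc.dbar.mul_right
  have hcc : Continuous fun ζ => dbar χ ζ * conj ζ := hdc.mul continuous_conj
  have hccc : HasCompactSupport fun ζ => dbar χ ζ * conj ζ := hχc.dbar.mul_right
  have hUo : IsOpen (ball (0 : ℂ) R \ {0}) := isOpen_ball.sdiff isClosed_singleton
  have hA0 := integral_dbar_mul_inv_ne_zero hχ hχc ha hχ1 hχre
  have key : ∀ z, ‖z‖ < R / 3 → z ≠ 0 → del p z * (∫ ζ, dbar χ ζ * ((ζ - z) ^ 1)⁻¹) =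
      2 * ((∫ ζ, χ ζ * (f ζ - f z) * ((ζ - z) ^ 2)⁻¹) + (∫ ζ, dbar χ ζ * p ζ * ((ζ - z) ^ 2)⁻¹)
        - p z * (∫ ζ, dbar χ ζ * ((ζ - z) ^ 2)⁻¹)
        - f z / 2 * (∫ ζ, dbar χ ζ * conj ζ * ((ζ - z) ^ 2)⁻¹)
        + f z / 2 * conj z * ∫ ζ, dbar χ ζ * ((ζ - z) ^ 2)⁻¹) := by
    intro z hz hz0
    have hzU : z ∈ ball (0 : ℂ) R \ {0} := ⟨by simp; linarith, hz0⟩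
    have hpz : DifferentiableAt ℝ p z :=
      (hp.contDiffAt (hUo.mem_nhds hzU)).differentiableAt (by norm_num)
    have hl : ContDiff ℝ 1 fun ζ => p z + (del p z / 2 * (ζ - z) + f z / 2 * conj (ζ - z)) := by
      have : ContDiff ℝ 1 fun ζ : ℂ => conj ζ := conjCLE.contDiff
      have := this.comp (contDiff_id.sub (contDiff_const (c := z)))
      refine contDiff_const.add (ContDiff.add (by fun_prop) (contDiff_const.mul this))
    have hldbar : ∀ ζ, dbar (fun ζ => p z + (del p z / 2 * (ζ - z) + f z / 2 * conj (ζ - z))) ζ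
        = f z := by
      intro ζ
      have he : (fun ζ => p z + (del p z / 2 * (ζ - z) + f z / 2 * conj (ζ - z))) =
          fun ζ => (fun ζ => f z / 2 * conj ζ) ζ -
            (fun ζ => -(p z + (del p z / 2 * (ζ - z) - f z / 2 * conj z))) ζ := by
        funext ζ
        simp only [map_sub]
        ring
      have hcj : DifferentiableAt ℝ (fun ζ : ℂ => conj ζ) ζ := conjCLE.differentiableAt
      rw [he, dbar_sub (hcj.const_mul _) (by fun_prop), dbar_const_mul _ hcj, dbar_conj,
        dbar_of_differentiableAt (by fun_prop)]
      ring
    have h := integral_cauchy_pompeiu (χ := χ)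
      (q := fun ζ => p ζ - (p z + (del p z / 2 * (ζ - z) + f z / 2 * conj (ζ - z))))
      (g := fun ζ => f ζ - f z) (s := 0) (z := z)
      (m := 2) isOpen_ball hχ hχc hχU (hd' z hz) hd0 hz0 (hp.sub hl.contDiffOn)
      (fun ζ hζ => by
        rw [dbar_sub ((hp.contDiffAt (hUo.mem_nhds hζ)).differentiableAt (by norm_num))
          (hl.differentiable (by norm_num) ζ), hldbar, hpf ζ hζ]) ?_
      (tendsto_mul_sub_mul hχ.continuous h0 hl.continuous)
      (integrable_mul_sub_mul_inv_sq hC0 hbR haR hα hχ.continuous hχs hχb hf hC hz)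
    · have h1 : Integrable fun ζ => dbar χ ζ * p ζ * ((ζ - z) ^ 2)⁻¹ :=
        integrable_mul_inv_pow hpc hpcc
          (eventuallyEq_zero_of_norm_lt (fun ζ hζ => by rw [hd ζ hζ, zero_mul]) hz) 2
      have h2 : Integrable fun ζ => dbar χ ζ * ((ζ - z) ^ 2)⁻¹ :=
        integrable_mul_inv_pow hdc hχc.dbar (hd' z hz) 2
      have h3 : Integrable fun ζ => dbar χ ζ * conj ζ * ((ζ - z) ^ 2)⁻¹ :=
        integrable_mul_inv_pow hcc hccc
          (eventuallyEq_zero_of_norm_lt (fun ζ hζ => by rw [hd ζ hζ, zero_mul]) hz) 2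
      have h4 : Integrable fun ζ => dbar χ ζ * ((ζ - z) ^ 1)⁻¹ :=
        integrable_mul_inv_pow hdc hχc.dbar (hd' z hz) 1
      have h5 : ∫ ζ, dbar χ ζ * (p ζ - (p z + (del p z / 2 * (ζ - z) + f z / 2 * conj (ζ - z))))
            * ((ζ - z) ^ 2)⁻¹ =
          (∫ ζ, dbar χ ζ * p ζ * ((ζ - z) ^ 2)⁻¹) - (p z - f z / 2 * conj z) *
            (∫ ζ, dbar χ ζ * ((ζ - z) ^ 2)⁻¹) - del p z / 2 * (∫ ζ, dbar χ ζ * ((ζ - z) ^ 1)⁻¹)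
            - f z / 2 * (∫ ζ, dbar χ ζ * conj ζ * ((ζ - z) ^ 2)⁻¹) := by
        have e2 := h2.const_mul (p z - f z / 2 * conj z)
        have e3 := h3.const_mul (f z / 2)
        have e4 := h4.const_mul (del p z / 2)
        have h12 : Integrable fun ζ => dbar χ ζ * p ζ * ((ζ - z) ^ 2)⁻¹ -
          (p z - f z / 2 * conj z) * (dbar χ ζ * ((ζ - z) ^ 2)⁻¹) := h1.sub e2
        have h124 : Integrable fun ζ => dbar χ ζ * p ζ * ((ζ - z) ^ 2)⁻¹ -
          (p z - f z / 2 * conj z) * (dbar χ ζ * ((ζ - z) ^ 2)⁻¹) -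
          del p z / 2 * (dbar χ ζ * ((ζ - z) ^ 1)⁻¹) := h12.sub e4
        rw [← integral_const_mul, ← integral_const_mul, ← integral_const_mul,
          ← integral_sub h1 e2, ← integral_sub h12 e4, ← integral_sub h124 e3]
        congr 1
        funext ζ
        have h6 : (ζ - z) * ((ζ - z) ^ 2)⁻¹ = ((ζ - z) ^ 1)⁻¹ := by
          by_cases h : ζ - z = 0
          · simp [h]
          · field_simp
        rw [map_sub]
        linear_combination (- dbar χ ζ * del p z / 2) * h6
      rw [h5] at h
      linear_combination (-2) * h
    · have ho := hpz.hasFDerivAt.isLittleO.tendsto_div_nhds_zero.mono_left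
        (nhdsWithin_le_nhds (s := {z}ᶜ))
      refine ho.congr' ?_
      filter_upwards [self_mem_nhdsWithin] with ζ hζ
      have hζ' : ζ - z ≠ 0 := sub_ne_zero.2 hζ
      rw [fderiv_apply_eq_del_dbar, hpf z hzU]
      field_simp
      ring
  have hA := continuousAt_integral_mul_inv_pow hdc hχc.dbar ha hd 1
  have hA2 := continuousAt_integral_mul_inv_pow hdc hχc.dbar ha hd 2
  have hP2 := continuousAt_integral_mul_inv_pow hpc hpcc ha
    (fun ζ hζ => by rw [hd ζ hζ, zero_mul]) 2
  have hC2 := continuousAt_integral_mul_inv_pow hcc hccc ha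
    (fun ζ hζ => by rw [hd ζ hζ, zero_mul]) 2
  have hJ := continuousAt_integral_mul_sub_mul_inv_sq hC0 hbR haR ha hα hχ.continuous hχs hχb hf hC
  have hf0 : ContinuousAt f 0 := hf.continuousAt (ball_mem_nhds _ hR)
  have hfc : Tendsto (fun z => f z / 2) (𝓝[≠] 0) (𝓝 (f 0 / 2)) :=
    (hf0.div_const 2).mono_left nhdsWithin_le_nhds
  have hcj : Tendsto (fun z : ℂ => conj z) (𝓝[≠] 0) (𝓝 (conj 0)) :=
    (continuous_conj.tendsto 0).mono_left nhdsWithin_le_nhds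
  have hle : 𝓝[≠] (0 : ℂ) ≤ 𝓝 0 := nhdsWithin_le_nhds
  have hN := (((((hJ.mono_left hle).add (hP2.mono_left hle)).sub
    (hp0.mul (hA2.mono_left hle))).sub (hfc.mul (hC2.mono_left hle))).add
    ((hfc.mul hcj).mul (hA2.mono_left hle))).const_mul 2
  have hq := hN.div (hA.mono_left hle) hA0
  have hdel : ∃ c, Tendsto (del p) (𝓝[≠] 0) (𝓝 c) := by
    refine ⟨_, hq.congr' ?_⟩
    filter_upwards [nhdsWithin_le_nhds (ball_mem_nhds (0 : ℂ) ha), self_mem_nhdsWithin,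
      nhdsWithin_le_nhds (hA.eventually_ne hA0)] with z hz hz0 hAz
    have := key z (by simpa using hz) hz0
    simp only [Pi.div_apply]
    rw [← this, mul_div_cancel_right₀ _ hAz]
  obtain ⟨c, hc⟩ := hdel
  have hlim := ((hc.div_const 2).smul_const (ContinuousLinearMap.id ℝ ℂ)).add
    (hfc.smul_const (conjCLE : ℂ →L[ℝ] ℂ))
  refine ⟨_, hlim.congr' ?_⟩
  filter_upwards [nhdsWithin_le_nhds (ball_mem_nhds (0 : ℂ) hR), self_mem_nhdsWithin] with z hz hz0
  ext1 w
  rw [fderiv_apply_eq_del_dbar, hpf z ⟨hz, hz0⟩]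
  simp

section Removable

variable {E F : Type*} [NormedAddCommGroup E] [NormedSpace ℝ E] [NormedAddCommGroup F]
  [NormedSpace ℝ F]

/-- If the derivative of a continuous function has a limit at an isolated singularity, the function
is differentiable there. -/
lemma hasFDerivAt_of_tendsto_fderiv {f : E → F} {a : E} {L : E →L[ℝ] F} (hf : ContinuousAt f a)
    (hd : ∀ᶠ x in 𝓝[≠] a, DifferentiableAt ℝ f x) (hL : Tendsto (fderiv ℝ f) (𝓝[≠] a) (𝓝 L)) :
    HasFDerivAt f L a := by
  refine HasFDerivAt.of_isLittleO (Asymptotics.isLittleO_iff.2 fun ε hε => ?_)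
  have h1 := hL.eventually (closedBall_mem_nhds L hε)
  obtain ⟨δ, hδ, hδs⟩ := Metric.mem_nhdsWithin_iff.1 (hd.and h1)
  filter_upwards [ball_mem_nhds a hδ] with x hx
  by_cases hxa : x = a
  · simp [hxa]
  let s : Set E := AffineMap.lineMap (k := ℝ) a x '' Set.Ioc 0 1
  have hs : Convex ℝ s := (convex_Ioc (0 : ℝ) 1).affine_image _
  have hsub : ∀ y ∈ s, DifferentiableAt ℝ f y ∧ ‖fderiv ℝ f y - L‖ ≤ ε := by
    rintro y ⟨t, ht, rfl⟩
    have hn : AffineMap.lineMap (k := ℝ) a x t - a = t • (x - a) := by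
      simp [AffineMap.lineMap_apply]
    have h2 := hδs (a := AffineMap.lineMap (k := ℝ) a x t) ⟨?_, ?_⟩
    · exact ⟨h2.1, by simpa [dist_eq_norm] using h2.2⟩
    · rw [mem_ball, dist_eq_norm, hn, norm_smul, Real.norm_of_nonneg ht.1.le]
      rw [mem_ball, dist_eq_norm] at hx
      nlinarith [ht.2, norm_nonneg (x - a)]
    · intro h
      rw [Set.mem_singleton_iff, ← sub_eq_zero, hn, smul_eq_zero, sub_eq_zero] at h
      exact h.elim ht.1.ne' hxa
  have hxs : x ∈ s := ⟨1, by simp, by simp⟩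
  have hlim : Tendsto (fun t : ℝ => AffineMap.lineMap (k := ℝ) a x t) (𝓝[>] 0) (𝓝 a) := by
    have h3 : Continuous fun t : ℝ => AffineMap.lineMap (k := ℝ) a x t :=
      AffineMap.lineMap_continuous
    have := (h3.tendsto 0).mono_left (nhdsWithin_le_nhds (s := Set.Ioi 0))
    simpa using this
  have hg : ContinuousAt (fun y => ‖f x - f y - L (x - y)‖) a := by fun_prop
  have hg' : ContinuousAt (fun y => ε * ‖x - y‖) a := by fun_prop
  refine le_of_tendsto_of_tendsto (hg.tendsto.comp hlim) (hg'.tendsto.comp hlim) ?_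
  filter_upwards [Ioc_mem_nhdsGT (zero_lt_one' ℝ)] with t ht
  exact hs.norm_image_sub_le_of_norm_fderiv_le' (fun y hy => (hsub y hy).1)
    (fun y hy => (hsub y hy).2) ⟨t, ht, rfl⟩ hxs

lemma contDiffOn_one_of_tendsto_fderiv {f : E → F} {a : E} {L : E →L[ℝ] F} {U : Set E}
    (hU : IsOpen U) (ha : a ∈ U) (hf : ContinuousAt f a) (hd : ContDiffOn ℝ 1 f (U \ {a}))
    (hL : Tendsto (fderiv ℝ f) (𝓝[≠] a) (𝓝 L)) : ContDiffOn ℝ 1 f U := by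
  have hUo : IsOpen (U \ {a}) := hU.sdiff isClosed_singleton
  have hdiff : ∀ x ∈ U \ {a}, DifferentiableAt ℝ f x := fun x hx =>
    (hd.contDiffAt (hUo.mem_nhds hx)).differentiableAt (by norm_num)
  have ha' : HasFDerivAt f L a := by
    refine hasFDerivAt_of_tendsto_fderiv hf ?_ hL
    filter_upwards [nhdsWithin_le_nhds (hU.mem_nhds ha), self_mem_nhdsWithin] with x h1 h2
    exact hdiff x ⟨h1, h2⟩
  rw [show (1 : WithTop ℕ∞) = 0 + 1 by simp, contDiffOn_succ_iff_fderiv_of_isOpen hU]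
  refine ⟨fun x hx => ?_, by simp, ?_⟩
  · by_cases h : x = a
    · subst h
      exact ha'.differentiableAt.differentiableWithinAt
    · exact (hdiff x ⟨hx, h⟩).differentiableWithinAt
  · rw [contDiffOn_zero]
    intro x hx
    refine ContinuousAt.continuousWithinAt ?_
    by_cases h : x = a
    · subst h
      rw [← continuousWithinAt_compl_self, ContinuousWithinAt, ha'.fderiv]
      exact hL
    · exact (hd.continuousOn_fderiv_of_isOpen hUo (by norm_num)).continuousAt
        (hUo.mem_nhds ⟨hx, h⟩)

end Removable

/-- Local Hölder continuity at the origin. -/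
def HolderNearZero (f : ℂ → ℝ) : Prop :=
  ∃ α C δ : ℝ, 0 < α ∧ α ≤ 1 ∧ 0 ≤ C ∧ 0 < δ ∧
    ∀ x ∈ ball (0 : ℂ) δ, ∀ y ∈ ball (0 : ℂ) δ, |f x - f y| ≤ C * ‖x - y‖ ^ α

lemma HolderNearZero.mul {f g : ℂ → ℝ} (hf : HolderNearZero f) (hg : HolderNearZero g) :
    HolderNearZero fun z => f z * g z := by
  obtain ⟨α, C, δ, hα, hα1, hC, hδ, hf⟩ := hf
  obtain ⟨β, D, η, hβ, hβ1, hD, hη, hg⟩ := hg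
  have hpow : ∀ {x y : ℂ}, x ∈ ball (0 : ℂ) (1 / 2) → y ∈ ball (0 : ℂ) (1 / 2) →
      ‖x - y‖ ≤ 1 := by
    intro x y hx hy
    simp only [mem_ball, dist_zero_right] at hx hy
    linarith [norm_sub_le x y]
  refine ⟨min α β, (|f 0| + C) * D + (|g 0| + D) * C, min (min δ η) (1 / 2), lt_min hα hβ,
    (min_le_left _ _).trans hα1, by positivity, by positivity, fun x hx y hy => ?_⟩
  have hle1 : min (min δ η) (1 / 2) ≤ δ := (min_le_left _ _).trans (min_le_left _ _)
  have hle2 : min (min δ η) (1 / 2) ≤ η := (min_le_left _ _).trans (min_le_right _ _)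
  have hle3 : min (min δ η) (1 / 2 : ℝ) ≤ 1 / 2 := min_le_right _ _
  have hxy : ‖x - y‖ ≤ 1 := hpow (ball_subset_ball hle3 hx) (ball_subset_ball hle3 hy)
  have hy1 : ‖y - 0‖ ≤ 1 := hpow (ball_subset_ball hle3 hy) (by simp)
  have hx1 : ‖x - 0‖ ≤ 1 := hpow (ball_subset_ball hle3 hx) (by simp)
  have hfx := hf x (ball_subset_ball hle1 hx) 0 (by simpa using hδ)
  have hgy := hg y (ball_subset_ball hle2 hy) 0 (by simpa using hη)
  have hfxy := hf x (ball_subset_ball hle1 hx) y (ball_subset_ball hle1 hy)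
  have hgxy := hg x (ball_subset_ball hle2 hx) y (ball_subset_ball hle2 hy)
  have hx2 : |f x| ≤ |f 0| + C := by
    have h1 : C * ‖x - 0‖ ^ α ≤ C :=
      mul_le_of_le_one_right hC (Real.rpow_le_one (norm_nonneg _) hx1 hα.le)
    linarith [abs_sub_abs_le_abs_sub (f x) (f 0)]
  have hy2 : |g y| ≤ |g 0| + D := by
    have h1 : D * ‖y - 0‖ ^ β ≤ D :=
      mul_le_of_le_one_right hD (Real.rpow_le_one (norm_nonneg _) hy1 hβ.le)
    linarith [abs_sub_abs_le_abs_sub (g y) (g 0)]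
  have hα' : ‖x - y‖ ^ α ≤ ‖x - y‖ ^ min α β :=
    Real.rpow_le_rpow_of_exponent_ge_of_imp (norm_nonneg _) hxy (min_le_left _ _)
      fun _ h => absurd h hα.ne'
  have hβ' : ‖x - y‖ ^ β ≤ ‖x - y‖ ^ min α β :=
    Real.rpow_le_rpow_of_exponent_ge_of_imp (norm_nonneg _) hxy (min_le_right _ _)
      fun _ h => absurd h hβ.ne'
  calc |f x * g x - f y * g y| = |f x * (g x - g y) + g y * (f x - f y)| := by ring_nf
    _ ≤ |f x| * |g x - g y| + |g y| * |f x - f y| := by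
        rw [← abs_mul, ← abs_mul]; exact abs_add_le _ _
    _ ≤ (|f 0| + C) * (D * ‖x - y‖ ^ min α β) + (|g 0| + D) * (C * ‖x - y‖ ^ min α β) := by
        gcongr
        · exact hgxy.trans (by gcongr)
        · exact hfxy.trans (by gcongr)
    _ = _ := by ring

lemma holderNearZero_of_contDiffAt {f : ℂ → ℝ} (hf : ContDiffAt ℝ 1 f 0) : HolderNearZero f := by
  obtain ⟨K, t, ht, hK⟩ := hf.exists_lipschitzOnWith
  obtain ⟨δ, hδ, hδt⟩ := Metric.mem_nhds_iff.1 ht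
  refine ⟨1, K, δ, one_pos, le_rfl, K.2, hδ, fun x hx y hy => ?_⟩
  have := hK.dist_le_mul x (hδt hx) y (hδt hy)
  rwa [Real.dist_eq, dist_eq_norm, ← Real.rpow_one ‖x - y‖] at this

lemma HolderOnWith.holderNearZero {f : ℂ → ℝ} {C α : ℝ≥0} {s : Set ℂ} (hf : HolderOnWith C α f s)
    (hs : s ∈ 𝓝 0) (hα : 0 < α) (hα1 : α ≤ 1) : HolderNearZero f := by
  obtain ⟨δ, hδ, hδs⟩ := Metric.mem_nhds_iff.1 hs
  refine ⟨α, C, δ, by exact_mod_cast hα, by exact_mod_cast hα1, C.2, hδ, fun x hx y hy => ?_⟩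
  have := hf.dist_le (hδs hx) (hδs hy)
  rwa [Real.dist_eq, dist_eq_norm] at this

lemma abs_rpow_sub_rpow_le {a b t : ℝ} (ha : 0 ≤ a) (hb : 0 ≤ b) (ht : 0 ≤ t) (ht1 : t ≤ 1) :
    |a ^ t - b ^ t| ≤ |a - b| ^ t := by
  wlog h : b ≤ a generalizing a b
  · rw [abs_sub_comm, abs_sub_comm a]
    exact this hb ha (le_of_not_ge h)
  rw [abs_of_nonneg (sub_nonneg.2 (Real.rpow_le_rpow hb h ht)), abs_of_nonneg (sub_nonneg.2 h)]
  have := Real.rpow_add_le_add_rpow hb (sub_nonneg.2 h) ht ht1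
  rw [add_sub_cancel] at this
  linarith

lemma holderNearZero_norm_rpow {t : ℝ} (ht : 0 ≤ t) : HolderNearZero fun z => ‖z‖ ^ t := by
  rcases ht.eq_or_lt with rfl | ht0
  · simpa using holderNearZero_of_contDiffAt (f := fun _ => 1) contDiffAt_const
  rcases le_total t 1 with ht1 | ht1
  · refine ⟨t, 1, 1, ht0, ht1, zero_le_one, one_pos, fun x _ y _ => ?_⟩
    rw [one_mul]
    refine (abs_rpow_sub_rpow_le (norm_nonneg _) (norm_nonneg _) ht ht1).trans ?_
    exact Real.rpow_le_rpow (abs_nonneg _) (abs_norm_sub_norm_le x y) ht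
  · have h : ContDiffAt ℝ 1 (fun x : ℝ => x ^ t) 0 :=
      (Real.contDiff_rpow_const_of_le (n := 1) (by simpa using ht1)).contDiffAt
    obtain ⟨K, s, hs, hK⟩ := h.exists_lipschitzOnWith
    obtain ⟨δ, hδ, hδs⟩ := Metric.mem_nhds_iff.1 hs
    refine ⟨1, K, δ, one_pos, le_rfl, K.2, hδ, fun x hx y hy => ?_⟩
    have := hK.dist_le_mul ‖x‖ (hδs (by simpa using hx)) ‖y‖ (hδs (by simpa using hy))
    rw [Real.dist_eq, Real.dist_eq] at this
    rw [Real.rpow_one]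
    exact this.trans (by gcongr; exact abs_norm_sub_norm_le x y)

/-- The Wirtinger coordinate of a real covector: `c ↦ (w ↦ Re (c w))`. -/
noncomputable def reMul : ℂ →L[ℝ] ℂ →L[ℝ] ℝ :=
  ((ContinuousLinearMap.compL ℝ ℂ ℂ ℝ) reCLM).comp (ContinuousLinearMap.mul ℝ ℂ)

@[simp] lemma reMul_apply (c w : ℂ) : reMul c w = (c * w).re := rfl

lemma fderiv_ofReal_comp {r : ℂ → ℝ} {z : ℂ} (hr : DifferentiableAt ℝ r z) (v : ℂ) :
    fderiv ℝ (fun w => (r w : ℂ)) z v = (fderiv ℝ r z v : ℂ) := by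
  have := (ofRealCLM.hasFDerivAt.comp z hr.hasFDerivAt).fderiv
  have h : (ofRealCLM ∘ r) = fun w => (r w : ℂ) := rfl
  rw [h] at this
  rw [this]
  rfl

lemma del_ofReal_comp {r : ℂ → ℝ} {z : ℂ} (hr : DifferentiableAt ℝ r z) :
    del (fun w => (r w : ℂ)) z = (fderiv ℝ r z 1 : ℂ) - I * (fderiv ℝ r z I : ℂ) := by
  rw [del, fderiv_ofReal_comp hr, fderiv_ofReal_comp hr]

lemma fderiv_eq_reMul_del {r : ℂ → ℝ} {z : ℂ} (hr : DifferentiableAt ℝ r z) :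
    fderiv ℝ r z = reMul (del (fun w => (r w : ℂ)) z) := by
  ext w
  have hw : w = w.re • (1 : ℂ) + w.im • I := by simp [Complex.re_add_im]
  rw [reMul_apply, del_ofReal_comp hr]
  conv_lhs => rw [hw, map_add, map_smul, map_smul]
  simp [Complex.mul_re]
  ring

lemma dbar_del_ofReal_comp {r : ℂ → ℝ} {z : ℂ} (hr : ContDiffAt ℝ 2 r z) :
    dbar (del fun w => (r w : ℂ)) z = lapl r z := by
  have hev : del (fun w => (r w : ℂ)) =ᶠ[𝓝 z]
      fun w => (fderiv ℝ r w 1 : ℂ) - I * (fderiv ℝ r w I : ℂ) := by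
    filter_upwards [hr.eventually (by simp)] with w hw
    exact del_ofReal_comp (hw.differentiableAt (by norm_num))
  have hD : DifferentiableAt ℝ (fderiv ℝ r) z :=
    (hr.fderiv_right (m := 1) (by norm_num)).differentiableAt (by norm_num)
  have h1 : ∀ v, DifferentiableAt ℝ (fun w => fderiv ℝ r w v) z := fun v =>
    hD.clm_apply (differentiableAt_const v)
  have h2 : ∀ v, DifferentiableAt ℝ (fun w => (fderiv ℝ r w v : ℂ)) z := fun v =>
    ofRealCLM.differentiableAt.comp z (h1 v)
  have h3 : ∀ a b, fderiv ℝ (fun w => fderiv ℝ r w a) z b = fderiv ℝ (fderiv ℝ r) z b a := by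
    intro a b
    rw [fderiv_clm_apply hD (differentiableAt_const a)]
    simp
  have hsymm : fderiv ℝ (fderiv ℝ r) z 1 I = fderiv ℝ (fderiv ℝ r) z I 1 :=
    (hr.isSymmSndFDerivAt (by simp)).eq 1 I
  rw [hev.dbar_eq, dbar_sub (h2 1) ((h2 I).const_mul I), dbar_const_mul _ (h2 I)]
  unfold dbar lapl
  rw [fderiv_ofReal_comp (h1 1), fderiv_ofReal_comp (h1 1), fderiv_ofReal_comp (h1 I),
    fderiv_ofReal_comp (h1 I), h3, h3, h3, h3, hsymm]
  push_cast
  linear_combination (-(fderiv ℝ (fderiv ℝ r) z I I : ℂ)) * I_sq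

lemma contDiffAt_log_norm {z : ℂ} (hz : z ≠ 0) {n : WithTop ℕ∞} :
    ContDiffAt ℝ n (fun w : ℂ => Real.log ‖w‖) z :=
  (contDiffAt_norm ℝ hz).log (norm_ne_zero_iff.2 hz)

lemma del_log_norm {z : ℂ} (hz : z ≠ 0) : del (fun w => (Real.log ‖w‖ : ℂ)) z = z⁻¹ := by
  rw [del_ofReal_comp ((contDiffAt_log_norm hz (n := 1)).differentiableAt (by norm_num))]
  have h1 : (fun w : ℂ => Real.log ‖w‖) = fun w => (1 / 2) * Real.log (‖w‖ ^ 2) := by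
    funext w
    rw [Real.log_pow]
    push_cast
    ring
  have hz2 : ‖z‖ ^ 2 ≠ 0 := by positivity
  have h2 : HasFDerivAt (fun w : ℂ => ‖w‖ ^ 2) (2 • innerSL ℝ z) z :=
    (hasStrictFDerivAt_norm_sq z).hasFDerivAt
  have h3 := ((h2.log hz2).const_mul (1 / 2)).fderiv
  rw [h1, h3, Complex.inv_def, Complex.normSq_eq_norm_sq]
  have hc : conj z = z.re - z.im * I := by
    apply Complex.ext <;> simp
  rw [hc]
  simp [Complex.inner]
  ring

lemma HolderNearZero.exists_norm_ofReal_sub_le {f : ℂ → ℝ} (hf : HolderNearZero f) :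
    ∃ α C R : ℝ, 0 < α ∧ 0 ≤ C ∧ 0 < R ∧ R ≤ 1 ∧ ∀ x ∈ ball (0 : ℂ) R, ∀ y ∈ ball (0 : ℂ) R,
      ‖(f x : ℂ) - f y‖ ≤ C * ‖x - y‖ ^ α := by
  obtain ⟨α, C, δ, hα, -, hC, hδ, h⟩ := hf
  refine ⟨α, C, min δ 1, hα, hC, by positivity, min_le_right _ _, fun x hx y hy => ?_⟩
  rw [← ofReal_sub, Complex.norm_real, Real.norm_eq_abs]
  exact h x (ball_subset_ball (min_le_left _ _) hx) y (ball_subset_ball (min_le_left _ _) hy)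

lemma lapl_sub_mul_log_norm {u : ℂ → ℝ} {z : ℂ} (γ : ℝ) (hz : z ≠ 0) (hu : ContDiffAt ℝ 2 u z) :
    lapl (fun w => u w - γ * Real.log ‖w‖) z = lapl u z := by
  have hr : ContDiffAt ℝ 2 (fun w => u w - γ * Real.log ‖w‖) z :=
    hu.sub (contDiffAt_const.mul (contDiffAt_log_norm hz))
  have hev : del (fun w => ((u w - γ * Real.log ‖w‖ : ℝ) : ℂ)) =ᶠ[𝓝 z]
      fun w => del (fun w => (u w : ℂ)) w - γ * w⁻¹ := by
    filter_upwards [hu.eventually (by simp), isOpen_ne.mem_nhds hz] with w hw hw0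
    have h1 := hw.differentiableAt (by norm_num)
    have h2 := (contDiffAt_log_norm hw0 (n := 1)).differentiableAt (by norm_num)
    have h3 := del_log_norm hw0
    rw [del_ofReal_comp h2] at h3
    rw [del_ofReal_comp (h1.fun_sub (h2.const_mul γ)), del_ofReal_comp h1, ← h3,
      fderiv_fun_sub h1 (h2.const_mul γ), fderiv_const_mul h2]
    simp
    ring
  have hd : DifferentiableAt ℝ (del fun w => (u w : ℂ)) z := by
    obtain ⟨U, hU, hUo, hzU⟩ := _root_.mem_nhds_iff.1 (hu.eventually (by simp))
    have hc : ContDiffOn ℝ 2 (fun w => (u w : ℂ)) U := fun w hw => by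
      have hw' : ContDiffAt ℝ 2 u w := hU hw
      exact (ofRealCLM.contDiff.contDiffAt.comp w hw').contDiffWithinAt
    exact ((hc.del_of_isOpen hUo).contDiffAt (hUo.mem_nhds hzU)).differentiableAt (by norm_num)
  have h := hev.dbar_eq
  rw [dbar_del_ofReal_comp hr, dbar_sub hd, dbar_del_ofReal_comp hu, dbar_of_differentiableAt,
    sub_zero] at h
  · exact_mod_cast h
  · fun_prop (disch := assumption)
  · have : DifferentiableAt ℂ (fun w : ℂ => (γ : ℂ) * w⁻¹) z := by fun_prop (disch := assumption)
    exact this.restrictScalars ℝ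

/-- Removability of an isolated singularity for `Δr = f` with `r` continuous and `f` continuous,
where `f` is Hölder continuous as soon as `r` is `C¹`. -/
lemma contDiffOn_two_of_lapl_eq {r f : ℂ → ℝ} (hrc : ContinuousOn r (ball 0 1))
    (hr : ContDiffOn ℝ 2 r (ball 0 1 \ {0})) (hfc : ContinuousOn f (ball 0 1))
    (hrf : ∀ z ∈ ball (0 : ℂ) 1 \ {0}, lapl r z = f z)
    (hf : ContDiffAt ℝ 1 r 0 → HolderNearZero f) : ContDiffOn ℝ 2 r (ball 0 1) := by
  have hUo : IsOpen (ball (0 : ℂ) 1 \ {0}) := isOpen_ball.sdiff isClosed_singleton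
  have h01 : (0 : ℂ) ∈ ball (0 : ℂ) 1 := by simp
  have hU0 : ball (0 : ℂ) 1 \ {0} ∈ 𝓝[≠] (0 : ℂ) :=
    sdiff_mem_nhdsWithin_compl (ball_mem_nhds 0 one_pos) {0}
  have hdiff : ∀ z ∈ ball (0 : ℂ) 1 \ {0}, DifferentiableAt ℝ r z := fun z hz =>
    (hr.contDiffAt (hUo.mem_nhds hz)).differentiableAt (by norm_num)
  set p : ℂ → ℂ := del fun w => (r w : ℂ) with hp
  have hrC : ContDiffOn ℝ 2 (fun w => (r w : ℂ)) (ball 0 1 \ {0}) :=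
    ofRealCLM.contDiff.comp_contDiffOn hr
  have hp1 : ContDiffOn ℝ 1 p (ball 0 1 \ {0}) := hrC.del_of_isOpen hUo
  have hpf : ∀ z ∈ ball (0 : ℂ) 1 \ {0}, dbar p z = f z := fun z hz => by
    rw [hp, dbar_del_ofReal_comp (hr.contDiffAt (hUo.mem_nhds hz)), hrf z hz]
  have hfcC : ContinuousOn (fun z => (f z : ℂ)) (ball 0 1) :=
    continuous_ofReal.comp_continuousOn hfc
  have hfr : ∀ z ∈ ball (0 : ℂ) 1 \ {0}, fderiv ℝ r z = reMul (p z) := fun z hz =>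
    fderiv_eq_reMul_del (hdiff z hz)
  have hsub : ball (0 : ℂ) (1 / 2) ⊆ ball 0 1 := ball_subset_ball (by norm_num)
  obtain ⟨B, hB⟩ := (isCompact_closedBall (0 : ℂ) (1 / 2)).exists_bound_of_continuousOn
    (hfcC.mono (closedBall_subset_ball (by norm_num)))
  have hgrad : Tendsto (fun ζ => p ζ * ζ) (𝓝[≠] 0) (𝓝 0) := by
    refine tendsto_mul_del (R := 1 / 2) (B := B) (by norm_num)
      (hrC.mono (Set.sdiff_subset_sdiff_left hsub)) ?_ fun ζ hζ => ?_
    · exact continuous_ofReal.continuousAt.comp (hrc.continuousAt (ball_mem_nhds 0 one_pos))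
    · rw [← hp, hpf ζ ⟨hsub hζ.1, hζ.2⟩]
      exact hB ζ (ball_subset_closedBall hζ.1)
  obtain ⟨p0, hp0⟩ := exists_tendsto_of_dbar_eq one_pos hp1 hfcC hpf hgrad
  have hr1 : ContDiffOn ℝ 1 r (ball 0 1) := by
    refine contDiffOn_one_of_tendsto_fderiv (L := reMul p0) isOpen_ball h01
      (hrc.continuousAt (ball_mem_nhds 0 one_pos)) (hr.of_le (by norm_num)) ?_
    refine ((reMul.continuous.tendsto p0).comp hp0).congr' ?_
    filter_upwards [hU0] with z hz using (hfr z hz).symm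
  obtain ⟨α, C, R, hα, hC, hR, hR1, hH⟩ :=
    (hf (hr1.contDiffAt (ball_mem_nhds 0 one_pos))).exists_norm_ofReal_sub_le
  have hsubR : ball (0 : ℂ) R ⊆ ball 0 1 := ball_subset_ball hR1
  obtain ⟨L, hL⟩ := exists_tendsto_fderiv_of_dbar_eq hR hα hC
    (hp1.mono (Set.sdiff_subset_sdiff_left hsubR)) (hfcC.mono hsubR) hH
    (fun ζ hζ => hpf ζ ⟨hsubR hζ.1, hζ.2⟩) hp0
  rw [show (2 : WithTop ℕ∞) = 1 + 1 by norm_num, contDiffOn_succ_iff_fderiv_of_isOpen isOpen_ball]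
  refine ⟨hr1.differentiableOn (by norm_num), by simp, ?_⟩
  refine contDiffOn_one_of_tendsto_fderiv (L := reMul.comp L) isOpen_ball h01
    ((hr1.continuousOn_fderiv_of_isOpen isOpen_ball (by norm_num)).continuousAt
      (ball_mem_nhds 0 one_pos)) (hr.fderiv_of_isOpen hUo (by norm_num)) ?_
  have hcomp : Tendsto (fun z => reMul.comp (fderiv ℝ p z)) (𝓝[≠] 0) (𝓝 (reMul.comp L)) :=
    (Continuous.tendsto (by fun_prop) L).comp hL
  refine hcomp.congr' ?_
  filter_upwards [hU0] with z hz
  have hev : fderiv ℝ r =ᶠ[𝓝 z] fun w => reMul (p w) := by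
    filter_upwards [hUo.mem_nhds hz] with w hw using hfr w hw
  rw [hev.fderiv_eq]
  exact (reMul.hasFDerivAt.comp z ((hp1.contDiffAt (hUo.mem_nhds hz)).differentiableAt
    (by norm_num)).hasFDerivAt).fderiv.symm

end

/-- Theorem 1.1 (C² regularity of the remainder): with u = γ·log|z| + r as in the
expansion, if γ ≥ 0 and k extends to a locally Hölder continuous function on 𝔻,
then r is C² on all of 𝔻. -/
theorem remainder_C2 (k u : ℂ → ℝ) (γ : ℝ) (r : ℂ → ℝ)
    (hk_cont : ContinuousOn k (ball (0 : ℂ) 1 \ {0}))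
    (hk_bdd : ∃ M : ℝ, ∀ z ∈ ball (0 : ℂ) 1 \ {0}, |k z| ≤ M)
    (hk_nonpos : ∀ z ∈ ball (0 : ℂ) 1 \ {0}, k z ≤ 0)
    (hk_holder : ∃ K : ℂ → ℝ, (∀ z ∈ ball (0 : ℂ) 1 \ {0}, K z = k z) ∧
      ∀ z ∈ ball (0 : ℂ) 1, ∃ s ∈ nhds z, ∃ (C α : ℝ≥0),
        0 < α ∧ α ≤ 1 ∧ HolderOnWith C α K s)
    (hu : ContDiffOn ℝ 2 u (ball (0 : ℂ) 1 \ {0}))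
    (hpde : ∀ z ∈ ball (0 : ℂ) 1 \ {0}, lapl u z = k z * Real.exp (2 * u z))
    (hint : ∫⁻ z in ball (0 : ℂ) 1, ENNReal.ofReal (Real.exp (2 * u z)) < ⊤)
    (hγ : -1 < γ)
    (hr_cont : ContinuousOn r (ball (0 : ℂ) 1))
    (hdecomp : ∀ z ∈ ball (0 : ℂ) 1 \ {0}, u z = γ * Real.log ‖z‖ + r z)
    (hγ0 : 0 ≤ γ) :
    ContDiffOn ℝ 2 r (ball (0 : ℂ) 1) := by
  obtain ⟨K, hKk, hK⟩ := hk_holder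
  have hUo : IsOpen (ball (0 : ℂ) 1 \ {0}) := isOpen_ball.sdiff isClosed_singleton
  have hreq : ∀ z ∈ ball (0 : ℂ) 1 \ {0}, r z = u z - γ * Real.log ‖z‖ := fun z hz => by
    rw [hdecomp z hz]; ring
  have hr2 : ContDiffOn ℝ 2 r (ball (0 : ℂ) 1 \ {0}) :=
    (hu.sub (contDiffOn_const.mul fun z hz =>
      (contDiffAt_log_norm hz.2).contDiffWithinAt)).congr hreq
  have hKc : ContinuousOn K (ball 0 1) := fun z hz => by
    obtain ⟨s, hs, C, α, hα, -, hC⟩ := hK z hz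
    exact ((hC.continuousOn hα).continuousAt hs).continuousWithinAt
  refine contDiffOn_two_of_lapl_eq (f := fun z => K z * ‖z‖ ^ (2 * γ) * Real.exp (2 * r z))
    hr_cont hr2 ?_ ?_ ?_
  · refine (hKc.mul ?_).mul (by fun_prop)
    exact (continuous_norm.rpow_const fun _ => Or.inr (by positivity)).continuousOn
  · intro z hz
    have hev : r =ᶠ[nhds z] fun w => u w - γ * Real.log ‖w‖ := by
      filter_upwards [hUo.mem_nhds hz] with w hw using hreq w hw
    have h1 : lapl r z = lapl (fun w => u w - γ * Real.log ‖w‖) z := by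
      have h2 : ∀ v, (fun w => fderiv ℝ r w v) =ᶠ[nhds z]
          fun w => fderiv ℝ (fun w => u w - γ * Real.log ‖w‖) w v := fun v => by
        filter_upwards [hev.fderiv (𝕜 := ℝ)] with w hw
        rw [hw]
      unfold lapl
      rw [(h2 1).fderiv_eq, (h2 Complex.I).fderiv_eq]
    rw [h1, lapl_sub_mul_log_norm γ hz.2 (hu.contDiffAt (hUo.mem_nhds hz)), hpde z hz, ← hKk z hz,
      hdecomp z hz, mul_assoc, Real.rpow_def_of_pos (norm_pos_iff.2 hz.2), ← Real.exp_add]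
    ring_nf
  · intro hr1
    obtain ⟨s, hs, C, α, hα, hα1, hC⟩ := hK 0 (mem_ball_self one_pos)
    refine ((hC.holderNearZero hs hα hα1).mul (holderNearZero_norm_rpow (by positivity))).mul ?_
    exact holderNearZero_of_contDiffAt (contDiffAt_const.mul hr1).exp
end

section
/- Let k : 𝔻∖{0} → ℝ be a bounded, nonpositive, continuous function and let u : 𝔻∖{0} → ℝ be a C² solution of Δu(z) = k(z)·e^{2u(z)} on 𝔻∖{0} with ∬_𝔻 e^{2u(z)} dxdy < ∞. Then there exist a real number γ > −1 and a harmonic function h on 𝔻 such that u(z) = γ·log|z| + h(z) + v(z) for all z ∈ 𝔻∖{0}, where v is the Newton potential of the function z ↦ k(z)·e^{2u(z)}. -/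
open Metric MeasureTheory
open scoped ENNReal

/-- The Newton potential v(z) = (1/2π) ∬_𝔻 log|z−ζ| f(ζ) dσ_ζ of f on the unit disk. -/
noncomputable def newtonPotential (f : ℂ → ℝ) (z : ℂ) : ℝ :=
  (2 * Real.pi)⁻¹ * ∫ ζ in Metric.ball (0 : ℂ) 1, Real.log ‖z - ζ‖ * f ζ

/-- A function is harmonic on a set if it is C² there and its Laplacian vanishes. -/
def IsHarmonicOn (h : ℂ → ℝ) (s : Set ℂ) : Prop :=
  ContDiffOn ℝ 2 h s ∧ ∀ z ∈ s, lapl h z = 0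


open Filter Topology

lemma contDiff_one_fderiv_apply {φ : ℂ → ℝ} (hφ : ContDiff ℝ 2 φ) (e : ℂ) :
    ContDiff ℝ 1 (fun w => fderiv ℝ φ w e) :=
  (hφ.fderiv_right (m := 1) (by norm_num)).clm_apply contDiff_const

lemma continuous_fderiv_fderiv_apply {φ : ℂ → ℝ} (hφ : ContDiff ℝ 2 φ) (e : ℂ) :
    Continuous (fun z => fderiv ℝ (fun w => fderiv ℝ φ w e) z e) :=
  (((contDiff_one_fderiv_apply hφ e).fderiv_right (m := 0) (by norm_num)).clm_apply
    contDiff_const).continuous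

lemma continuous_lapl {φ : ℂ → ℝ} (hφ : ContDiff ℝ 2 φ) : Continuous (lapl φ) :=
  (continuous_fderiv_fderiv_apply hφ 1).add (continuous_fderiv_fderiv_apply hφ Complex.I)

lemma hasCompactSupport_lapl {φ : ℂ → ℝ} (hc : HasCompactSupport φ) :
    HasCompactSupport (lapl φ) :=
  ((hc.fderiv_apply (𝕜 := ℝ) 1).fderiv_apply (𝕜 := ℝ) 1).add
    ((hc.fderiv_apply (𝕜 := ℝ) Complex.I).fderiv_apply (𝕜 := ℝ) Complex.I)

lemma integral_mul_fderiv_fderiv {G φ : ℂ → ℝ} (hG : ContDiff ℝ 2 G) (hφ : ContDiff ℝ 2 φ)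
    (hc : HasCompactSupport φ) (e : ℂ) :
    ∫ z, G z * fderiv ℝ (fun w => fderiv ℝ φ w e) z e
      = ∫ z, fderiv ℝ (fun w => fderiv ℝ G w e) z e * φ z := by
  have hG1 := contDiff_one_fderiv_apply hG e
  have hφ1 := contDiff_one_fderiv_apply hφ e
  have hG2 := continuous_fderiv_fderiv_apply hG e
  have hφ2 := continuous_fderiv_fderiv_apply hφ e
  have hc1 := hc.fderiv_apply (𝕜 := ℝ) e
  have hc2 := hc1.fderiv_apply (𝕜 := ℝ) e
  have hi : ∀ {f g : ℂ → ℝ}, Continuous f → Continuous g → HasCompactSupport g →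
      Integrable (fun x => f x * g x) := fun hf hg hcg =>
    (hf.mul hg).integrable_of_hasCompactSupport hcg.mul_left
  rw [integral_mul_fderiv_eq_neg_fderiv_mul_of_integrable
      (hi hG1.continuous hφ1.continuous hc1) (hi hG.continuous hφ2 hc2)
      (hi hG.continuous hφ1.continuous hc1)
      (fun x _ => (hG.differentiable (by norm_num)).differentiableAt)
      (fun x _ => (hφ1.differentiable (by norm_num)).differentiableAt),
    integral_mul_fderiv_eq_neg_fderiv_mul_of_integrable
      (hi hG2 hφ.continuous hc) (hi hG1.continuous hφ1.continuous hc1)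
      (hi hG1.continuous hφ.continuous hc)
      (fun x _ => (hG1.differentiable (by norm_num)).differentiableAt)
      (fun x _ => (hφ.differentiable (by norm_num)).differentiableAt), neg_neg]

lemma integral_mul_lapl {G φ : ℂ → ℝ} (hG : ContDiff ℝ 2 G) (hφ : ContDiff ℝ 2 φ)
    (hc : HasCompactSupport φ) :
    ∫ z, G z * lapl φ z = ∫ z, lapl G z * φ z := by
  have hi1 : ∀ e : ℂ, Integrable (fun z => G z * fderiv ℝ (fun w => fderiv ℝ φ w e) z e) :=
    fun e => (hG.continuous.mul (continuous_fderiv_fderiv_apply hφ e)).integrable_of_hasCompactSupport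
      ((hc.fderiv_apply (𝕜 := ℝ) e).fderiv_apply (𝕜 := ℝ) e).mul_left
  have hi2 : ∀ e : ℂ, Integrable (fun z => fderiv ℝ (fun w => fderiv ℝ G w e) z e * φ z) :=
    fun e => ((continuous_fderiv_fderiv_apply hG e).mul hφ.continuous).integrable_of_hasCompactSupport
      hc.mul_left
  simp only [lapl, mul_add, add_mul]
  rw [integral_add (hi1 _) (hi1 _), integral_add (hi2 _) (hi2 _),
    integral_mul_fderiv_fderiv hG hφ hc, integral_mul_fderiv_fderiv hG hφ hc]

/-- A smooth approximation of `log ‖z‖`. -/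
noncomputable def smoothLog (ε : ℝ) (z : ℂ) : ℝ :=
  2⁻¹ * Real.log (z.re ^ 2 + z.im ^ 2 + ε ^ 2)

lemma contDiff_smoothLog {ε : ℝ} (hε : 0 < ε) : ContDiff ℝ 2 (smoothLog ε) := by
  unfold smoothLog
  have h1 : ContDiff ℝ 2 (fun z : ℂ => z.re) := Complex.reCLM.contDiff
  have h2 : ContDiff ℝ 2 (fun z : ℂ => z.im) := Complex.imCLM.contDiff
  exact contDiff_const.mul
    ((((h1.pow 2).add (h2.pow 2)).add contDiff_const).log (fun z => by positivity))

lemma lapl_smoothLog {ε : ℝ} (hε : 0 < ε) (z : ℂ) :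
    lapl (smoothLog ε) z = 2 * ε ^ 2 / (‖z‖ ^ 2 + ε ^ 2) ^ 2 := by
  have hre : ∀ z : ℂ, HasFDerivAt (fun z : ℂ => z.re) Complex.reCLM z :=
    fun z => Complex.reCLM.hasFDerivAt
  have him : ∀ z : ℂ, HasFDerivAt (fun z : ℂ => z.im) Complex.imCLM z :=
    fun z => Complex.imCLM.hasFDerivAt
  have hpos : ∀ z : ℂ, z.re ^ 2 + z.im ^ 2 + ε ^ 2 ≠ 0 := fun z => by positivity
  have hD : ∀ z : ℂ, HasFDerivAt (fun z : ℂ => z.re ^ 2 + z.im ^ 2 + ε ^ 2) _ z :=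
    fun z => (((hre z).pow 2).add ((him z).pow 2)).add_const (ε ^ 2)
  have h1 : ∀ z : ℂ, fderiv ℝ (smoothLog ε) z = _ :=
    fun z => (((hD z).log (hpos z)).const_mul 2⁻¹).fderiv
  have e1 : (fun w => fderiv ℝ (smoothLog ε) w 1) =
      fun w : ℂ => w.re * (w.re ^ 2 + w.im ^ 2 + ε ^ 2)⁻¹ := by
    funext w; rw [h1]; simp; ring
  have e2 : (fun w => fderiv ℝ (smoothLog ε) w Complex.I) =
      fun w : ℂ => w.im * (w.re ^ 2 + w.im ^ 2 + ε ^ 2)⁻¹ := by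
    funext w; rw [h1]; simp; ring
  have hn : ‖z‖ ^ 2 = z.re ^ 2 + z.im ^ 2 := by
    rw [Complex.sq_norm, Complex.normSq_apply]; ring
  have hI : HasFDerivAt (fun z : ℂ => (z.re ^ 2 + z.im ^ 2 + ε ^ 2)⁻¹) _ z :=
    (hasDerivAt_inv (hpos z)).comp_hasFDerivAt z (hD z)
  have f1 : fderiv ℝ (fun w : ℂ => w.re * (w.re ^ 2 + w.im ^ 2 + ε ^ 2)⁻¹) z = _ :=
    ((hre z).mul hI).fderiv
  have f2 : fderiv ℝ (fun w : ℂ => w.im * (w.re ^ 2 + w.im ^ 2 + ε ^ 2)⁻¹) z = _ :=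
    ((him z).mul hI).fderiv
  rw [lapl, e1, e2, f1, f2, hn]
  have := hpos z
  simp
  field_simp
  ring

lemma locallyIntegrable_log_norm : LocallyIntegrable (fun z : ℂ => Real.log ‖z‖) := by
  rw [locallyIntegrable_iff]
  intro K hK
  obtain ⟨R, hR⟩ := hK.isBounded.subset_ball 0
  refine IntegrableOn.mono_set ?_ hR
  rw [integrableOn_fun_norm_addHaar volume (f := Real.log), Complex.finrank_real_complex]
  have : Continuous (fun y : ℝ => y ^ (2 - 1) • Real.log y) := by
    simpa using Real.continuous_mul_log
  exact (this.continuousOn.integrableOn_compact isCompact_Icc).mono_set Set.Ioo_subset_Icc_self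

lemma integrable_log_norm_mul {g : ℂ → ℝ} (hg : Continuous g) (hc : HasCompactSupport g) :
    Integrable (fun z => Real.log ‖z‖ * g z) := by
  simpa [mul_comm] using locallyIntegrable_log_norm.integrable_smul_left_of_hasCompactSupport hg hc

lemma abs_smoothLog_le {ε : ℝ} (hε : 0 < ε) (hε1 : ε ≤ 1) {z : ℂ} (hz : z ≠ 0) :
    |smoothLog ε z| ≤ |Real.log ‖z‖| + ‖z‖ ^ 2 := by
  have hn : ‖z‖ ^ 2 = z.re ^ 2 + z.im ^ 2 := by
    rw [Complex.sq_norm, Complex.normSq_apply]; ring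
  have hz' : 0 < ‖z‖ := norm_pos_iff.2 hz
  rw [smoothLog, ← hn]
  have h1 : Real.log (‖z‖ ^ 2) ≤ Real.log (‖z‖ ^ 2 + ε ^ 2) :=
    Real.log_le_log (by positivity) (by nlinarith)
  have h2 : Real.log (‖z‖ ^ 2 + ε ^ 2) ≤ ‖z‖ ^ 2 + ε ^ 2 - 1 :=
    Real.log_le_sub_one_of_pos (by positivity)
  rw [Real.log_pow] at h1
  push_cast at h1
  have h3 := neg_abs_le (Real.log ‖z‖)
  have h4 := abs_nonneg (Real.log ‖z‖)
  rw [abs_le]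
  constructor <;> nlinarith

lemma tendsto_smoothLog {z : ℂ} (hz : z ≠ 0) :
    Tendsto (fun ε => smoothLog ε z) (𝓝[>] 0) (𝓝 (Real.log ‖z‖)) := by
  have hn : ‖z‖ ^ 2 = z.re ^ 2 + z.im ^ 2 := by
    rw [Complex.sq_norm, Complex.normSq_apply]; ring
  have hz' : 0 < ‖z‖ := norm_pos_iff.2 hz
  have h : ContinuousAt (fun ε : ℝ => 2⁻¹ * Real.log (‖z‖ ^ 2 + ε ^ 2)) 0 := by
    refine continuousAt_const.mul (ContinuousAt.log (by fun_prop) (by positivity))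
  have h2 := h.tendsto
  simp only [smoothLog, ← hn]
  convert h2.mono_left nhdsWithin_le_nhds using 2
  rw [zero_pow two_ne_zero, add_zero, Real.log_pow]; push_cast; ring

lemma tendsto_integral_smoothLog_mul {g : ℂ → ℝ} (hg : Continuous g) (hc : HasCompactSupport g) :
    Tendsto (fun ε => ∫ z, smoothLog ε z * g z) (𝓝[>] 0) (𝓝 (∫ z, Real.log ‖z‖ * g z)) := by
  have hne : ∀ᵐ z : ℂ, z ≠ 0 := by simp [ae_iff]
  have hmem : Set.Ioc (0 : ℝ) 1 ∈ 𝓝[>] (0 : ℝ) := Ioc_mem_nhdsGT one_pos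
  refine tendsto_integral_filter_of_dominated_convergence
    (fun z => |Real.log ‖z‖ * g z| + ‖z‖ ^ 2 * |g z|) ?_ ?_ ?_ ?_
  · filter_upwards [hmem] with ε hε
    exact ((contDiff_smoothLog hε.1).continuous.mul hg).aestronglyMeasurable
  · filter_upwards [hmem] with ε hε
    filter_upwards [hne] with z hz
    rw [Real.norm_eq_abs, abs_mul, abs_mul, ← add_mul]
    exact mul_le_mul_of_nonneg_right (abs_smoothLog_le hε.1 hε.2 hz) (abs_nonneg _)
  · refine (integrable_log_norm_mul hg hc).abs.add ?_
    exact ((continuous_norm.pow 2).mul hg.abs).integrable_of_hasCompactSupport hc.norm.mul_left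
  · filter_upwards [hne] with z hz
    exact (tendsto_smoothLog hz).mul_const _

lemma integrable_and_integral_radial :
    Integrable (fun z : ℂ => 2 / (‖z‖ ^ 2 + 1) ^ 2) ∧
      ∫ z : ℂ, 2 / (‖z‖ ^ 2 + 1) ^ 2 = 2 * Real.pi := by
  have hd : ∀ x ∈ Set.Ici (0 : ℝ), HasDerivAt (fun x : ℝ => -(x ^ 2 + 1)⁻¹)
      (x ^ (2 - 1) • (2 / (x ^ 2 + 1) ^ 2)) x := by
    intro x _
    have h := (((hasDerivAt_id x).pow 2).add_const 1).inv (by simp; positivity)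
    refine h.neg.congr_deriv ?_
    simp
    ring
  have hpos : ∀ x ∈ Set.Ioi (0 : ℝ), 0 ≤ x ^ (2 - 1) • (2 / (x ^ 2 + 1) ^ 2) := by
    intro x hx
    have : 0 < x := hx
    simp only [smul_eq_mul]; positivity
  have hlim : Tendsto (fun x : ℝ => -(x ^ 2 + 1)⁻¹) atTop (𝓝 0) := by
    have : Tendsto (fun x : ℝ => (x ^ 2 + 1)) atTop atTop :=
      tendsto_atTop_add_const_right _ _ (tendsto_pow_atTop two_ne_zero)
    simpa using this.inv_tendsto_atTop.neg
  constructor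
  · rw [integrable_fun_norm_addHaar volume (f := fun x => 2 / (x ^ 2 + 1) ^ 2),
      Complex.finrank_real_complex]
    exact integrableOn_Ioi_deriv_of_nonneg' hd hpos hlim
  · rw [integral_fun_norm_addHaar volume (fun x => 2 / (x ^ 2 + 1) ^ 2),
      Complex.finrank_real_complex, integral_Ioi_of_hasDerivAt_of_nonneg' hd hpos hlim]
    simp [Measure.real, Complex.volume_ball]

lemma tendsto_integral_lapl_smoothLog_mul {φ : ℂ → ℝ} (hφ : Continuous φ)
    (hc : HasCompactSupport φ) :
    Tendsto (fun ε => ∫ z, lapl (smoothLog ε) z * φ z) (𝓝[>] 0) (𝓝 (2 * Real.pi * φ 0)) := by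
  obtain ⟨hint, hval⟩ := integrable_and_integral_radial
  obtain ⟨C, hC⟩ := hc.exists_bound_of_continuous hφ
  have key : ∀ ε : ℝ, 0 < ε → ∫ z, lapl (smoothLog ε) z * φ z
      = ∫ z : ℂ, 2 / (‖z‖ ^ 2 + 1) ^ 2 * φ (ε • z) := by
    intro ε hε
    have h := Measure.integral_comp_smul volume (fun z => lapl (smoothLog ε) z * φ z) ε
    have h2 : ∀ z : ℂ, lapl (smoothLog ε) (ε • z) * φ (ε • z)
        = (ε ^ 2)⁻¹ * (2 / (‖z‖ ^ 2 + 1) ^ 2 * φ (ε • z)) := by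
      intro z
      rw [lapl_smoothLog hε, norm_smul, Real.norm_of_nonneg hε.le]
      have : ‖z‖ ^ 2 + 1 ≠ 0 := by positivity
      field_simp
    simp_rw [h2] at h
    rw [integral_const_mul, Complex.finrank_real_complex, abs_of_pos (by positivity),
      smul_eq_mul] at h
    exact (mul_left_cancel₀ (by positivity) h).symm
  rw [← hval, ← integral_mul_const]
  refine Tendsto.congr' (f₁ := fun ε : ℝ => ∫ z : ℂ, 2 / (‖z‖ ^ 2 + 1) ^ 2 * φ (ε • z))
    (by filter_upwards [self_mem_nhdsWithin] with ε hε using (key ε hε).symm) ?_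
  refine tendsto_integral_filter_of_dominated_convergence
    (fun z => 2 / (‖z‖ ^ 2 + 1) ^ 2 * C) ?_ ?_ (hint.mul_const C) ?_
  · exact .of_forall fun ε => hint.aestronglyMeasurable.mul
      (hφ.comp (continuous_const_smul ε)).aestronglyMeasurable
  · refine .of_forall fun ε => .of_forall fun z => ?_
    rw [norm_mul, Real.norm_of_nonneg (by positivity)]
    exact mul_le_mul_of_nonneg_left (hC _) (by positivity)
  · refine .of_forall fun z => Tendsto.const_mul _ ?_
    have : Continuous (fun ε : ℝ => φ (ε • z)) := by fun_prop
    simpa using (this.tendsto 0).mono_left nhdsWithin_le_nhds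

lemma integral_log_norm_mul_lapl {φ : ℂ → ℝ} (hφ : ContDiff ℝ 2 φ) (hc : HasCompactSupport φ) :
    ∫ z, Real.log ‖z‖ * lapl φ z = 2 * Real.pi * φ 0 := by
  refine tendsto_nhds_unique
    (tendsto_integral_smoothLog_mul (continuous_lapl hφ) (hasCompactSupport_lapl hc))
    ((tendsto_integral_lapl_smoothLog_mul hφ.continuous hc).congr' ?_)
  filter_upwards [self_mem_nhdsWithin] with ε hε
  exact (integral_mul_lapl (contDiff_smoothLog hε) hφ hc).symm

lemma lapl_comp_add_right (φ : ℂ → ℝ) (a z : ℂ) : lapl (fun w => φ (w + a)) z = lapl φ (z + a) := by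
  simp only [lapl, fderiv_comp_add_right]
  rw [fderiv_comp_add_right (f := fun w => fderiv ℝ φ w 1) a,
    fderiv_comp_add_right (f := fun w => fderiv ℝ φ w Complex.I) a]

lemma integral_log_norm_sub_mul_lapl {φ : ℂ → ℝ} (hφ : ContDiff ℝ 2 φ)
    (hc : HasCompactSupport φ) (z : ℂ) :
    ∫ ζ, Real.log ‖z - ζ‖ * lapl φ ζ = 2 * Real.pi * φ z := by
  have h := integral_log_norm_mul_lapl (φ := fun w => φ (w + z))
    (hφ.comp (contDiff_id.add contDiff_const)) (hc.comp_homeomorph (Homeomorph.addRight z))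
  simp only [lapl_comp_add_right, zero_add] at h
  rw [← h, ← integral_add_right_eq_self (fun ζ => Real.log ‖z - ζ‖ * lapl φ ζ) z]
  simp

lemma integrable_log_norm_sub_mul {g : ℂ → ℝ} (hg : Continuous g) (hc : HasCompactSupport g)
    (z : ℂ) : Integrable (fun ζ => Real.log ‖z - ζ‖ * g ζ) := by
  have h := integrable_log_norm_mul (g := fun w => g (w + z)) (by fun_prop)
    (hc.comp_homeomorph (Homeomorph.addRight z))
  have h2 := h.comp_sub_right z
  simpa [norm_sub_rev] using h2

open InnerProductSpace Laplacian

lemma Filter.EventuallyEq.lapl_eq {u v : ℂ → ℝ} {z : ℂ} (h : u =ᶠ[𝓝 z] v) :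
    lapl u z = lapl v z := by
  have h1 : ∀ e : ℂ, (fun w => fderiv ℝ u w e) =ᶠ[𝓝 z] fun w => fderiv ℝ v w e := fun e => by
    filter_upwards [h.fderiv (𝕜 := ℝ)] with w hw
    rw [hw]
  rw [lapl, lapl, (h1 1).fderiv_eq, (h1 Complex.I).fderiv_eq]

lemma ContDiffAt.lapl_eq_laplacian {u : ℂ → ℝ} {z : ℂ} (hu : ContDiffAt ℝ 2 u z) :
    lapl u z = Δ u z := by
  have hd : DifferentiableAt ℝ (fderiv ℝ u) z :=
    (hu.fderiv_right (m := 1) (by norm_num)).differentiableAt (by norm_num)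
  have h : ∀ e : ℂ, fderiv ℝ (fun w => fderiv ℝ u w e) z e = fderiv ℝ (fderiv ℝ u) z e e := by
    intro e
    rw [fderiv_clm_apply hd (differentiableAt_const e)]
    simp
  rw [laplacian_eq_iteratedFDeriv_complexPlane]
  simp [lapl, h, iteratedFDeriv_two_apply]

lemma InnerProductSpace.HarmonicOnNhd.isHarmonicOn {h : ℂ → ℝ} {s : Set ℂ}
    (hh : HarmonicOnNhd h s) : IsHarmonicOn h s :=
  ⟨hh.contDiffOn, fun z hz => by
    rw [(hh z hz).1.lapl_eq_laplacian]; exact (hh z hz).2.self_of_nhds⟩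

lemma integrableOn_log_norm_sub_mul {g : ℂ → ℝ} (hg : IntegrableOn g (ball 0 1)) {c : ℂ} {r : ℝ}
    (hc : c ∈ ball (0 : ℂ) 1) (hr : 0 < r) (h0 : ∀ ζ ∈ ball c r, g ζ = 0) :
    IntegrableOn (fun ζ => Real.log ‖c - ζ‖ * g ζ) (ball 0 1) := by
  refine Integrable.mono' (hg.norm.const_mul (|Real.log r| + Real.log 2)) ?_ ?_
  · exact (by fun_prop : Measurable fun ζ : ℂ => Real.log ‖c - ζ‖).aestronglyMeasurable.mul
      hg.aestronglyMeasurable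
  · filter_upwards [ae_restrict_mem measurableSet_ball] with ζ hζ
    by_cases hζc : ζ ∈ ball c r
    · simp [h0 ζ hζc]
    · rw [norm_mul, Real.norm_eq_abs]
      refine mul_le_mul_of_nonneg_right ?_ (norm_nonneg _)
      have h1 : r ≤ ‖c - ζ‖ := by
        rw [norm_sub_rev, ← dist_eq_norm]; simpa using hζc
      have h2 : ‖c - ζ‖ ≤ 2 := by
        rw [mem_ball_zero_iff] at hc hζ
        linarith [norm_sub_le c ζ]
      have h3 := Real.log_le_log hr h1
      have h4 := Real.log_le_log (hr.trans_le h1) h2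
      have h5 := neg_abs_le (Real.log r)
      have h6 := abs_nonneg (Real.log r)
      have h7 := Real.log_nonneg (one_le_two (α := ℝ))
      rw [abs_le]
      constructor <;> linarith

lemma harmonicAt_newtonPotential {g : ℂ → ℝ} (hg : IntegrableOn g (ball 0 1)) {c : ℂ} {r : ℝ}
    (hc : c ∈ ball (0 : ℂ) 1) (hr : 0 < r) (h0 : ∀ ζ ∈ ball c r, g ζ = 0) :
    HarmonicAt (newtonPotential g) c := by
  let F : ℂ → ℂ → ℂ := fun z ζ => Complex.log (1 + (z - c) / (c - ζ)) * g ζ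
  let F' : ℂ → ℂ → ℂ := fun z ζ => 1 / (c - ζ) / (1 + (z - c) / (c - ζ)) * g ζ
  have hsmall : ∀ z ∈ ball c (r / 2), ∀ ζ ∉ ball c r, ‖(z - c) / (c - ζ)‖ ≤ 1 / 2 := by
    intro z hz ζ hζ
    have h1 : r ≤ ‖c - ζ‖ := by
      rw [norm_sub_rev, ← dist_eq_norm]; simpa using hζ
    rw [mem_ball, dist_eq_norm] at hz
    rw [norm_div, div_le_iff₀ (by linarith)]
    linarith
  have hre : ∀ z ∈ ball c (r / 2), ∀ ζ ∉ ball c r, 1 / 2 ≤ (1 + (z - c) / (c - ζ)).re := by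
    intro z hz ζ hζ
    have := (abs_le.1 ((Complex.abs_re_le_norm _).trans (hsmall z hz ζ hζ))).1
    simp only [Complex.add_re, Complex.one_re]
    linarith
  have hgm : AEStronglyMeasurable (fun ζ => (g ζ : ℂ)) (volume.restrict (ball 0 1)) :=
    Complex.continuous_ofReal.comp_aestronglyMeasurable hg.aestronglyMeasurable
  have hmeas : ∀ z, AEStronglyMeasurable (F z) (volume.restrict (ball 0 1)) := fun z =>
    (by fun_prop : Measurable fun ζ : ℂ =>
      Complex.log (1 + (z - c) / (c - ζ))).aestronglyMeasurable.mul hgm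
  have hmeas' : ∀ z, AEStronglyMeasurable (F' z) (volume.restrict (ball 0 1)) := fun z =>
    (by fun_prop : Measurable fun ζ : ℂ =>
      1 / (c - ζ) / (1 + (z - c) / (c - ζ))).aestronglyMeasurable.mul hgm
  have hFint : ∀ z ∈ ball c (r / 2), IntegrableOn (F z) (ball 0 1) := by
    intro z hz
    refine Integrable.mono' hg.norm (hmeas z) (.of_forall fun ζ => ?_)
    by_cases hζ : ζ ∈ ball c r
    · simp [F, h0 ζ hζ]
    · have h1 := hsmall z hz ζ hζ
      have h2 := Complex.norm_log_one_add_half_le_self h1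
      simp only [F, norm_mul, Complex.norm_real]
      exact mul_le_of_le_one_left (norm_nonneg _) (by linarith)
  have hderiv : ∀ z ∈ ball c (r / 2),
      HasDerivAt (fun z => ∫ ζ in ball 0 1, F z ζ) (∫ ζ in ball 0 1, F' z ζ) z := by
    intro z hz
    refine (hasDerivAt_integral_of_dominated_loc_of_deriv_le (isOpen_ball.mem_nhds hz)
      (.of_forall hmeas) (hFint z hz) (hmeas' z) (bound := fun ζ => 2 / r * ‖g ζ‖) ?_
      (hg.norm.const_mul _) ?_).2
    · refine .of_forall fun ζ x hx => ?_
      by_cases hζ : ζ ∈ ball c r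
      · simp [F', h0 ζ hζ]
      · have h1 : r ≤ ‖c - ζ‖ := by
          rw [norm_sub_rev, ← dist_eq_norm]; simpa using hζ
        have h2 := (hre x hx ζ hζ).trans (Complex.re_le_norm _)
        simp only [F', norm_mul, Complex.norm_real, norm_div, norm_one]
        refine mul_le_mul_of_nonneg_right ?_ (norm_nonneg _)
        calc 1 / ‖c - ζ‖ / ‖1 + (x - c) / (c - ζ)‖ ≤ 1 / r / (1 / 2) := by gcongr
          _ = 2 / r := by field_simp
    · refine .of_forall fun ζ x hx => ?_
      by_cases hζ : ζ ∈ ball c r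
      · simpa [F, F', h0 ζ hζ] using hasDerivAt_const x (0 : ℂ)
      · have h2 : 0 < (1 + (x - c) / (c - ζ)).re := by linarith [hre x hx ζ hζ]
        exact (((((hasDerivAt_id x).sub_const c).div_const (c - ζ)).const_add 1).clog
          (Or.inl h2)).mul_const _
  have hana : AnalyticAt ℂ (fun z => ∫ ζ in ball 0 1, F z ζ) c :=
    DifferentiableOn.analyticAt (s := ball c (r / 2))
      (fun z hz => (hderiv z hz).differentiableAt.differentiableWithinAt)
      (ball_mem_nhds c (by positivity))
  have hharm := ((harmonicAt_const (x := c) (∫ ζ in ball 0 1, Real.log ‖c - ζ‖ * g ζ)).add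
    hana.harmonicAt_re).const_smul (c := (2 * Real.pi)⁻¹)
  refine (harmonicAt_congr_nhds ?_).1 hharm
  filter_upwards [ball_mem_nhds c (half_pos hr)] with z hz
  simp only [Pi.smul_apply, Pi.add_apply, smul_eq_mul, newtonPotential]
  congr 1
  rw [← Complex.reCLM_apply, ← Complex.reCLM.integral_comp_comm (hFint z hz),
    ← integral_add (integrableOn_log_norm_sub_mul hg hc hr h0)
      (Complex.reCLM.integrable_comp (hFint z hz))]
  refine integral_congr_ae (.of_forall fun ζ => ?_)
  by_cases hζ : ζ ∈ ball c r
  · simp [F, h0 ζ hζ]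
  · have h1 : r ≤ ‖c - ζ‖ := by
      rw [norm_sub_rev, ← dist_eq_norm]; simpa using hζ
    have hne : c - ζ ≠ 0 := norm_pos_iff.1 (hr.trans_le h1)
    have h2 : 1 + (z - c) / (c - ζ) ≠ 0 := fun h => by
      have := hre z hz ζ hζ
      rw [h] at this
      norm_num at this
    have h3 : z - ζ = (c - ζ) * (1 + (z - c) / (c - ζ)) := by field_simp; ring
    simp only [F, Complex.reCLM_apply, Complex.re_mul_ofReal, Complex.log_re]
    rw [h3, norm_mul, Real.log_mul (norm_ne_zero_iff.2 hne) (norm_ne_zero_iff.2 h2), add_mul]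

lemma newtonPotential_lapl {φ : ℂ → ℝ} (hφ : ContDiff ℝ 2 φ) (hc : HasCompactSupport φ)
    (hs : Function.support (lapl φ) ⊆ ball 0 1) (z : ℂ) : newtonPotential (lapl φ) z = φ z := by
  rw [newtonPotential, setIntegral_eq_integral_of_forall_compl_eq_zero,
    integral_log_norm_sub_mul_lapl hφ hc]
  · field_simp
  · intro x hx
    rw [Function.notMem_support.1 fun h => hx (hs h), mul_zero]

lemma harmonicAt_sub_newtonPotential {u f : ℂ → ℝ} {U : Set ℂ} (hU : IsOpen U)
    (hU1 : U ⊆ ball 0 1) (hu : ContDiffOn ℝ 2 u U) (hf : IntegrableOn f (ball 0 1))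
    (hlap : ∀ z ∈ U, lapl u z = f z) {c : ℂ} (hc : c ∈ U) :
    HarmonicAt (fun z => u z - newtonPotential f z) c := by
  obtain ⟨R, hR, hRU⟩ := nhds_basis_closedBall.mem_iff.1 (hU.mem_nhds hc)
  let χ : ContDiffBump c := ⟨R / 2, R, by positivity, by linarith⟩
  let φ : ℂ → ℝ := fun z => χ z * u z
  have hsupp : ∀ z ∉ closedBall c R, φ z = 0 := by
    intro z hz
    have : χ z = 0 := χ.zero_of_le_dist (by simpa using (not_le.1 hz).le)
    simp [φ, this]
  have hφ : ContDiff ℝ 2 φ := by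
    rw [contDiff_iff_contDiffAt]
    intro z
    by_cases hz : z ∈ closedBall c R
    · exact χ.contDiff.contDiffAt.mul (hu.contDiffAt (hU.mem_nhds (hRU hz)))
    · refine (contDiffAt_const (c := (0 : ℝ))).congr_of_eventuallyEq ?_
      filter_upwards [isClosed_closedBall.isOpen_compl.mem_nhds hz] with w hw using hsupp w hw
  have hcs : HasCompactSupport φ := HasCompactSupport.intro (isCompact_closedBall c R) hsupp
  have hlapφ0 : ∀ z ∉ closedBall c R, lapl φ z = 0 := by
    intro z hz
    have : φ =ᶠ[𝓝 z] fun _ => 0 := by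
      filter_upwards [isClosed_closedBall.isOpen_compl.mem_nhds hz] with w hw using hsupp w hw
    rw [this.lapl_eq]
    simp [lapl]
  have hφu : ∀ z ∈ ball c (R / 2), φ z = u z := fun z hz => by
    have : χ z = 1 := χ.one_of_mem_closedBall (ball_subset_closedBall hz)
    simp [φ, this]
  have hsub : ball c (R / 2) ⊆ U :=
    ((ball_subset_ball (by linarith)).trans ball_subset_closedBall).trans hRU
  have hlapφ : ∀ z ∈ ball c (R / 2), lapl φ z = f z := by
    intro z hz
    rw [← hlap z (hsub hz)]
    apply Filter.EventuallyEq.lapl_eq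
    filter_upwards [isOpen_ball.mem_nhds hz] with w hw using hφu w hw
  have hLint : IntegrableOn (lapl φ) (ball 0 1) :=
    ((continuous_lapl hφ).integrable_of_hasCompactSupport (hasCompactSupport_lapl hcs)).integrableOn
  have hg : IntegrableOn (fun z => lapl φ z - f z) (ball 0 1) := hLint.sub hf
  have hg0 : ∀ ζ ∈ ball c (R / 2), lapl φ ζ - f ζ = 0 := fun ζ hζ => by rw [hlapφ ζ hζ, sub_self]
  refine (harmonicAt_congr_nhds ?_).1
    (harmonicAt_newtonPotential hg (hU1 hc) (half_pos hR) hg0)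
  filter_upwards [isOpen_ball.mem_nhds (mem_ball_self (half_pos hR))] with z hz
  obtain ⟨ρ, hρ, hρs⟩ := Metric.isOpen_iff.1 isOpen_ball z hz
  have hi1 := (integrable_log_norm_sub_mul (continuous_lapl hφ) (hasCompactSupport_lapl hcs)
    z).integrableOn (s := ball 0 1)
  have hi2 := integrableOn_log_norm_sub_mul hg (hU1 (hsub hz)) hρ fun ζ hζ => hg0 ζ (hρs hζ)
  have hi3 : IntegrableOn (fun ζ => Real.log ‖z - ζ‖ * f ζ) (ball 0 1) := by
    refine (hi1.sub hi2).congr (.of_forall fun ζ => ?_)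
    simp only [Pi.sub_apply]; ring
  have hs : Function.support (lapl φ) ⊆ ball 0 1 := fun ζ hζ =>
    hU1 (hRU (not_not.1 fun h => hζ (hlapφ0 ζ h)))
  rw [← hφu z hz, ← newtonPotential_lapl hφ hcs hs z]
  simp only [newtonPotential, mul_sub]
  rw [integral_sub hi1 hi3, mul_sub]

lemma enorm_mul_le_lintegral_ball {Φ : ℂ → ℂ} {c : ℂ} {R : ℝ} (hR : 0 < R)
    (hΦ : DifferentiableOn ℂ Φ (ball c R)) :
    ENNReal.ofReal (Real.pi * R ^ 2) * ‖Φ c‖ₑ ≤ ∫⁻ z in ball c R, ‖Φ z‖ₑ := by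
  classical
  let Ψ : ℂ → ℝ≥0∞ := (ball c R).piecewise (fun z => ‖Φ z‖ₑ) 0
  have hΨ : Measurable Ψ :=
    (hΦ.continuousOn.enorm).measurable_piecewise continuousOn_const measurableSet_ball
  have hmean : ∀ r ∈ Set.Ioo 0 R, ENNReal.ofReal (2 * Real.pi) * ‖Φ c‖ₑ ≤
      ∫⁻ θ in Set.Ioo (-Real.pi) Real.pi, Ψ (circleMap c r θ) := by
    intro r hr
    have hmem : ∀ θ, circleMap c r θ ∈ ball c R := fun θ => by
      simp [circleMap, abs_of_pos hr.1, hr.2]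
    have h1 : Real.circleAverage Φ c r = Φ c := by
      apply DiffContOnCl.circleAverage
      rw [abs_of_pos hr.1]
      exact (hΦ.mono (closedBall_subset_ball hr.2)).diffContOnCl_ball subset_rfl
    have h2 : ∫ θ in Set.Ioo (-Real.pi) Real.pi, Φ (circleMap c r θ) = (2 * Real.pi : ℝ) • Φ c := by
      rw [← h1, Real.circleAverage, smul_smul, mul_inv_cancel₀ (by positivity), one_smul]
      have h3 := ((periodic_circleMap c r).comp Φ).intervalIntegral_add_eq 0 (-Real.pi)
      simp only [zero_add, Function.comp_def] at h3
      rw [h3, show -Real.pi + 2 * Real.pi = Real.pi by ring,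
        intervalIntegral.integral_of_le (by linarith [Real.pi_pos]), integral_Ioc_eq_integral_Ioo]
    calc ENNReal.ofReal (2 * Real.pi) * ‖Φ c‖ₑ = ‖(2 * Real.pi : ℝ) • Φ c‖ₑ := by
          rw [enorm_smul, Real.enorm_of_nonneg (by positivity)]
      _ ≤ ∫⁻ θ in Set.Ioo (-Real.pi) Real.pi, ‖Φ (circleMap c r θ)‖ₑ := by
          rw [← h2]; exact enorm_integral_le_lintegral_enorm _
      _ = _ := lintegral_congr fun θ => by
          simp only [Ψ, Set.piecewise_eq_of_mem _ _ _ (hmem θ)]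
  have hrad : ∫⁻ r in Set.Ioo 0 R, ENNReal.ofReal r = ENNReal.ofReal (R ^ 2 / 2) := by
    rw [← ofReal_integral_eq_lintegral_ofReal, ← integral_Ioc_eq_integral_Ioo,
      ← intervalIntegral.integral_of_le hR.le, integral_id]
    · simp
    · exact (continuous_id.integrableOn_Icc (a := 0) (b := R)).mono_set Set.Ioo_subset_Icc_self
    · filter_upwards [ae_restrict_mem measurableSet_Ioo] with r hr using hr.1.le
  have hpolar : Measurable fun p : ℝ × ℝ =>
      ENNReal.ofReal p.1 * Ψ (circleMap c p.1 p.2) := by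
    have : Continuous fun p : ℝ × ℝ => circleMap c p.1 p.2 := by unfold circleMap; fun_prop
    exact (by fun_prop : Measurable fun p : ℝ × ℝ => ENNReal.ofReal p.1).mul
      (hΨ.comp this.measurable)
  calc ENNReal.ofReal (Real.pi * R ^ 2) * ‖Φ c‖ₑ
      = ∫⁻ r in Set.Ioo 0 R, ENNReal.ofReal r * (ENNReal.ofReal (2 * Real.pi) * ‖Φ c‖ₑ) := by
        rw [lintegral_mul_const _ (by fun_prop), hrad, ← mul_assoc,
          ← ENNReal.ofReal_mul (by positivity)]
        congr 2; ring
    _ ≤ ∫⁻ r in Set.Ioo 0 R, ENNReal.ofReal r *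
          ∫⁻ θ in Set.Ioo (-Real.pi) Real.pi, Ψ (circleMap c r θ) :=
        setLIntegral_mono' measurableSet_Ioo fun r hr => by gcongr; exact hmean r hr
    _ ≤ ∫⁻ r in Set.Ioi 0, ENNReal.ofReal r *
          ∫⁻ θ in Set.Ioo (-Real.pi) Real.pi, Ψ (circleMap c r θ) :=
        lintegral_mono_set fun r hr => hr.1
    _ = ∫⁻ p in polarCoord.target, ENNReal.ofReal p.1 * Ψ (circleMap c p.1 p.2) := by
        rw [polarCoord_target, Measure.volume_eq_prod, ← Measure.prod_restrict,
          lintegral_prod _ hpolar.aemeasurable]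
        refine lintegral_congr fun r => ?_
        dsimp only
        rw [lintegral_const_mul' _ _ ENNReal.ofReal_ne_top]
    _ = ∫⁻ z, Ψ (z + c) := by
        rw [← Complex.lintegral_comp_polarCoord_symm]
        refine lintegral_congr fun p => ?_
        simp only [circleMap, Complex.polarCoord_symm_apply, smul_eq_mul, Complex.exp_mul_I]
        rw [add_comm c]
        push_cast
        rfl
    _ = ∫⁻ z, Ψ z := lintegral_add_right_eq_self Ψ c
    _ = ∫⁻ z in ball c R, ‖Φ z‖ₑ := by
        rw [← lintegral_indicator measurableSet_ball]
        rfl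

lemma HarmonicAt.comp_analyticAt {w : ℂ → ℝ} {p : ℂ → ℂ} {ξ : ℂ} (hw : HarmonicAt w (p ξ))
    (hp : AnalyticAt ℂ p ξ) : HarmonicAt (fun z => w (p z)) ξ := by
  obtain ⟨R, hR, hRs⟩ := Metric.eventually_nhds_iff_ball.1 hw.eventually
  obtain ⟨F, hF, hFw⟩ := HarmonicOnNhd.exists_analyticOnNhd_ball_re_eq hRs
  have h := ((hF (p ξ) (mem_ball_self hR)).comp hp).harmonicAt_re
  refine (harmonicAt_congr_nhds ?_).1 h
  filter_upwards [hp.continuousAt.preimage_mem_nhds (ball_mem_nhds _ hR)] with z hz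
  exact hFw hz

lemma le_const_sub_log_of_lintegral_lt_top {w : ℂ → ℝ}
    (hw : HarmonicOnNhd w (ball 0 1 \ {0}))
    (hint : ∫⁻ z in ball (0 : ℂ) 1, ENNReal.ofReal (Real.exp (2 * w z)) < ⊤) :
    ∃ C : ℝ, ∀ z ∈ ball (0 : ℂ) (1 / 2) \ {0}, w z ≤ C - Real.log ‖z‖ := by
  set J := ∫⁻ z in ball (0 : ℂ) 1, ENNReal.ofReal (Real.exp (2 * w z)) with hJ
  refine ⟨Real.log (J.toReal / Real.pi) / 2, fun z hz => ?_⟩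
  have hz0 : 0 < ‖z‖ := norm_pos_iff.2 hz.2
  have hz1 : ‖z‖ < 1 / 2 := mem_ball_zero_iff.1 hz.1
  have hsub : ball z ‖z‖ ⊆ ball 0 1 \ {0} := by
    intro x hx
    refine ⟨?_, ?_⟩
    · rw [mem_ball, dist_eq_norm] at hx
      rw [mem_ball_zero_iff]
      calc ‖x‖ = ‖(x - z) + z‖ := by simp
        _ ≤ ‖x - z‖ + ‖z‖ := norm_add_le _ _
        _ < 1 := by linarith
    · rintro rfl
      simp at hx
  obtain ⟨F, hF, hFw⟩ := HarmonicOnNhd.exists_analyticOnNhd_ball_re_eq (hw.mono hsub)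
  have hΦ : ∀ x ∈ ball z ‖z‖, ‖Complex.exp (2 * F x)‖ₑ = ENNReal.ofReal (Real.exp (2 * w x)) := by
    intro x hx
    rw [← hFw hx, ← ofReal_norm, Complex.norm_exp]
    simp
  have h1 := enorm_mul_le_lintegral_ball (Φ := fun x => Complex.exp (2 * F x)) hz0
    ((hF.differentiableOn.const_mul 2).cexp)
  rw [setLIntegral_congr_fun measurableSet_ball hΦ, hΦ z (mem_ball_self hz0),
    ← ENNReal.ofReal_mul (by positivity)] at h1
  have h2 := h1.trans (lintegral_mono_set (hsub.trans Set.sdiff_subset))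
  rw [← hJ, ENNReal.ofReal_le_iff_le_toReal hint.ne] at h2
  have h3 : Real.exp (2 * w z) * ‖z‖ ^ 2 ≤ J.toReal / Real.pi := by
    rw [le_div_iff₀ Real.pi_pos]; linarith
  have h4 := Real.log_le_log (by positivity) h3
  rw [Real.log_mul (by positivity) (by positivity), Real.log_exp, Real.log_pow] at h4
  push_cast at h4
  linarith

lemma exists_re_eq_comp_qParam {w : ℂ → ℝ} (hw : HarmonicOnNhd w (ball 0 1 \ {0})) :
    ∃ G : ℂ → ℂ, AnalyticOnNhd ℂ G {τ | 0 < τ.im} ∧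
      ∀ τ : ℂ, 0 < τ.im → (G τ).re = w (Function.Periodic.qParam 1 τ) := by
  let p : ℂ → ℂ := fun ξ => Complex.I * (1 + ξ) / (1 - ξ)
  let κ : ℂ → ℂ := fun τ => (τ - Complex.I) / (τ + Complex.I)
  have hne : ∀ ξ ∈ ball (0 : ℂ) 1, 1 - ξ ≠ 0 := by
    intro ξ hξ h
    rw [← sub_eq_zero.1 h] at hξ
    simp at hξ
  have hp : ∀ ξ ∈ ball (0 : ℂ) 1, 0 < (p ξ).im := by
    intro ξ hξ
    have h1 : p ξ = (Complex.I * (1 + ξ) * (starRingEnd ℂ) (1 - ξ)) / Complex.normSq (1 - ξ) := by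
      rw [Complex.normSq_eq_conj_mul_self]
      have := hne ξ hξ
      have h2 : (starRingEnd ℂ) (1 - ξ) ≠ 0 := (map_ne_zero _).2 this
      simp only [p]
      field_simp
    have h3 : 0 < Complex.normSq (1 - ξ) := Complex.normSq_pos.2 (hne ξ hξ)
    rw [h1, Complex.div_ofReal_im]
    refine div_pos ?_ h3
    rw [mem_ball_zero_iff, ← sq_lt_one_iff₀ (norm_nonneg _), Complex.sq_norm,
      Complex.normSq_apply] at hξ
    simp
    nlinarith
  have hτne : ∀ τ : ℂ, 0 < τ.im → τ + Complex.I ≠ 0 := by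
    intro τ hτ h
    have := congrArg Complex.im h
    simp at this
    linarith
  have hκ : ∀ τ : ℂ, 0 < τ.im → κ τ ∈ ball (0 : ℂ) 1 := by
    intro τ hτ
    rw [mem_ball_zero_iff, norm_div, div_lt_one (norm_pos_iff.2 (hτne τ hτ)),
      ← sq_lt_sq₀ (norm_nonneg _) (norm_nonneg _), Complex.sq_norm, Complex.sq_norm,
      Complex.normSq_apply, Complex.normSq_apply]
    simp
    nlinarith
  have hpκ : ∀ τ : ℂ, 0 < τ.im → p (κ τ) = τ := by
    intro τ hτ
    have h := hτne τ hτ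
    have h1 : 1 - κ τ = 2 * Complex.I / (τ + Complex.I) := by
      simp only [κ]; field_simp; ring
    have h2 : 1 + κ τ = 2 * τ / (τ + Complex.I) := by
      simp only [κ]; field_simp; ring
    have := Complex.I_ne_zero
    simp only [p, h1, h2]
    field_simp
  have hq : ∀ τ : ℂ, 0 < τ.im → Function.Periodic.qParam 1 τ ∈ ball (0 : ℂ) 1 \ {0} :=
    fun τ hτ => ⟨mem_ball_zero_iff.2 (Function.Periodic.norm_qParam_lt_one one_pos hτ),
      Function.Periodic.qParam_ne_zero τ⟩
  have hharm : HarmonicOnNhd (fun ξ => w (Function.Periodic.qParam 1 (p ξ))) (ball 0 1) := by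
    intro ξ hξ
    refine HarmonicAt.comp_analyticAt (p := fun ξ => Function.Periodic.qParam 1 (p ξ))
      (hw _ (hq _ (hp ξ hξ))) ?_
    have hpa : AnalyticAt ℂ p ξ := by
      have h1 := hne ξ hξ
      simp only [p]
      fun_prop (disch := exact h1)
    exact (Function.Periodic.differentiable_qParam.analyticAt _).comp hpa
  obtain ⟨F, hF, hFw⟩ := HarmonicOnNhd.exists_analyticOnNhd_ball_re_eq hharm
  refine ⟨fun τ => F (κ τ), fun τ hτ => ?_, fun τ hτ => ?_⟩
  · refine (hF _ (hκ τ hτ)).comp ?_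
    have h1 := hτne τ hτ
    simp only [κ]
    fun_prop (disch := exact h1)
  · have := hFw (hκ τ hτ)
    simp only [hpκ τ hτ] at this
    exact this

lemma exists_analyticAt_norm_eq_exp {w : ℂ → ℝ} (hw : HarmonicOnNhd w (ball 0 1 \ {0})) {C : ℝ}
    (hC : ∀ z ∈ ball (0 : ℂ) (1 / 2) \ {0}, w z ≤ C - Real.log ‖z‖) :
    ∃ (e : ℂ → ℂ) (β : ℝ), AnalyticAt ℂ e 0 ∧
      ∀ z ∈ ball (0 : ℂ) 1 \ {0}, ‖e z‖ = Real.exp (w z + β * Real.log ‖z‖) := by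
  classical
  obtain ⟨G, hG, hGw⟩ := exists_re_eq_comp_qParam hw
  have hopen : IsOpen {τ : ℂ | 0 < τ.im} := isOpen_lt continuous_const Complex.continuous_im
  have hconn : IsConnected {τ : ℂ | 0 < τ.im} :=
    ⟨⟨Complex.I, by simp⟩, (convex_halfSpace_im_gt 0).isPreconnected⟩
  have hq1 : ∀ τ : ℂ, Function.Periodic.qParam 1 (τ + 1) = Function.Periodic.qParam 1 τ := by
    intro τ
    simp only [Function.Periodic.qParam, Complex.ofReal_one, div_one]
    rw [mul_add, mul_one, Complex.exp_periodic]
  obtain ⟨b, hb⟩ := AnalyticOnNhd.eq_re_add_const_mul_I_of_re_eq_const (c₀ := 0)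
    (f := fun τ => G (τ + 1) - G τ) (U := {τ : ℂ | 0 < τ.im})
    (fun τ hτ => by
      have h1 : AnalyticAt ℂ G (τ + 1) := hG (τ + 1) (by simpa using hτ)
      exact (h1.fun_comp (f := fun τ : ℂ => τ + 1) (by fun_prop)).sub (hG τ hτ))
    (fun τ hτ => by
      have hτ' : 0 < (τ + 1).im := by simpa using hτ
      simp only [Complex.sub_re, hGw _ hτ', hGw _ hτ, hq1, sub_self])
    hopen hconn
  obtain ⟨N, hN⟩ := exists_nat_ge (1 + b / (2 * Real.pi))
  let E : ℂ → ℂ := fun τ => if 0 < τ.im then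
    Complex.exp (G τ - b * Complex.I * τ + N * (2 * Real.pi * Complex.I) * τ) else 0
  have hE : Function.Periodic E (1 : ℝ) := by
    intro τ
    by_cases hτ : 0 < τ.im
    · have hτ' : 0 < (τ + 1).im := by simpa using hτ
      have h1 : G (τ + 1) = G τ + b * Complex.I := by
        rw [← sub_eq_iff_eq_add', hb τ hτ]; simp
      simp only [E, Complex.ofReal_one, if_pos hτ, if_pos hτ', h1]
      refine Eq.trans ?_ (Complex.exp_periodic.nat_mul N _)
      congr 1
      ring
    · have hτ' : ¬ 0 < (τ + 1).im := by simpa using hτ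
      simp only [E, Complex.ofReal_one, if_neg hτ, if_neg hτ']
  have hEd : ∀ τ : ℂ, 0 < τ.im → DifferentiableAt ℂ E τ := by
    intro τ hτ
    have h1 : DifferentiableAt ℂ G τ := (hG τ hτ).differentiableAt
    have h2 : DifferentiableAt ℂ (fun τ => Complex.exp
        (G τ - b * Complex.I * τ + N * (2 * Real.pi * Complex.I) * τ)) τ := by fun_prop
    refine h2.congr_of_eventuallyEq ?_
    filter_upwards [hopen.mem_nhds hτ] with x hx
    exact if_pos hx
  set β : ℝ := N - b / (2 * Real.pi) with hβ
  have hlog : ∀ τ : ℂ, Real.log ‖Function.Periodic.qParam 1 τ‖ = -2 * Real.pi * τ.im := by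
    intro τ
    rw [Function.Periodic.norm_qParam, Real.log_exp, div_one]
  have hEn : ∀ τ : ℂ, 0 < τ.im → ‖E τ‖ = Real.exp (w (Function.Periodic.qParam 1 τ) +
      β * Real.log ‖Function.Periodic.qParam 1 τ‖) := by
    intro τ hτ
    have hπ := Real.pi_ne_zero
    simp only [E, if_pos hτ]
    rw [Complex.norm_exp, hlog, ← hGw τ hτ, hβ]
    congr 1
    simp
    field_simp
    ring
  have him : ∀ᶠ τ in comap Complex.im atTop, 0 < τ.im :=
    tendsto_comap.eventually (eventually_gt_atTop 0)
  have hEb : BoundedAtFilter (comap Complex.im atTop) E := by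
    have hq : ∀ᶠ τ in comap Complex.im atTop, Function.Periodic.qParam 1 τ ∈
        ball (0 : ℂ) (1 / 2) :=
      ((Function.Periodic.qParam_tendsto one_pos).mono_right nhdsWithin_le_nhds).eventually
        (ball_mem_nhds _ (by norm_num))
    refine Asymptotics.IsBigO.of_bound (Real.exp C) ?_
    filter_upwards [him, hq] with τ hτ hτq
    have h0 := hC _ ⟨hτq, Function.Periodic.qParam_ne_zero τ⟩
    have h1 : Real.log ‖Function.Periodic.qParam 1 τ‖ ≤ 0 :=
      Real.log_nonpos (norm_nonneg _) (by linarith [mem_ball_zero_iff.1 hτq])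
    have h2 : 1 ≤ β := by rw [hβ]; linarith
    simp only [hEn τ hτ, Pi.one_apply, norm_one, mul_one]
    gcongr
    nlinarith
  refine ⟨Function.Periodic.cuspFunction 1 E, β, ?_, fun z hz => ?_⟩
  · refine Complex.analyticAt_iff_eventually_differentiableAt.2 ?_
    rw [← nhdsNE_sup_pure, eventually_sup, eventually_pure]
    exact ⟨Function.Periodic.eventually_differentiableAt_cuspFunction_nhds_ne_zero one_pos hE
      (him.mono hEd), Function.Periodic.differentiableAt_cuspFunction_zero one_pos hE
      (him.mono hEd) hEb⟩
  · have h1 : 0 < (Function.Periodic.invQParam 1 z).im := by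
      rw [Function.Periodic.im_invQParam]
      have := Real.log_neg (norm_pos_iff.2 hz.2) (mem_ball_zero_iff.1 hz.1)
      have h3 : 0 < (1 / (2 * Real.pi)) := by positivity
      rw [neg_div]
      nlinarith
    rw [Function.Periodic.cuspFunction_eq_of_nonzero _ _ hz.2, hEn _ h1,
      Function.Periodic.qParam_right_inv one_ne_zero hz.2]

lemma exists_eq_log_add_harmonic {w : ℂ → ℝ} (hw : HarmonicOnNhd w (ball 0 1 \ {0})) {C : ℝ}
    (hC : ∀ z ∈ ball (0 : ℂ) (1 / 2) \ {0}, w z ≤ C - Real.log ‖z‖) :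
    ∃ (γ : ℝ) (h : ℂ → ℝ), HarmonicOnNhd h (ball 0 1) ∧
      ∀ z ∈ ball (0 : ℂ) 1 \ {0}, w z = γ * Real.log ‖z‖ + h z := by
  classical
  obtain ⟨e, β, he, hen⟩ := exists_analyticAt_norm_eq_exp hw hC
  have hball : ball (0 : ℂ) 1 ∈ 𝓝 0 := ball_mem_nhds _ one_pos
  have hne : ¬ ∀ᶠ z in 𝓝 0, e z = 0 := by
    intro h
    have h1 : ∀ᶠ z in 𝓝[≠] (0 : ℂ), False := by
      filter_upwards [nhdsWithin_le_nhds h, nhdsWithin_le_nhds hball, self_mem_nhdsWithin]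
        with z hz hz1 hz0
      have := hen z ⟨hz1, hz0⟩
      rw [hz, norm_zero] at this
      exact (Real.exp_pos _).ne this
    exact h1.exists.elim fun _ h => h
  obtain ⟨n, g, hg, hg0, heg⟩ := he.exists_eventuallyEq_pow_smul_nonzero_iff.2 hne
  have hloc : ∀ᶠ z in 𝓝 (0 : ℂ), z ≠ 0 →
      w z - (n - β) * Real.log ‖z‖ = Real.log ‖g z‖ := by
    filter_upwards [heg, hball, hg.continuousAt.eventually_ne hg0] with z hz hz1 hgz hz0
    have h1 := congrArg Real.log (hen z ⟨hz1, hz0⟩)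
    rw [Real.log_exp, hz, sub_zero, norm_smul, norm_pow,
      Real.log_mul (pow_ne_zero _ (norm_ne_zero_iff.2 hz0)) (norm_ne_zero_iff.2 hgz),
      Real.log_pow] at h1
    linarith
  refine ⟨n - β, fun z => if z = 0 then Real.log ‖g 0‖ else w z - (n - β) * Real.log ‖z‖,
    fun z hz => ?_, fun z hz => ?_⟩
  · rcases eq_or_ne z 0 with rfl | hz0
    · refine (harmonicAt_congr_nhds ?_).1 (hg.harmonicAt_log_norm hg0)
      filter_upwards [hloc] with x hx
      by_cases hx0 : x = 0
      · simp [hx0]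
      · simp [hx0, hx hx0]
    · have h1 : HarmonicAt (fun z : ℂ => Real.log ‖z‖) z :=
        analyticAt_id.harmonicAt_log_norm hz0
      refine (harmonicAt_congr_nhds ?_).1 ((hw z ⟨hz, hz0⟩).sub (h1.const_smul (c := n - β)))
      filter_upwards [isOpen_ne.mem_nhds hz0] with x hx
      simp [if_neg hx]
  · simp [show z ≠ 0 from hz.2]

lemma neg_one_lt_of_lintegral_exp_lt_top {γ : ℝ} {h w : ℂ → ℝ}
    (hh : ContinuousAt h 0) (hw : ∀ z ∈ ball (0 : ℂ) 1 \ {0}, w z = γ * Real.log ‖z‖ + h z)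
    (hint : ∫⁻ z in ball (0 : ℂ) 1, ENNReal.ofReal (Real.exp (2 * w z)) < ⊤) : -1 < γ := by
  obtain ⟨δ, hδ, hδh⟩ := Metric.eventually_nhds_iff_ball.1
    ((hh.tendsto.eventually_const_lt (sub_one_lt (h 0))).and (ball_mem_nhds (0 : ℂ) one_pos))
  have hmeas : Measurable fun z : ℂ => (Set.Ioo 0 δ).indicator (fun y : ℝ => y ^ (2 * γ)) ‖z‖ :=
    (Measurable.indicator (by fun_prop) measurableSet_Ioo).comp measurable_norm
  have hfin : Integrable
      fun z : ℂ => (Set.Ioo 0 δ).indicator (fun y : ℝ => y ^ (2 * γ)) ‖z‖ := by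
    refine ⟨hmeas.aestronglyMeasurable, ?_⟩
    have hle : ∀ z : ℂ, ‖(Set.Ioo 0 δ).indicator (fun y : ℝ => y ^ (2 * γ)) ‖z‖‖ₑ ≤
        (ball (0 : ℂ) 1).indicator (fun z => ENNReal.ofReal (Real.exp (-2 * (h 0 - 1))) *
          ENNReal.ofReal (Real.exp (2 * w z))) z := by
      intro z
      by_cases hz : ‖z‖ ∈ Set.Ioo 0 δ
      · obtain ⟨h1, h2⟩ := hδh z (mem_ball_zero_iff.2 hz.2)
        rw [Set.indicator_of_mem hz, Set.indicator_of_mem (mem_ball.2 h2), Real.enorm_of_nonneg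
          (Real.rpow_nonneg hz.1.le _), ← ENNReal.ofReal_mul (Real.exp_pos _).le,
          ← Real.exp_add, hw z ⟨h2, norm_pos_iff.1 hz.1⟩, Real.rpow_def_of_pos hz.1]
        apply ENNReal.ofReal_le_ofReal
        gcongr
        linarith
      · simp [Set.indicator_of_notMem hz]
    refine (lintegral_mono hle).trans_lt ?_
    rw [lintegral_indicator measurableSet_ball, lintegral_const_mul' _ _ ENNReal.ofReal_ne_top]
    exact ENNReal.mul_lt_top ENNReal.ofReal_lt_top hint
  rw [integrable_fun_norm_addHaar (μ := (volume : Measure ℂ))] at hfin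
  have h3 : IntegrableOn (fun y : ℝ => y ^ (2 * γ + 1)) (Set.Ioo 0 δ) := by
    refine (hfin.mono_set (fun y hy => hy.1)).congr_fun (fun y hy => ?_) measurableSet_Ioo
    simp only [Complex.finrank_real_complex, Set.indicator_of_mem hy, smul_eq_mul]
    rw [Real.rpow_add_one hy.1.ne']
    ring
  have := (intervalIntegral.integrableOn_Ioo_rpow_iff hδ).1 h3
  linarith

lemma exists_neg_le_newtonPotential {f : ℂ → ℝ} (hf : IntegrableOn f (ball 0 1))
    (hneg : ∀ᵐ ζ ∂volume.restrict (ball (0 : ℂ) 1), f ζ ≤ 0) :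
    ∃ C : ℝ, ∀ z ∈ ball (0 : ℂ) 1, -C ≤ newtonPotential f z := by
  refine ⟨(2 * Real.pi)⁻¹ * -(Real.log 2 * ∫ ζ in ball (0 : ℂ) 1, f ζ), fun z hz => ?_⟩
  have hI : ∫ ζ in ball (0 : ℂ) 1, f ζ ≤ 0 := integral_nonpos_of_ae hneg
  have hlog2 : 0 ≤ Real.log 2 := Real.log_nonneg one_le_two
  rw [newtonPotential, ← mul_neg, neg_neg]
  refine mul_le_mul_of_nonneg_left ?_ (by positivity)
  by_cases hi : IntegrableOn (fun ζ => Real.log ‖z - ζ‖ * f ζ) (ball 0 1)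
  · rw [← integral_const_mul]
    refine integral_mono_ae (hf.const_mul _) hi ?_
    filter_upwards [hneg, ae_restrict_mem measurableSet_ball] with ζ h1 h2
    refine mul_le_mul_of_nonpos_right ?_ h1
    rcases (norm_nonneg (z - ζ)).eq_or_lt with h0 | h0
    · rw [← h0, Real.log_zero]
      exact hlog2
    · refine Real.log_le_log h0 ((norm_sub_le z ζ).trans ?_)
      linarith [mem_ball_zero_iff.1 hz, mem_ball_zero_iff.1 h2]
  · rw [integral_undef hi]
    exact mul_nonpos_of_nonneg_of_nonpos hlog2 hI

lemma integrableOn_mul_exp {k u : ℂ → ℝ}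
    (hk_cont : ContinuousOn k (ball (0 : ℂ) 1 \ {0}))
    (hk_bdd : ∃ M : ℝ, ∀ z ∈ ball (0 : ℂ) 1 \ {0}, |k z| ≤ M)
    (hu : ContinuousOn u (ball (0 : ℂ) 1 \ {0}))
    (hint : ∫⁻ z in ball (0 : ℂ) 1, ENNReal.ofReal (Real.exp (2 * u z)) < ⊤) :
    IntegrableOn (fun z => k z * Real.exp (2 * u z)) (ball 0 1) := by
  obtain ⟨M, hM⟩ := hk_bdd
  have hU : MeasurableSet (ball (0 : ℂ) 1 \ {0}) :=
    measurableSet_ball.diff (measurableSet_singleton 0)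
  have hae : (ball (0 : ℂ) 1 \ {0} : Set ℂ) =ᵐ[volume] ball 0 1 :=
    sdiff_null_ae_eq_self (measure_singleton 0)
  have hexp : ContinuousOn (fun z => Real.exp (2 * u z)) (ball (0 : ℂ) 1 \ {0}) := by fun_prop
  rw [← integrableOn_congr_set_ae hae]
  have h1 : IntegrableOn (fun z => Real.exp (2 * u z)) (ball (0 : ℂ) 1 \ {0}) := by
    refine ⟨hexp.aestronglyMeasurable hU, ?_⟩
    rw [hasFiniteIntegral_iff_ofReal (ae_of_all _ fun z => (Real.exp_pos _).le)]
    exact (lintegral_mono_set Set.sdiff_subset).trans_lt hint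
  refine h1.bdd_mul (hk_cont.aestronglyMeasurable hU) (c := M) ?_
  filter_upwards [ae_restrict_mem hU] with z hz using hM z hz

/-- Lemma 2.1: if k is bounded, nonpositive and continuous on the punctured unit disk
and u is a C² solution of Δu = k·e^{2u} there with ∬_𝔻 e^{2u} dxdy < ∞, then
u(z) = γ·log|z| + h(z) + v(z) with γ > −1, h harmonic on 𝔻, and v the Newton
potential of k·e^{2u}. -/
theorem decomposition_lemma (k u : ℂ → ℝ)
    (hk_cont : ContinuousOn k (ball (0 : ℂ) 1 \ {0}))
    (hk_bdd : ∃ M : ℝ, ∀ z ∈ ball (0 : ℂ) 1 \ {0}, |k z| ≤ M)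
    (hk_nonpos : ∀ z ∈ ball (0 : ℂ) 1 \ {0}, k z ≤ 0)
    (hu : ContDiffOn ℝ 2 u (ball (0 : ℂ) 1 \ {0}))
    (hpde : ∀ z ∈ ball (0 : ℂ) 1 \ {0}, lapl u z = k z * Real.exp (2 * u z))
    (hint : ∫⁻ z in ball (0 : ℂ) 1, ENNReal.ofReal (Real.exp (2 * u z)) < ⊤) :
    ∃ (γ : ℝ) (h : ℂ → ℝ), -1 < γ ∧ IsHarmonicOn h (ball (0 : ℂ) 1) ∧
      ∀ z ∈ ball (0 : ℂ) 1 \ {0},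
        u z = γ * Real.log ‖z‖ + h z
          + newtonPotential (fun w => k w * Real.exp (2 * u w)) z := by
  set f : ℂ → ℝ := fun w => k w * Real.exp (2 * u w)
  have hf : IntegrableOn f (ball 0 1) := integrableOn_mul_exp hk_cont hk_bdd hu.continuousOn hint
  have hU : IsOpen (ball (0 : ℂ) 1 \ {0}) := isOpen_ball.sdiff isClosed_singleton
  have hneg : ∀ᵐ ζ ∂volume.restrict (ball (0 : ℂ) 1), f ζ ≤ 0 := by
    filter_upwards [ae_restrict_mem measurableSet_ball,
      ae_restrict_of_ae (Measure.ae_ne volume (0 : ℂ))] with ζ h1 h2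
    exact mul_nonpos_of_nonpos_of_nonneg (hk_nonpos ζ ⟨h1, h2⟩) (Real.exp_pos _).le
  obtain ⟨A, hA⟩ := exists_neg_le_newtonPotential hf hneg
  have hw : HarmonicOnNhd (fun z => u z - newtonPotential f z) (ball 0 1 \ {0}) :=
    fun z hz => harmonicAt_sub_newtonPotential hU Set.sdiff_subset hu hf hpde hz
  have hwint : ∫⁻ z in ball (0 : ℂ) 1,
      ENNReal.ofReal (Real.exp (2 * (u z - newtonPotential f z))) < ⊤ := by
    refine (setLIntegral_mono' (g := fun z => ENNReal.ofReal (Real.exp (2 * A)) *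
      ENNReal.ofReal (Real.exp (2 * u z))) measurableSet_ball fun z hz => ?_).trans_lt ?_
    · rw [← ENNReal.ofReal_mul (Real.exp_pos _).le, ← Real.exp_add]
      apply ENNReal.ofReal_le_ofReal
      gcongr
      linarith [hA z hz]
    · rw [lintegral_const_mul' _ _ ENNReal.ofReal_ne_top]
      exact ENNReal.mul_lt_top ENNReal.ofReal_lt_top hint
  obtain ⟨C, hC⟩ := le_const_sub_log_of_lintegral_lt_top hw hwint
  obtain ⟨γ, h, hh, heq⟩ := exists_eq_log_add_harmonic hw hC
  have hh0 : ContinuousAt h 0 := (hh 0 (mem_ball_self one_pos)).1.continuousAt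
  refine ⟨γ, h, neg_one_lt_of_lintegral_exp_lt_top hh0 heq hwint, hh.isHarmonicOn,
    fun z hz => ?_⟩
  rw [← heq z hz]
  ring
end

section
/- (Brézis–Merle) Let f ∈ L¹(𝔻) and let v be the Newton potential of f. Then for every exponent 0 < p < ∞ one has e^{|v|} ∈ L^p(𝔻), i.e. ∬_𝔻 e^{p·|v(z)|} dxdy < ∞. -/
open Metric MeasureTheory
open scoped ENNReal

/-- The exponential of the absolute value of the logarithmic kernel is integrable near its pole. -/
lemma integrableOn_exp_abs_log_norm :
    IntegrableOn (fun w : ℂ => Real.exp |Real.log ‖w‖|) (ball 0 2) := by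
  refine integrableOn_ball_of_norm_le_rpow (C := 5) (α := 1) (by simp) (by simp) ?_
    (by fun_prop : Measurable fun w : ℂ => Real.exp |Real.log ‖w‖|).aestronglyMeasurable
  have h0 : ∀ᵐ w : ℂ ∂volume.restrict (ball 0 2), w ≠ 0 :=
    ae_restrict_of_ae (Measure.ae_ne volume 0)
  filter_upwards [h0, ae_restrict_mem measurableSet_ball] with w hw hw2
  have hpos : 0 < ‖w‖ := norm_pos_iff.mpr hw
  have hlt : ‖w‖ < 2 := mem_ball_zero_iff.mp hw2
  rw [Real.norm_of_nonneg (Real.exp_pos _).le, Real.rpow_neg_one, ← div_eq_mul_inv, le_div_iff₀ hpos]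
  rcases abs_cases (Real.log ‖w‖) with ⟨h, -⟩ | ⟨h, -⟩
  · rw [h, Real.exp_log hpos]
    nlinarith
  · rw [h, Real.exp_neg, Real.exp_log hpos, inv_mul_cancel₀ hpos.ne']
    norm_num

/-- The integrals over the unit disk of `exp |log ‖z - ζ‖|` are bounded uniformly in the pole. -/
lemma lintegral_exp_abs_log_norm_sub_le {ζ : ℂ} (hζ : ζ ∈ ball (0 : ℂ) 1) :
    ∫⁻ z in ball (0 : ℂ) 1, ENNReal.ofReal (Real.exp |Real.log ‖z - ζ‖|) ≤
      ∫⁻ w in ball (0 : ℂ) 2, ENNReal.ofReal (Real.exp |Real.log ‖w‖|) := by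
  rw [← lintegral_indicator measurableSet_ball, ← lintegral_indicator measurableSet_ball,
    ← lintegral_sub_right_eq_self (μ := volume) ((ball (0 : ℂ) 2).indicator _) ζ]
  refine lintegral_mono fun z => ?_
  by_cases hz : z ∈ ball (0 : ℂ) 1
  · have hzζ : z - ζ ∈ ball (0 : ℂ) 2 := by
      rw [mem_ball_zero_iff] at *
      linarith [norm_sub_le z ζ]
    rw [Set.indicator_of_mem hz, Set.indicator_of_mem hzζ]
  · rw [Set.indicator_of_notMem hz]
    exact zero_le

/-- A form of Jensen's inequality for the exponential and measures of total mass at most one. -/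
lemma ofReal_exp_integral_le {α : Type*} [MeasurableSpace α] {μ : Measure α}
    (hμ : μ Set.univ ≤ 1) (φ : α → ℝ) :
    ENNReal.ofReal (Real.exp (∫ x, φ x ∂μ)) ≤
      ENNReal.ofReal (Real.exp 1) + ∫⁻ x, ENNReal.ofReal (Real.exp (φ x)) ∂μ := by
  set A := ∫ x, φ x ∂μ with hA
  rcases le_total A 1 with h1 | h1
  · exact le_add_right (ENNReal.ofReal_le_ofReal (Real.exp_le_exp.mpr h1))
  have hφ : Integrable φ μ := by
    by_contra hn
    rw [hA, integral_undef hn] at h1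
    linarith
  have : IsFiniteMeasure μ := ⟨hμ.trans_lt ENNReal.one_lt_top⟩
  have hm : μ.real Set.univ ≤ 1 := ENNReal.toReal_le_of_le_ofReal zero_le_one (by simpa using hμ)
  have hint : Integrable (fun x => Real.exp A * ((1 - A) + φ x)) μ :=
    ((integrable_const _).add hφ).const_mul _
  have hval : ∫ x, Real.exp A * ((1 - A) + φ x) ∂μ =
      Real.exp A * (μ.real Set.univ * (1 - A) + A) := by
    rw [integral_const_mul, integral_add (integrable_const _) hφ, integral_const, smul_eq_mul]
  calc ENNReal.ofReal (Real.exp A)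
      ≤ ENNReal.ofReal (∫ x, Real.exp A * ((1 - A) + φ x) ∂μ) := by
        rw [hval]
        exact ENNReal.ofReal_le_ofReal (le_mul_of_one_le_right (Real.exp_pos A).le (by nlinarith))
    _ ≤ ∫⁻ x, ENNReal.ofReal (Real.exp A * ((1 - A) + φ x)) ∂μ := by
        rw [integral_eq_lintegral_pos_part_sub_lintegral_neg_part hint]
        exact (ENNReal.ofReal_le_ofReal (sub_le_self _ ENNReal.toReal_nonneg)).trans
          ENNReal.ofReal_toReal_le
    _ ≤ ∫⁻ x, ENNReal.ofReal (Real.exp (φ x)) ∂μ := by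
        refine lintegral_mono fun x => ENNReal.ofReal_le_ofReal ?_
        calc Real.exp A * ((1 - A) + φ x)
            ≤ Real.exp A * Real.exp (φ x - A) := by
              gcongr
              linarith [Real.add_one_le_exp (φ x - A)]
          _ = Real.exp (φ x) := by rw [← Real.exp_add, add_sub_cancel]
    _ ≤ _ := le_add_self

/-- The part of an integrable function above a sufficiently high level has small integral. -/
lemma exists_lintegral_ofReal_abs_sub_le_one {α : Type*} [MeasurableSpace α] {μ : Measure α}
    {h : α → ℝ} (hh : Integrable h μ) :
    ∃ n : ℕ, ∫⁻ x, ENNReal.ofReal (|h x| - n) ∂μ ≤ 1 := by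
  have hlim : Filter.Tendsto (fun n : ℕ => ∫⁻ x, ENNReal.ofReal (|h x| - n) ∂μ) Filter.atTop
      (nhds (∫⁻ _, 0 ∂μ)) := by
    refine tendsto_lintegral_of_dominated_convergence' (fun x => ENNReal.ofReal |h x|)
      (fun n => (hh.abs.aemeasurable.sub_const _).ennreal_ofReal) (fun n => ?_) ?_ ?_
    · exact Filter.Eventually.of_forall fun x =>
        ENNReal.ofReal_le_ofReal (sub_le_self _ n.cast_nonneg)
    · exact hh.abs.lintegral_lt_top.ne
    · refine Filter.Eventually.of_forall fun x => tendsto_const_nhds.congr' ?_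
      filter_upwards [Filter.eventually_ge_atTop ⌈|h x|⌉₊] with n hn
      exact (ENNReal.ofReal_of_nonpos (sub_nonpos.mpr (Nat.ceil_le.mp hn))).symm
  rw [lintegral_zero] at hlim
  exact (hlim.eventually_le_const one_pos).exists

/-- Lemma 2.2 (Brézis–Merle): if f ∈ L¹(𝔻) and v is the Newton potential of f, then
e^{|v|} ∈ L^p(𝔻) for every 0 < p < ∞, i.e. ∬_𝔻 e^{p·|v|} dxdy < ∞. -/
theorem brezis_merle (f : ℂ → ℝ) (hf : IntegrableOn f (ball (0 : ℂ) 1)) :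
    ∀ p : ℝ, 0 < p →
      ∫⁻ z in ball (0 : ℂ) 1,
        ENNReal.ofReal (Real.exp (p * |newtonPotential f z|)) < ⊤ := by
  intro p hp
  set D : Measure ℂ := volume.restrict (ball (0 : ℂ) 1) with hD
  set K : ℂ → ℂ → ℝ := fun z ζ => |Real.log ‖z - ζ‖| with hK
  set h : ℂ → ℝ := fun ζ => p * (2 * Real.pi)⁻¹ * f ζ with hh
  have hhint : Integrable h D := hf.const_mul _
  have hpi : 0 < p * (2 * Real.pi)⁻¹ := by positivity
  obtain ⟨n, hn⟩ := exists_lintegral_ofReal_abs_sub_le_one hhint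
  set g : ℂ → ℝ≥0∞ := fun ζ => ENNReal.ofReal (|h ζ| - n) with hg
  have hgm : AEMeasurable g D := (hhint.abs.aemeasurable.sub_const _).ennreal_ofReal
  set μ : Measure ℂ := D.withDensity g with hμ
  have hμ1 : μ Set.univ ≤ 1 := by
    rwa [hμ, withDensity_apply _ MeasurableSet.univ, Measure.restrict_univ]
  have : IsFiniteMeasure μ := ⟨hμ1.trans_lt ENNReal.one_lt_top⟩
  have hKm : Measurable (Function.uncurry K) := by
    simp only [hK, Function.uncurry_def]
    fun_prop
  set C : ℝ≥0∞ := ∫⁻ w in ball (0 : ℂ) 2, ENNReal.ofReal (Real.exp |Real.log ‖w‖|) with hC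
  have hCtop : C < ⊤ := integrableOn_exp_abs_log_norm.lintegral_lt_top
  have hKz : ∀ z ∈ ball (0 : ℂ) 1,
      Integrable (K z) D ∧ ∫ ζ, K z ζ ∂D ≤ C.toReal := by
    intro z hz
    have hle : ∫⁻ ζ, ENNReal.ofReal (K z ζ) ∂D ≤ C := by
      refine le_trans (lintegral_mono fun ζ => ENNReal.ofReal_le_ofReal ?_)
        (lintegral_exp_abs_log_norm_sub_le hz)
      rw [norm_sub_rev ζ z]
      linarith [Real.add_one_le_exp (K z ζ)]
    have hm : AEStronglyMeasurable (K z) D :=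
      (hKm.comp measurable_prodMk_left).aestronglyMeasurable
    have h0 : 0 ≤ᵐ[D] K z := Filter.Eventually.of_forall fun ζ => abs_nonneg _
    refine ⟨(lintegral_ofReal_ne_top_iff_integrable hm h0).mp (hle.trans_lt hCtop).ne, ?_⟩
    rw [integral_eq_lintegral_of_nonneg_ae h0 hm]
    exact ENNReal.toReal_mono hCtop.ne hle
  have hv : ∀ z ∈ ball (0 : ℂ) 1,
      p * |newtonPotential f z| ≤ n * C.toReal + ∫ ζ, K z ζ ∂μ := by
    intro z hz
    obtain ⟨hKi, hKle⟩ := hKz z hz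
    have hμint : ∫ ζ, K z ζ ∂μ = ∫ ζ, (g ζ).toReal * K z ζ ∂D :=
      integral_withDensity_eq_integral_toReal_smul₀ hgm
        (Filter.Eventually.of_forall fun _ => ENNReal.ofReal_lt_top) _
    have hpv : p * |newtonPotential f z| = |∫ ζ, Real.log ‖z - ζ‖ * h ζ ∂D| := by
      simp only [newtonPotential, hh, mul_left_comm _ (p * (2 * Real.pi)⁻¹), integral_const_mul]
      rw [abs_mul, abs_mul, abs_of_pos hpi, abs_of_pos (by positivity : 0 < (2 * Real.pi)⁻¹)]
      ring
    rw [hpv, hμint]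
    by_cases hi : Integrable (fun ζ => Real.log ‖z - ζ‖ * h ζ) D
    · have habs : ∀ ζ, |Real.log ‖z - ζ‖ * h ζ| = K z ζ * |h ζ| := fun ζ => abs_mul _ _
      have hgi : Integrable (fun ζ => (g ζ).toReal * K z ζ) D := by
        refine hi.mono (hgm.ennreal_toReal.aestronglyMeasurable.mul hKi.1)
          (Filter.Eventually.of_forall fun ζ => ?_)
        rw [Real.norm_eq_abs, Real.norm_eq_abs, habs, abs_mul, abs_of_nonneg ENNReal.toReal_nonneg,
          mul_comm, hK, abs_abs]
        gcongr
        exact ENNReal.toReal_le_of_le_ofReal (abs_nonneg _)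
          (ENNReal.ofReal_le_ofReal (sub_le_self _ n.cast_nonneg))
      calc |∫ ζ, Real.log ‖z - ζ‖ * h ζ ∂D|
          ≤ ∫ ζ, |Real.log ‖z - ζ‖ * h ζ| ∂D := abs_integral_le_integral_abs
        _ ≤ ∫ ζ, (n * K z ζ + (g ζ).toReal * K z ζ) ∂D := by
          refine integral_mono hi.abs ((hKi.const_mul _).add hgi) fun ζ => ?_
          have hle : |h ζ| ≤ n + (g ζ).toReal := by
            rw [hg, ENNReal.toReal_ofReal']
            linarith [le_max_left (|h ζ| - n) 0]
          calc |Real.log ‖z - ζ‖ * h ζ| = K z ζ * |h ζ| := habs ζ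
            _ ≤ K z ζ * (n + (g ζ).toReal) := mul_le_mul_of_nonneg_left hle (abs_nonneg _)
            _ = n * K z ζ + (g ζ).toReal * K z ζ := by ring
        _ = n * ∫ ζ, K z ζ ∂D + ∫ ζ, (g ζ).toReal * K z ζ ∂D := by
          rw [integral_add (hKi.const_mul _) hgi, integral_const_mul]
        _ ≤ _ := by gcongr
    · rw [integral_undef hi, abs_zero]
      have : 0 ≤ ∫ ζ, (g ζ).toReal * K z ζ ∂D :=
        integral_nonneg fun ζ => mul_nonneg ENNReal.toReal_nonneg (abs_nonneg _)
      positivity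
  have hEm : Measurable (Function.uncurry fun z ζ => ENNReal.ofReal (Real.exp (K z ζ))) :=
    hKm.exp.ennreal_ofReal
  have hDμ : ∫⁻ z, ∫⁻ ζ, ENNReal.ofReal (Real.exp (K z ζ)) ∂μ ∂D ≤ C := by
    rw [lintegral_lintegral_swap hEm.aemeasurable]
    have hball : ∀ᵐ ζ ∂μ, ζ ∈ ball (0 : ℂ) 1 :=
      (withDensity_absolutelyContinuous D g).ae_le (ae_restrict_mem measurableSet_ball)
    calc ∫⁻ ζ, ∫⁻ z, ENNReal.ofReal (Real.exp (K z ζ)) ∂D ∂μ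
        ≤ ∫⁻ _, C ∂μ :=
          lintegral_mono_ae (hball.mono fun ζ hζ => lintegral_exp_abs_log_norm_sub_le hζ)
      _ ≤ C := by
          rw [lintegral_const]
          exact mul_le_of_le_one_right' hμ1
  calc ∫⁻ z, ENNReal.ofReal (Real.exp (p * |newtonPotential f z|)) ∂D
      ≤ ∫⁻ z, ENNReal.ofReal (Real.exp (n * C.toReal)) * (ENNReal.ofReal (Real.exp 1) +
          ∫⁻ ζ, ENNReal.ofReal (Real.exp (K z ζ)) ∂μ) ∂D := by
        refine lintegral_mono_ae ((ae_restrict_mem measurableSet_ball).mono fun z hz => ?_)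
        calc ENNReal.ofReal (Real.exp (p * |newtonPotential f z|))
            ≤ ENNReal.ofReal (Real.exp (n * C.toReal + ∫ ζ, K z ζ ∂μ)) :=
              ENNReal.ofReal_le_ofReal (Real.exp_le_exp.mpr (hv z hz))
          _ = ENNReal.ofReal (Real.exp (n * C.toReal)) *
                ENNReal.ofReal (Real.exp (∫ ζ, K z ζ ∂μ)) := by
              rw [Real.exp_add, ENNReal.ofReal_mul (Real.exp_pos _).le]
          _ ≤ _ := by
              gcongr
              exact ofReal_exp_integral_le hμ1 _
    _ = ENNReal.ofReal (Real.exp (n * C.toReal)) * (ENNReal.ofReal (Real.exp 1) * D Set.univ +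
          ∫⁻ z, ∫⁻ ζ, ENNReal.ofReal (Real.exp (K z ζ)) ∂μ ∂D) := by
        rw [lintegral_const_mul' _ _ ENNReal.ofReal_ne_top, lintegral_add_left measurable_const,
          lintegral_const]
    _ < ⊤ := by
        have hDfin : D Set.univ < ⊤ := by
          rw [hD, Measure.restrict_apply_univ]
          exact measure_ball_lt_top
        exact ENNReal.mul_lt_top ENNReal.ofReal_lt_top (ENNReal.add_lt_top.mpr
          ⟨ENNReal.mul_lt_top ENNReal.ofReal_lt_top hDfin, hDμ.trans_lt hCtop⟩)
end

section
/- Let γ ∈ ℝ and let g be a holomorphic function on the punctured unit disk 𝔻∖{0} such that ∬_𝔻 |z|^{2γ} · |e^{g(z)}|² dxdy < ∞. Then g extends to a holomorphic function on all of 𝔻; equivalently, the singularity of g at z = 0 is removable. -/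
open Metric MeasureTheory
open scoped ENNReal

open Filter Topology Set in
/-- A function that is holomorphic near `c` away from `c` and whose real part is bounded above
there has a limit at `c`. -/
theorem exists_tendsto_of_eventually_re_le {g : ℂ → ℂ} {c : ℂ} {M : ℝ}
    (hd : ∀ᶠ z in 𝓝[≠] c, DifferentiableAt ℂ g z) (hM : ∀ᶠ z in 𝓝[≠] c, (g z).re ≤ M) :
    ∃ l, Tendsto g (𝓝[≠] c) (𝓝 l) := by
  set F : ℂ → ℂ := fun z => (g z - (M + 1))⁻¹ with hF
  have hre : ∀ z, (g z).re ≤ M → (g z - (M + 1)).re ≤ -1 := fun z hz => by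
    simp only [Complex.sub_re, Complex.add_re, Complex.ofReal_re, Complex.one_re]; linarith
  have hne : ∀ z, (g z).re ≤ M → g z - (M + 1) ≠ 0 := fun z hz h => by
    have := hre z hz
    rw [h, Complex.zero_re] at this
    linarith
  have hFd : ∀ᶠ z in 𝓝[≠] c, DifferentiableAt ℂ F z := by
    filter_upwards [hd, hM] with z hz hz'
    exact (hz.sub_const _).inv (hne z hz')
  have hFb : ∀ᶠ z in 𝓝[≠] c, ‖F z‖ ≤ 1 := by
    filter_upwards [hM] with z hz
    rw [hF, norm_inv]
    refine inv_le_one_of_one_le₀ ?_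
    have h1 := Complex.abs_re_le_norm (g z - (M + 1))
    have h2 := neg_abs_le (g z - (M + 1)).re
    linarith [hre z hz]
  have hlim := Complex.tendsto_limUnder_of_differentiable_on_punctured_nhds_of_bounded_under hFd
    ⟨1 + ‖F c‖, eventually_map.2 (hFb.mono fun z hz => norm_sub_le_of_le hz le_rfl)⟩
  set l := limUnder (𝓝[≠] c) F
  have hl : l ≠ 0 := by
    intro hl
    rw [hl] at hlim
    set E : ℂ → ℂ := Function.update F c 0 with hE
    have hEc : ContinuousAt E c := continuousAt_update_same.2 hlim
    have hEF : ∀ z ≠ c, E =ᶠ[𝓝 z] F := fun z hz => by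
      filter_upwards [isOpen_ne.mem_nhds hz] with w hw
      exact Function.update_of_ne hw _ _
    have hEd : ∀ᶠ z in 𝓝[≠] c, DifferentiableAt ℂ E z := by
      filter_upwards [hFd, self_mem_nhdsWithin] with z hz hzc
      exact hz.congr_of_eventuallyEq (hEF z hzc)
    have hEa := (Complex.analyticAt_of_differentiable_on_punctured_nhds_of_continuousAt
      hEd hEc).eventually_analyticAt
    have hneg : ∀ᶠ z in 𝓝[≠] c, (E z).re < 0 := by
      filter_upwards [hM, self_mem_nhdsWithin] with z hz hzc
      rw [(hEF z hzc).eq_of_nhds, hF, Complex.inv_re]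
      exact div_neg_of_neg_of_pos (by linarith [hre z hz]) (Complex.normSq_pos.2 (hne z hz))
    have hEc0 : E c = 0 := Function.update_self ..
    have hmax : IsLocalMax (norm ∘ fun z => Complex.exp (E z)) c := by
      have := eventually_nhdsWithin_iff.1 hneg
      filter_upwards [this] with z hz
      rcases eq_or_ne z c with rfl | hzc
      · rfl
      · simpa [Complex.norm_exp, hEc0] using (hz hzc).le
    have heq := Complex.norm_eventually_eq_of_isLocalMax
      (hEa.mono fun z hz => hz.differentiableAt.cexp) hmax
    obtain ⟨z, hz1, hz2⟩ := ((heq.filter_mono nhdsWithin_le_nhds).and hneg).exists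
    simp only [Complex.norm_exp, hEc0, Complex.zero_re, Real.exp_zero, Real.exp_eq_one_iff] at hz1
    linarith
  refine ⟨l⁻¹ + (M + 1), ((hlim.inv₀ hl).add_const _).congr fun z => ?_⟩
  simp [hF]

open Set Real in
/-- A crude form of the area sub-mean value inequality for a holomorphic function on a disk. -/
theorem ofReal_sq_mul_enorm_le_lintegral_ball {f : ℂ → ℂ} {c : ℂ} {R : ℝ}
    (hR : 0 < R) (hf : DifferentiableOn ℂ f (ball c R)) :
    ENNReal.ofReal (R ^ 2) * ‖f c‖ₑ ≤ ∫⁻ z in ball c R, ‖f z‖ₑ := by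
  classical
  set F : ℂ → ℂ := (ball c R).piecewise f 0 with hF
  have hFm : Measurable F :=
    hf.continuousOn.measurable_piecewise continuousOn_const measurableSet_ball
  have hcirc : ∀ r ∈ Ioo (R / 2) R,
      ENNReal.ofReal (2 * π) * ‖f c‖ₑ ≤
        ∫⁻ θ in Ioo (-π) π, ‖F (c + Complex.polarCoord.symm (r, θ))‖ₑ := by
    intro r hr
    have hr0 : 0 < r := by linarith [hr.1]
    have hmean : circleAverage f c r = f c := by
      apply DiffContOnCl.circleAverage
      rw [abs_of_pos hr0]
      exact (hf.mono (closedBall_subset_ball hr.2)).diffContOnCl_ball subset_rfl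
    have hint : ∫ θ in Ioo (-π) π, F (c + Complex.polarCoord.symm (r, θ)) = (2 * π) • f c := by
      rw [← hmean, circleAverage_eq_integral_add (-π), smul_inv_smul₀ (by positivity),
        intervalIntegral.integral_comp_add_right (fun θ => f (circleMap c r θ)),
        intervalIntegral.integral_of_le (by linarith [pi_pos]), integral_Ioc_eq_integral_Ioo]
      rw [show 0 + -π = -π by ring, show 2 * π + -π = π by ring]
      refine integral_congr_ae (.of_forall fun θ => ?_)
      have : c + Complex.polarCoord.symm (r, θ) = circleMap c r θ := by
        simp [circleMap, Complex.exp_mul_I]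
      simp only [this, hF]
      refine piecewise_eq_of_mem _ _ _ ?_
      simpa [dist_eq_norm, circleMap, abs_of_pos hr0] using hr.2
    calc ENNReal.ofReal (2 * π) * ‖f c‖ₑ = ‖(2 * π) • f c‖ₑ := by
          rw [enorm_smul, Real.enorm_of_nonneg (by positivity)]
      _ ≤ _ := hint ▸ enorm_integral_le_lintegral_enorm _
  calc ENNReal.ofReal (R ^ 2) * ‖f c‖ₑ
      ≤ ENNReal.ofReal (R / 2) * (ENNReal.ofReal (2 * π) * ‖f c‖ₑ) * ENNReal.ofReal (R / 2) := by
        rw [← mul_assoc, mul_right_comm, ← ENNReal.ofReal_mul (by positivity),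
          ← ENNReal.ofReal_mul (by positivity)]
        gcongr
        nlinarith [pi_gt_three, sq_nonneg R]
    _ = ∫⁻ r in Ioo (R / 2) R, ENNReal.ofReal (R / 2) * (ENNReal.ofReal (2 * π) * ‖f c‖ₑ) := by
        rw [setLIntegral_const, Real.volume_Ioo, sub_half]
    _ ≤ ∫⁻ r in Ioo (R / 2) R, ENNReal.ofReal r *
          ∫⁻ θ in Ioo (-π) π, ‖F (c + Complex.polarCoord.symm (r, θ))‖ₑ := by
        refine setLIntegral_mono' measurableSet_Ioo fun r hr => ?_
        gcongr
        · exact hr.1.le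
        · exact hcirc r hr
    _ ≤ ∫⁻ r in Ioi 0, ENNReal.ofReal r *
          ∫⁻ θ in Ioo (-π) π, ‖F (c + Complex.polarCoord.symm (r, θ))‖ₑ :=
        lintegral_mono_set fun r hr => by have := hr.1; rw [mem_Ioi]; linarith
    _ = ∫⁻ p in polarCoord.target,
          ENNReal.ofReal p.1 • ‖F (c + Complex.polarCoord.symm p)‖ₑ := by
        have hs : Measurable Complex.polarCoord.symm := by
          have : ⇑Complex.polarCoord.symm =
              fun p : ℝ × ℝ => (p.1 * (Real.cos p.2 + Real.sin p.2 * Complex.I) : ℂ) :=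
            funext Complex.polarCoord_symm_apply
          rw [this]
          fun_prop
        rw [polarCoord_target, Measure.volume_eq_prod, ← Measure.prod_restrict, lintegral_prod]
        · refine lintegral_congr fun r => ?_
          simp only [smul_eq_mul]
          rw [lintegral_const_mul]
          fun_prop
        · simp only [smul_eq_mul]
          fun_prop
    _ = ∫⁻ z in ball c R, ‖f z‖ₑ := by
        rw [Complex.lintegral_comp_polarCoord_symm (fun w => ‖F (c + w)‖ₑ),
          lintegral_add_left_eq_self (fun w => ‖F w‖ₑ) c, ← lintegral_indicator measurableSet_ball]
        refine lintegral_congr fun z => ?_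
        by_cases hz : z ∈ ball c R <;> simp [hF, hz]

open Filter Topology Set in
/-- If `exp g` is square-integrable on the punctured unit disk against a power weight, then
`exp (2 * g)` has at most polynomial growth at the puncture. -/
theorem exists_norm_exp_mul_pow_le {γ : ℝ} {g : ℂ → ℂ}
    (hg : DifferentiableOn ℂ g (ball (0 : ℂ) 1 \ {0}))
    (hint : ∫⁻ z in ball (0 : ℂ) 1,
      ENNReal.ofReal (‖z‖ ^ (2 * γ) * ‖Complex.exp (g z)‖ ^ 2) < ⊤) :
    ∃ (N : ℕ) (K : ℝ), N ≠ 0 ∧ ∀ c : ℂ, c ≠ 0 → ‖c‖ < 1 / 2 →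
      ‖Complex.exp (g c)‖ ^ 2 * ‖c‖ ^ N ≤ K := by
  obtain ⟨m, hm⟩ := exists_nat_ge (2 * γ)
  set I := ∫⁻ z in ball (0 : ℂ) 1,
      ENNReal.ofReal (‖z‖ ^ (2 * γ) * ‖Complex.exp (g z)‖ ^ 2)
  refine ⟨m + 2, I.toReal * 2 ^ (m + 2), by omega, fun c hc hc2 => ?_⟩
  have hc0 : 0 < ‖c‖ := norm_pos_iff.2 hc
  set R := ‖c‖ / 2 with hR
  have hnorm : ∀ z ∈ ball c R, R ≤ ‖z‖ ∧ ‖z‖ < 1 := fun z hz => by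
    rw [mem_ball, dist_eq_norm] at hz
    have h1 := norm_sub_norm_le c z
    have h2 := norm_sub_norm_le z c
    rw [norm_sub_rev] at h1
    constructor <;> linarith
  have hsub : ball c R ⊆ ball (0 : ℂ) 1 \ {0} := fun z hz => by
    refine ⟨by simpa using (hnorm z hz).2, fun h => ?_⟩
    have := (hnorm z hz).1
    rw [mem_singleton_iff.1 h, norm_zero] at this
    linarith
  have hmean := ofReal_sq_mul_enorm_le_lintegral_ball (f := fun z => Complex.exp (g z) ^ 2)
    (c := c) (R := R) (half_pos hc0) ((hg.mono hsub).cexp.pow 2)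
  have hle : ENNReal.ofReal (R ^ m) * ∫⁻ z in ball c R, ‖Complex.exp (g z) ^ 2‖ₑ ≤ I := by
    rw [← lintegral_const_mul' _ _ ENNReal.ofReal_ne_top]
    refine (setLIntegral_mono' measurableSet_ball fun z hz => ?_).trans
      (lintegral_mono_set (hsub.trans sdiff_subset))
    obtain ⟨h1, h2⟩ := hnorm z hz
    have hz0 : 0 < ‖z‖ := by linarith
    rw [← ofReal_norm, ← ENNReal.ofReal_mul (by positivity), norm_pow]
    refine ENNReal.ofReal_le_ofReal (mul_le_mul_of_nonneg_right ?_ (by positivity))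
    calc R ^ m ≤ ‖z‖ ^ m := by gcongr
      _ = ‖z‖ ^ (m : ℝ) := (Real.rpow_natCast _ _).symm
      _ ≤ ‖z‖ ^ (2 * γ) := Real.rpow_le_rpow_of_exponent_ge hz0 h2.le hm
  have hfin : ENNReal.ofReal (R ^ (m + 2) * ‖Complex.exp (g c)‖ ^ 2) ≤ I := by
    refine le_trans ?_ ((mul_le_mul_right hmean _).trans hle)
    rw [← ofReal_norm, ← ENNReal.ofReal_mul (by positivity),
      ← ENNReal.ofReal_mul (by positivity), norm_pow, pow_add, mul_assoc]
  have hreal := (ENNReal.ofReal_le_iff_le_toReal hint.ne).1 hfin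
  calc ‖Complex.exp (g c)‖ ^ 2 * ‖c‖ ^ (m + 2)
      = R ^ (m + 2) * ‖Complex.exp (g c)‖ ^ 2 * 2 ^ (m + 2) := by
        rw [hR, div_pow]; field_simp
    _ ≤ _ := by gcongr

open Filter Topology Set in
/-- If `exp g` has at most polynomial growth at an isolated singularity of `g`, then the real part
of `g` is bounded above near it. -/
theorem exists_eventually_re_le_of_norm_exp_mul_pow_le {g : ℂ → ℂ} {N : ℕ} {K : ℝ} (hN : N ≠ 0)
    (hd : ∀ᶠ z in 𝓝[≠] (0 : ℂ), DifferentiableAt ℂ g z)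
    (hK : ∀ᶠ z in 𝓝[≠] (0 : ℂ), ‖Complex.exp (g z)‖ ^ 2 * ‖z‖ ^ N ≤ K) :
    ∃ M : ℝ, ∀ᶠ z in 𝓝[≠] (0 : ℂ), (g z).re ≤ M := by
  set h : ℂ → ℂ := fun z => Complex.exp (g z / N) with hh
  have hpow : ∀ z, h z ^ N = Complex.exp (g z) := fun z => by
    rw [hh, ← Complex.exp_nat_mul, mul_div_cancel₀ _ (Nat.cast_ne_zero.2 hN)]
  have hbound : ∀ᶠ z in 𝓝[≠] (0 : ℂ), ‖h z * z‖ ^ 2 ≤ max K 1 * ‖z‖ := by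
    filter_upwards [hK] with z hz
    have h1 : ‖h z‖ ^ 2 * ‖z‖ ≤ max K 1 := by
      by_contra! hlt
      rw [max_lt_iff] at hlt
      have := le_self_pow₀ hlt.2.le hN
      rw [mul_pow, ← pow_mul, mul_comm 2, pow_mul, ← norm_pow (h z) N, hpow] at this
      linarith
    calc ‖h z * z‖ ^ 2 = ‖h z‖ ^ 2 * ‖z‖ * ‖z‖ := by rw [norm_mul]; ring
      _ ≤ _ := by gcongr
  have ht : Tendsto (fun z => h z * z) (𝓝[≠] 0) (𝓝 0) := by
    have h0 : Tendsto (fun z : ℂ => max K 1 * ‖z‖) (𝓝[≠] 0) (𝓝 0) := by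
      have : ContinuousAt (fun z : ℂ => max K 1 * ‖z‖) 0 := by fun_prop
      simpa using this.tendsto.mono_left (nhdsWithin_le_nhds (s := {0}ᶜ))
    have h2 := (squeeze_zero' (.of_forall fun z => by positivity) hbound h0).sqrt
    rw [tendsto_zero_iff_norm_tendsto_zero]
    simpa [Real.sqrt_sq_eq_abs] using h2
  have ho : h =o[𝓝[≠] (0 : ℂ)] fun z => (z - 0)⁻¹ := by
    rw [Asymptotics.isLittleO_iff_tendsto']
    · simpa using ht
    · filter_upwards [self_mem_nhdsWithin] with z hz hz0
      simp_all
  have hconst : (fun _ : ℂ => h 0) =o[𝓝[≠] (0 : ℂ)] fun z => (z - 0)⁻¹ :=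
    IsBoundedUnder.isLittleO_sub_self_inv ⟨‖h 0‖, by simp⟩
  have hlim := Complex.tendsto_limUnder_of_differentiable_on_punctured_nhds_of_isLittleO
    (hd.mono fun z hz => (hz.div_const (N : ℂ)).cexp) (ho.sub hconst)
  set B := ‖limUnder (𝓝[≠] 0) h‖ + 1
  have hB : ∀ᶠ z in 𝓝[≠] (0 : ℂ), ‖h z‖ < B := hlim.norm.eventually_lt_const (lt_add_one _)
  refine ⟨N * Real.log B, hB.mono fun z hz => ?_⟩
  have hN' : (0 : ℝ) < N := by positivity
  rw [hh, Complex.norm_exp, Complex.div_natCast_re, ← Real.lt_log_iff_exp_lt (by positivity)] at hz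
  rw [← div_le_iff₀' hN']
  exact hz.le

/-- Part (b) of the proof of Lemma 2.1: if g is holomorphic on the punctured unit disk
and ∬_𝔻 |z|^{2γ}·|e^{g(z)}|² dxdy < ∞ for some γ ∈ ℝ, then the singularity of g at
z = 0 is removable, i.e. g extends holomorphically to all of 𝔻. -/
theorem removable_singularity_of_integrable (γ : ℝ) (g : ℂ → ℂ)
    (hg : DifferentiableOn ℂ g (ball (0 : ℂ) 1 \ {0}))
    (hint : ∫⁻ z in ball (0 : ℂ) 1,
      ENNReal.ofReal (‖z‖ ^ (2 * γ) * ‖Complex.exp (g z)‖ ^ 2) < ⊤) :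
    ∃ G : ℂ → ℂ, DifferentiableOn ℂ G (ball (0 : ℂ) 1) ∧
      ∀ z ∈ ball (0 : ℂ) 1 \ {0}, G z = g z := by
  have hd : ∀ᶠ z in nhdsWithin (0 : ℂ) {0}ᶜ, DifferentiableAt ℂ g z := by
    have hopen : IsOpen (ball (0 : ℂ) 1 \ {0}) := isOpen_ball.sdiff isClosed_singleton
    filter_upwards [sdiff_mem_nhdsWithin_compl (ball_mem_nhds (0 : ℂ) one_pos) {0}] with z hz
    exact hg.differentiableAt (hopen.mem_nhds hz)
  obtain ⟨N, K, hN, hK⟩ := exists_norm_exp_mul_pow_le hg hint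
  obtain ⟨M, hM⟩ := exists_eventually_re_le_of_norm_exp_mul_pow_le (K := K) hN hd <| by
    filter_upwards [sdiff_mem_nhdsWithin_compl (ball_mem_nhds (0 : ℂ) one_half_pos) {0}] with z hz
    exact hK z hz.2 (by simpa using hz.1)
  obtain ⟨l, hl⟩ := exists_tendsto_of_eventually_re_le hd hM
  refine ⟨Function.update g 0 l, ?_, fun z hz => Function.update_of_ne hz.2 _ _⟩
  rw [← Complex.differentiableOn_compl_singleton_and_continuousAt_iff
    (ball_mem_nhds (0 : ℂ) one_pos)]
  exact ⟨hg.congr fun z hz => Function.update_of_ne hz.2 _ _, continuousAt_update_same.2 hl⟩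
end
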